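/- Let n ≥ 2, p ≥ 1 and λ ∈ (1, ∞), and set λ' = λ/(λ−1). A nonzero nonnegative continuous function f : ℝⁿ → ℝ with compact support satisfies equality in the symmetric functional Blaschke–Santaló inequality ‖f‖₁^{n+λ'p} ≤ 2^{−n} b_{n,p,λ} ‖f‖_λ^{λ'p} ( ∫_{S^{n−1}} ( ∫_{ℝⁿ} f(x) |⟨x,ξ⟩|^p dx )^{−n/p} dξ )^{−p} if and only if there exist a > 0 and an invertible n×n matrix B such that f(x) = a (1 − |Bx|^p)₊^{1/(λ−1)} for all x ∈ ℝⁿ, where t₊ = max{t,0}. -/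

import Mathlib

open MeasureTheory Real
open scoped RealInnerProductSpace

/-- The constant `R_{n,p}` from the Haberl–Schuster asymmetric `L_p` Blaschke–Santaló
inequality: the value of the sharp bound, attained for the Euclidean ball. -/
noncomputable def Rnp (n : ℕ) (p : ℝ) : ℝ :=
  Real.pi ^ ((n : ℝ) / (2 * p) + n) / (Real.Gamma (((n : ℝ) + 2) / 2)) ^ (2 : ℕ) *
    (2 * Real.Gamma (((n : ℝ) + p + 2) / 2) /
      (Real.Gamma (((n : ℝ) + 2) / 2) * Real.Gamma ((p + 1) / 2))) ^ ((n : ℝ) / p)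

/-- The constant `a_{n,p,λ}` for `λ > 1`, with `λ' = λ/(λ-1)`; here
`B(m,l) = Γ(m)Γ(l)/Γ(m+l)` is the Beta function. -/
noncomputable def anpl (n : ℕ) (p lam : ℝ) : ℝ :=
  (((n : ℝ) / p) * ((n : ℝ) / ((lam / (lam - 1)) * p) + 1) ^ (lam / (lam - 1) - 1) *
      ((lam / (lam - 1)) * p / (n : ℝ) + 1) ^ ((n : ℝ) / p) *
      (Real.Gamma ((n : ℝ) / p) * Real.Gamma (lam / (lam - 1)) /
        Real.Gamma ((n : ℝ) / p + lam / (lam - 1)))) ^ p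

/-- The constant `b_{n,p,λ} = (n/(n+p))^n a_{n,p,λ} R_{n,p}^p n^p` for `λ > 1`. -/
noncomputable def bnpl (n : ℕ) (p lam : ℝ) : ℝ :=
  ((n : ℝ) / ((n : ℝ) + p)) ^ (n : ℝ) * anpl n p lam * Rnp n p ^ p * (n : ℝ) ^ p

/-- Application of an `n × n` real matrix to a point of `EuclideanSpace ℝ (Fin n)`. -/
noncomputable def matApply {n : ℕ} (B : Matrix (Fin n) (Fin n) ℝ)
    (x : EuclideanSpace ℝ (Fin n)) : EuclideanSpace ℝ (Fin n) :=
  (EuclideanSpace.equiv (Fin n) ℝ).symm (B.mulVec (EuclideanSpace.equiv (Fin n) ℝ x))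

open scoped ENNReal Pointwise in
/-- One-dimensional Brunn–Minkowski inequality for compact sets. -/
lemma volume_add_volume_le_volume_add {A B : Set ℝ} (hA : IsCompact A) (hB : IsCompact B)
    (hA' : A.Nonempty) (hB' : B.Nonempty) : volume A + volume B ≤ volume (A + B) := by
  obtain ⟨a, haA, ha⟩ := hA.exists_isGreatest hA'
  obtain ⟨b, hbB, hb⟩ := hB.exists_isLeast hB'
  have h1 : (fun x => x + b) '' A ∪ (fun x => a + x) '' B ⊆ A + B := by
    rintro _ (⟨x, hx, rfl⟩ | ⟨x, hx, rfl⟩)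
    · exact Set.add_mem_add hx hbB
    · exact Set.add_mem_add haA hx
  have hmB : MeasurableSet ((fun x => a + x) '' B) :=
    (hB.image (by fun_prop)).measurableSet
  have h2 : AEDisjoint volume ((fun x => x + b) '' A) ((fun x => a + x) '' B) := by
    refine measure_mono_null (t := {a + b}) ?_ (by simp)
    rintro _ ⟨⟨x, hx, rfl⟩, ⟨y, hy, hxy⟩⟩
    have h3 := ha hx
    have h4 := hb hy
    simp only [Set.mem_singleton_iff] at *
    linarith
  calc volume A + volume B = volume ((fun x => x + b) '' A) + volume ((fun x => a + x) '' B) := by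
        simp
    _ = volume ((fun x => x + b) '' A ∪ (fun x => a + x) '' B) :=
        (measure_union₀ hmB.nullMeasurableSet h2).symm
    _ ≤ _ := measure_mono h1

open scoped ENNReal Pointwise in
lemma volume_add_volume_le_two_mul_of_midpoint_mem {A B C : Set ℝ} (hA : MeasurableSet A)
    (hB : MeasurableSet B) (hA' : A.Nonempty) (hB' : B.Nonempty)
    (hC : ∀ x ∈ A, ∀ y ∈ B, (x + y) / 2 ∈ C) : volume A + volume B ≤ 2 * volume C := by
  have key : ∀ K ⊆ A, IsCompact K → ∀ K' ⊆ B, IsCompact K' →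
      volume K + volume K' ≤ 2 * volume C := by
    intro K hK hKc K' hK' hKc'
    obtain ⟨a, ha⟩ := hA'
    obtain ⟨b, hb⟩ := hB'
    have h1 := volume_add_volume_le_volume_add (hKc.insert a) (hKc'.insert b)
      ⟨a, by simp⟩ ⟨b, by simp⟩
    have h2 : insert a K + insert b K' ⊆ (2 : ℝ) • C := by
      rintro _ ⟨x, hx, y, hy, rfl⟩
      have hx' : x ∈ A := by
        rcases hx with rfl | hx
        exacts [ha, hK hx]
      have hy' : y ∈ B := by
        rcases hy with rfl | hy
        exacts [hb, hK' hy]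
      exact ⟨_, hC x hx' y hy', by simp; ring⟩
    calc volume K + volume K' ≤ volume (insert a K) + volume (insert b K') := by
          gcongr <;> exact Set.subset_insert _ _
      _ ≤ _ := h1
      _ ≤ _ := measure_mono h2
      _ = 2 * volume C := by
          rw [Measure.addHaar_smul]; simp
  rw [hA.measure_eq_iSup_isCompact, hB.measure_eq_iSup_isCompact]
  simp only [iSup_subtype']
  have : Nonempty {K : Set ℝ // K ⊆ A ∧ IsCompact K} := ⟨⟨∅, by simp⟩⟩
  have : Nonempty {K : Set ℝ // K ⊆ B ∧ IsCompact K} := ⟨⟨∅, by simp⟩⟩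
  have e1 : (⨆ K, ⨆ (_ : K ⊆ A), ⨆ (_ : IsCompact K), volume K)
      = ⨆ K : {K : Set ℝ // K ⊆ A ∧ IsCompact K}, volume K.1 := by
    simp [iSup_subtype, iSup_and]
  have e2 : (⨆ K, ⨆ (_ : K ⊆ B), ⨆ (_ : IsCompact K), volume K)
      = ⨆ K : {K : Set ℝ // K ⊆ B ∧ IsCompact K}, volume K.1 := by
    simp [iSup_subtype, iSup_and]
  simp only [iSup_subtype'] at e1 e2
  rw [e1, e2]
  exact ENNReal.iSup_add_iSup_le fun K K' => key K.1 K.2.1 K.2.2 K'.1 K'.2.1 K'.2.2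

open scoped ENNReal in
lemma lintegral_eq_lintegral_Ioo_meas_lt {g : ℝ → ℝ≥0∞} (hg : Measurable g) (h1 : ∀ x, g x ≤ 1) :
    ∫⁻ x, g x = ∫⁻ τ in Set.Ioo (0 : ℝ) 1, volume {x | ENNReal.ofReal τ < g x} := by
  have hfin : ∀ x, g x ≠ ∞ := fun x => ((h1 x).trans_lt ENNReal.one_lt_top).ne
  have h := lintegral_eq_lintegral_meas_lt (volume : Measure ℝ) (f := fun x => (g x).toReal)
    (Filter.Eventually.of_forall fun x => ENNReal.toReal_nonneg) hg.ennreal_toReal.aemeasurable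
  simp only [ENNReal.ofReal_toReal (hfin _)] at h
  rw [h]
  have h2 : Set.Ioi (0 : ℝ) = Set.Ioo 0 1 ∪ Set.Ici 1 := by
    ext x; simp only [Set.mem_Ioi, Set.mem_union, Set.mem_Ioo, Set.mem_Ici]
    constructor
    · intro hx; rcases lt_or_ge x 1 with h | h
      exacts [Or.inl ⟨hx, h⟩, Or.inr h]
    · rintro (h | h) <;> linarith [h]
  rw [h2, lintegral_union measurableSet_Ici]
  · have h3 : ∫⁻ t in Set.Ici (1 : ℝ), volume {a : ℝ | t < (g a).toReal} = 0 := by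
      rw [setLIntegral_congr_fun (g := fun _ => 0) measurableSet_Ici]
      · simp
      · intro t ht
        have : {a : ℝ | t < (g a).toReal} = ∅ := by
          ext a
          have : (g a).toReal ≤ 1 := ENNReal.toReal_le_of_le_ofReal zero_le_one (by simpa using h1 a)
          simp only [Set.mem_ofPred_eq, Set.mem_empty_iff_false, iff_false, not_lt]
          exact this.trans ht
        simp [this]
    rw [h3, add_zero]
    refine setLIntegral_congr_fun measurableSet_Ioo fun t ht => ?_
    congr 1
    ext a
    simp only [Set.mem_ofPred_eq]
    rw [ENNReal.ofReal_lt_iff_lt_toReal ht.1.le (hfin a)]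
  · rw [Set.disjoint_left]; rintro x ⟨_, h⟩ h'; exact absurd h (not_lt.2 h')

open scoped ENNReal in
/-- The additive one-dimensional Prékopa–Leindler inequality for functions with supremum `1`. -/
lemma lintegral_add_le_of_iSup_eq_one {u v h : ℝ → ℝ≥0∞} (hu : Measurable u) (hv : Measurable v)
    (hh : Measurable h) (hu1 : ⨆ x, u x = 1) (hv1 : ⨆ x, v x = 1)
    (H : ∀ x y, u x * v y ≤ h ((x + y) / 2) ^ 2) :
    (∫⁻ x, u x) + ∫⁻ x, v x ≤ 2 * ∫⁻ x, h x := by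
  have hu' : ∀ x, u x ≤ 1 := fun x => hu1 ▸ le_iSup u x
  have hv' : ∀ x, v x ≤ 1 := fun x => hv1 ▸ le_iSup v x
  have hm : Measurable fun x => min (h x) 1 := hh.min measurable_const
  calc (∫⁻ x, u x) + ∫⁻ x, v x
      = ∫⁻ τ in Set.Ioo (0 : ℝ) 1, (volume {x | ENNReal.ofReal τ < u x} +
          volume {x | ENNReal.ofReal τ < v x}) := by
        rw [lintegral_eq_lintegral_Ioo_meas_lt hu hu', lintegral_eq_lintegral_Ioo_meas_lt hv hv',
          lintegral_add_left]
        refine Antitone.measurable fun a b hab => measure_mono fun x hx => ?_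
        exact (ENNReal.ofReal_le_ofReal hab).trans_lt hx
    _ ≤ ∫⁻ τ in Set.Ioo (0 : ℝ) 1, 2 * volume {x | ENNReal.ofReal τ < min (h x) 1} := by
        refine setLIntegral_mono' measurableSet_Ioo fun τ hτ => ?_
        have hτ1 : ENNReal.ofReal τ < 1 := by
          rw [ENNReal.ofReal_lt_one]; exact hτ.2
        refine volume_add_volume_le_two_mul_of_midpoint_mem (measurableSet_lt measurable_const hu)
          (measurableSet_lt measurable_const hv) ?_ ?_ ?_
        · exact lt_iSup_iff.1 (hu1 ▸ hτ1)
        · exact lt_iSup_iff.1 (hv1 ▸ hτ1)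
        · intro x hx y hy
          refine lt_min ?_ hτ1
          by_contra hcon
          have h1 : h ((x + y) / 2) ^ 2 ≤ ENNReal.ofReal τ ^ 2 := by gcongr; exact not_lt.1 hcon
          have h2 : ENNReal.ofReal τ ^ 2 < u x * v y := by
            rw [sq]; exact ENNReal.mul_lt_mul hx hy
          exact absurd ((H x y).trans h1) (not_le.2 h2)
    _ = 2 * ∫⁻ x, min (h x) 1 := by
        rw [lintegral_const_mul', lintegral_eq_lintegral_Ioo_meas_lt hm fun x => min_le_right _ _]
        simp
    _ ≤ _ := by
        gcongr; exact min_le_left _ _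

open scoped ENNReal in
lemma ENNReal.four_mul_mul_le_sq_add (a b : ℝ≥0∞) : 4 * (a * b) ≤ (a + b) ^ 2 := by
  by_cases ha : a = ∞
  · simp [ha]
  by_cases hb : b = ∞
  · simp [hb]
  lift a to NNReal using ha
  lift b to NNReal using hb
  norm_cast
  rw [← NNReal.coe_le_coe]
  push_cast
  nlinarith [sq_nonneg ((a : ℝ) - b)]

open scoped ENNReal in
/-- One-dimensional Prékopa–Leindler inequality (with equal weights). -/
lemma lintegral_mul_lintegral_le_sq_real {u v h : ℝ → ℝ≥0∞} (hu : Measurable u)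
    (hv : Measurable v) (hh : Measurable h) (H : ∀ x y, u x * v y ≤ h ((x + y) / 2) ^ 2) :
    (∫⁻ x, u x) * ∫⁻ x, v x ≤ (∫⁻ x, h x) ^ 2 := by
  have bdd : ∀ u v : ℝ → ℝ≥0∞, Measurable u → Measurable v → (⨆ x, u x) ≠ ∞ → (⨆ x, v x) ≠ ∞ →
      (∀ x y, u x * v y ≤ h ((x + y) / 2) ^ 2) →
      (∫⁻ x, u x) * ∫⁻ x, v x ≤ (∫⁻ x, h x) ^ 2 := by
    intro u v hu hv hau hbv H
    set a := ⨆ x, u x with ha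
    set b := ⨆ x, v x with hb
    by_cases ha0 : a = 0
    · have : u = 0 := by
        ext x; simpa using (le_iSup u x).trans_eq (ha.symm.trans ha0)
      simp [this]
    by_cases hb0 : b = 0
    · have : v = 0 := by
        ext x; simpa using (le_iSup v x).trans_eq (hb.symm.trans hb0)
      simp [this]
    set c : ℝ≥0∞ := (a * b) ^ (1 / 2 : ℝ) with hc
    have hc2 : c ^ 2 = a * b := by
      rw [hc, ← ENNReal.rpow_natCast, ← ENNReal.rpow_mul]; norm_num
    have hab0 : a * b ≠ 0 := mul_ne_zero ha0 hb0
    have habt : a * b ≠ ∞ := ENNReal.mul_ne_top hau hbv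
    have hc0 : c ≠ 0 := by
      intro h0; rw [h0] at hc2; exact hab0 (by simpa using hc2.symm)
    have hct : c ≠ ∞ := by
      intro h0; rw [h0] at hc2; exact habt (by simpa using hc2.symm)
    have h1 := lintegral_add_le_of_iSup_eq_one (u := fun x => a⁻¹ * u x) (v := fun x => b⁻¹ * v x)
      (h := fun x => c⁻¹ * h x) (hu.const_mul _) (hv.const_mul _) (hh.const_mul _)
      (by rw [← ENNReal.mul_iSup]; exact ENNReal.inv_mul_cancel ha0 hau)
      (by rw [← ENNReal.mul_iSup]; exact ENNReal.inv_mul_cancel hb0 hbv)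
      (by
        intro x y
        calc a⁻¹ * u x * (b⁻¹ * v y) = (a⁻¹ * b⁻¹) * (u x * v y) := by ring
          _ ≤ (a⁻¹ * b⁻¹) * h ((x + y) / 2) ^ 2 := by gcongr; exact H x y
          _ = _ := by
            rw [mul_pow, ← ENNReal.inv_pow, hc2, ENNReal.mul_inv (Or.inl ha0) (Or.inl hau)])
    rw [lintegral_const_mul _ hu, lintegral_const_mul _ hv, lintegral_const_mul _ hh] at h1
    have h2 := ENNReal.four_mul_mul_le_sq_add (a⁻¹ * ∫⁻ x, u x) (b⁻¹ * ∫⁻ x, v x)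
    have h3 : 4 * (a⁻¹ * (∫⁻ x, u x) * (b⁻¹ * ∫⁻ x, v x)) ≤ (2 * (c⁻¹ * ∫⁻ x, h x)) ^ 2 :=
      h2.trans (by gcongr)
    have h4 : (a * b)⁻¹ * (4 * ((∫⁻ x, u x) * ∫⁻ x, v x)) ≤ (a * b)⁻¹ * (4 * (∫⁻ x, h x) ^ 2) := by
      calc (a * b)⁻¹ * (4 * ((∫⁻ x, u x) * ∫⁻ x, v x))
          = 4 * (a⁻¹ * (∫⁻ x, u x) * (b⁻¹ * ∫⁻ x, v x)) := by
            rw [ENNReal.mul_inv (Or.inl ha0) (Or.inl hau)]; ring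
        _ ≤ _ := h3
        _ = _ := by
            rw [mul_pow, mul_pow, ← ENNReal.inv_pow, hc2]; ring
    rw [ENNReal.mul_le_mul_iff_right (ENNReal.inv_ne_zero.2 habt) (ENNReal.inv_ne_top.2 hab0),
      ENNReal.mul_le_mul_iff_right (by norm_num) (by norm_num)] at h4
    exact h4
  have trunc : ∀ w : ℝ → ℝ≥0∞, Measurable w → ∫⁻ x, w x = ⨆ k : ℕ, ∫⁻ x, min (w x) k := by
    intro w hw
    rw [← lintegral_iSup]
    · congr 1; ext x
      apply le_antisymm
      · refine le_of_forall_lt fun y hy => ?_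
        obtain ⟨k, hk⟩ := ENNReal.exists_nat_gt (hy.ne_top)
        exact lt_iSup_iff.2 ⟨k, lt_min hy hk⟩
      · exact iSup_le fun k => min_le_left _ _
    · exact fun k => hw.min measurable_const
    · intro k l hkl x
      exact min_le_min_left _ (by exact_mod_cast hkl)
  rw [trunc u hu, trunc v hv, ENNReal.iSup_mul]
  refine iSup_le fun k => ?_
  rw [ENNReal.mul_iSup]
  refine iSup_le fun l => ?_
  refine bdd _ _ (hu.min measurable_const) (hv.min measurable_const) ?_ ?_ ?_
  · exact ((iSup_le fun x => min_le_right _ _).trans_lt (ENNReal.natCast_lt_top k)).ne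
  · exact ((iSup_le fun x => min_le_right _ _).trans_lt (ENNReal.natCast_lt_top l)).ne
  · exact fun x y => (mul_le_mul' (min_le_left _ _) (min_le_left _ _)).trans (H x y)

open scoped ENNReal in
lemma lintegral_fin_succ {d : ℕ} {u : (Fin (d + 1) → ℝ) → ℝ≥0∞} (hu : Measurable u) :
    ∫⁻ x, u x = ∫⁻ s, ∫⁻ y, u (Fin.cons s y) := by
  have e := (volume_preserving_piFinSuccAbove (fun _ : Fin (d + 1) => ℝ) 0).symm
  rw [← e.lintegral_comp hu, Measure.volume_eq_prod]
  have h0 : ∀ (s : ℝ) (y : Fin d → ℝ), (Fin.cons s y : Fin (d + 1) → ℝ) =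
      (MeasurableEquiv.piFinSuccAbove (fun _ : Fin (d + 1) => ℝ) 0).symm (s, y) := by
    intro s y
    simp [MeasurableEquiv.piFinSuccAbove, Fin.insertNthEquiv]
  simp only [h0]
  exact lintegral_prod (μ := volume) (ν := volume) (fun q : ℝ × (Fin d → ℝ) =>
    u ((MeasurableEquiv.piFinSuccAbove (fun _ : Fin (d + 1) => ℝ) 0).symm q))
    (hu.comp e.measurable).aemeasurable

open scoped ENNReal in
/-- The Prékopa–Leindler inequality on `ℝ^d` (with equal weights). -/
theorem lintegral_mul_lintegral_le_sq {d : ℕ} {u v h : (Fin d → ℝ) → ℝ≥0∞} (hu : Measurable u)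
    (hv : Measurable v) (hh : Measurable h)
    (H : ∀ x y, u x * v y ≤ h ((2⁻¹ : ℝ) • (x + y)) ^ 2) :
    (∫⁻ x, u x) * ∫⁻ x, v x ≤ (∫⁻ x, h x) ^ 2 := by
  induction d with
  | zero =>
    have e : ∀ w : (Fin 0 → ℝ) → ℝ≥0∞, ∫⁻ x, w x = w default := fun w => by
      have h1 : (volume : Measure (Fin 0 → ℝ)) Set.univ = 1 := by simp [volume_pi]
      rw [lintegral_unique, h1, mul_one]
      exact congrArg w (Subsingleton.elim _ _)
    rw [e, e, e]
    convert H default default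
  | succ d ih =>
    have hc : Measurable fun q : ℝ × (Fin d → ℝ) => (Fin.cons q.1 q.2 : Fin (d + 1) → ℝ) :=
      measurable_pi_iff.2 fun i => Fin.cases measurable_fst
        (fun j => (measurable_pi_apply j).comp measurable_snd) i
    rw [lintegral_fin_succ hu, lintegral_fin_succ hv, lintegral_fin_succ hh]
    refine lintegral_mul_lintegral_le_sq_real (hu.comp hc).lintegral_prod_right'
      (hv.comp hc).lintegral_prod_right' (hh.comp hc).lintegral_prod_right' fun s t => ?_
    refine ih (hu.comp (hc.comp measurable_prodMk_left)) (hv.comp (hc.comp measurable_prodMk_left))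
      (hh.comp (hc.comp measurable_prodMk_left)) fun x y => ?_
    convert H (Fin.cons s x) (Fin.cons t y) using 3
    ext i
    refine Fin.cases ?_ (fun j => ?_) i
    · simp; ring
    · simp; ring

local notation "𝔼" n:max => EuclideanSpace ℝ (Fin n)

/-- `N` is a norm on `ℝⁿ`. -/
structure IsNorm {n : ℕ} (N : EuclideanSpace ℝ (Fin n) → ℝ) : Prop where
  add_le : ∀ x y, N (x + y) ≤ N x + N y
  smul : ∀ (c : ℝ) x, N (c • x) = |c| * N x
  pos : ∀ x, x ≠ 0 → 0 < N x

namespace IsNorm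

variable {n : ℕ} {N : 𝔼 n → ℝ}

lemma zero (h : IsNorm N) : N 0 = 0 := by simpa using h.smul 0 0

lemma nonneg (h : IsNorm N) (x : 𝔼 n) : 0 ≤ N x := by
  by_cases hx : x = 0
  · rw [hx, h.zero]
  · exact (h.pos x hx).le

lemma neg (h : IsNorm N) (x : 𝔼 n) : N (-x) = N x := by simpa using h.smul (-1) x

lemma sub_le (h : IsNorm N) (x y : 𝔼 n) : N x - N y ≤ N (x - y) := by
  have := h.add_le (x - y) y
  simp only [sub_add_cancel] at this
  linarith

lemma exists_le (h : IsNorm N) : ∃ C, 0 < C ∧ ∀ x, N x ≤ C * ‖x‖ := by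
  refine ⟨1 + ∑ i, N (EuclideanSpace.single i 1), ?_, fun x => ?_⟩
  · have : 0 ≤ ∑ i, N (EuclideanSpace.single i (1 : ℝ)) := Finset.sum_nonneg fun i _ => h.nonneg _
    linarith
  · have hx : x = ∑ i, x i • EuclideanSpace.single i (1 : ℝ) := by
      ext j; simp [Finset.sum_apply, Pi.single_apply]
    calc N x = N (∑ i, x i • EuclideanSpace.single i (1 : ℝ)) := by rw [← hx]
      _ ≤ ∑ i, N (x i • EuclideanSpace.single i (1 : ℝ)) :=
        Finset.le_sum_of_subadditive N h.zero.le h.add_le _ _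
      _ ≤ ∑ i, ‖x‖ * N (EuclideanSpace.single i (1 : ℝ)) := by
        refine Finset.sum_le_sum fun i _ => ?_
        rw [h.smul]
        exact mul_le_mul_of_nonneg_right (by simpa using PiLp.norm_apply_le x i) (h.nonneg _)
      _ ≤ _ := by
        rw [← Finset.mul_sum]; nlinarith [norm_nonneg x]

lemma continuous (h : IsNorm N) : Continuous N := by
  obtain ⟨C, hC, hN⟩ := h.exists_le
  refine (LipschitzWith.of_dist_le_mul (K := C.toNNReal) fun x y => ?_).continuous
  rw [Real.coe_toNNReal _ hC.le, Real.dist_eq, dist_eq_norm, abs_le]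
  have h1 := h.sub_le x y
  have h2 := h.sub_le y x
  have h3 := hN (x - y)
  have h4 : N (y - x) = N (x - y) := by rw [← h.neg, neg_sub]
  constructor <;> linarith

lemma exists_ge (h : IsNorm N) : ∃ c, 0 < c ∧ ∀ x, c * ‖x‖ ≤ N x := by
  by_cases hs : (Metric.sphere (0 : 𝔼 n) 1).Nonempty
  · obtain ⟨x₀, hx₀, hmin⟩ := (isCompact_sphere (0 : 𝔼 n) 1).exists_isMinOn hs h.continuous.continuousOn
    have hx0 : x₀ ≠ 0 := by rintro rfl; simp at hx₀
    refine ⟨N x₀, h.pos _ hx0, fun x => ?_⟩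
    by_cases hx : x = 0
    · simp [hx, h.zero]
    have hx' : 0 < ‖x‖ := norm_pos_iff.2 hx
    have h1 : N x₀ ≤ N (‖x‖⁻¹ • x) := hmin (by simp [norm_smul, hx'.ne'])
    rw [h.smul, abs_of_pos (inv_pos.2 hx')] at h1
    rw [inv_mul_eq_div, le_div_iff₀ hx'] at h1
    exact h1
  · refine ⟨1, one_pos, fun x => ?_⟩
    by_cases hx : x = 0
    · simp [hx, h.zero]
    exact absurd ⟨‖x‖⁻¹ • x, by simp [norm_smul, hx]⟩ hs

lemma const_mul (h : IsNorm N) {c : ℝ} (hc : 0 < c) : IsNorm fun x => c * N x where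
  add_le x y := by have := h.add_le x y; nlinarith
  smul a x := by rw [h.smul]; ring
  pos x hx := mul_pos hc (h.pos x hx)

lemma comp_linearEquiv (h : IsNorm N) (A : 𝔼 n ≃ₗ[ℝ] 𝔼 n) : IsNorm fun x => N (A x) where
  add_le x y := by rw [map_add]; exact h.add_le _ _
  smul a x := by rw [map_smul, h.smul]
  pos x hx := h.pos _ (by simpa using hx)

lemma norm : IsNorm (fun x : 𝔼 n => ‖x‖) where
  add_le := norm_add_le
  smul c x := by rw [norm_smul, Real.norm_eq_abs]
  pos x hx := norm_pos_iff.2 hx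

lemma isClosed (h : IsNorm N) (r : ℝ) : IsClosed {x | N x ≤ r} :=
  isClosed_le h.continuous continuous_const

lemma isBounded (h : IsNorm N) (r : ℝ) : Bornology.IsBounded {x | N x ≤ r} := by
  obtain ⟨c, hc, hN⟩ := h.exists_ge
  refine (Metric.isBounded_closedBall (x := (0 : 𝔼 n)) (r := r / c)).subset fun x hx => ?_
  rw [mem_closedBall_zero_iff, le_div_iff₀ hc, mul_comm]
  exact (hN x).trans hx

lemma measurableSet (h : IsNorm N) (r : ℝ) : MeasurableSet {x | N x ≤ r} := (h.isClosed r).measurableSet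

lemma volume_lt_top (h : IsNorm N) (r : ℝ) : volume {x | N x ≤ r} < ⊤ :=
  (h.isBounded r).measure_lt_top

lemma volume_pos (h : IsNorm N) : 0 < volume {x | N x ≤ 1} := by
  refine lt_of_lt_of_le ?_ (measure_mono (s := {x | N x < 1}) fun x hx => (show N x ≤ 1 from le_of_lt hx))
  exact (isOpen_lt h.continuous continuous_const).measure_pos _ ⟨0, by simp [h.zero]⟩

end IsNorm

open scoped ENNReal in
/-- Integration in polar coordinates. -/
lemma lintegral_polar {n : ℕ} (hn : 0 < n) {f : 𝔼 n → ℝ≥0∞} (hf : Measurable f) :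
    ∫⁻ x, f x = ∫⁻ θ : Metric.sphere (0 : 𝔼 n) 1, ∫⁻ r in Set.Ioi (0 : ℝ),
      ENNReal.ofReal (r ^ ((n : ℝ) - 1)) * f (r • (θ : 𝔼 n))
        ∂volume ∂(volume : Measure (𝔼 n)).toSphere := by
  have : Nonempty (Fin n) := ⟨⟨0, hn⟩⟩
  have hmp := (volume : Measure (𝔼 n)).measurePreserving_homeomorphUnitSphereProd
  have h1 := hmp.symm (homeomorphUnitSphereProd (𝔼 n)).toMeasurableEquiv
  calc ∫⁻ x, f x = ∫⁻ x in ({0}ᶜ : Set (𝔼 n)), f x := by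
        rw [restrict_compl_singleton]
    _ = ∫⁻ x : ({0}ᶜ : Set (𝔼 n)), f x ∂(volume : Measure (𝔼 n)).comap (↑) := by
        rw [lintegral_subtype_comap (measurableSet_singleton _).compl]
    _ = ∫⁻ q, f ((homeomorphUnitSphereProd (𝔼 n)).symm q) ∂((volume : Measure (𝔼 n)).toSphere.prod
          (Measure.volumeIoiPow (Module.finrank ℝ (𝔼 n) - 1))) := by
        exact (h1.lintegral_comp (f := fun x => f x) (hf.comp measurable_subtype_coe)).symm
    _ = _ := by
        rw [lintegral_prod]
        · refine lintegral_congr fun θ => ?_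
          rw [Measure.volumeIoiPow, lintegral_withDensity_eq_lintegral_mul]
          · simp only [finrank_euclideanSpace, Fintype.card_fin, Pi.mul_apply,
              homeomorphUnitSphereProd_symm_apply_coe]
            rw [← lintegral_subtype_comap measurableSet_Ioi]
            refine lintegral_congr fun r => ?_
            rw [← Real.rpow_natCast, Nat.cast_sub hn, Nat.cast_one]
          · fun_prop
          · exact hf.comp (measurable_subtype_coe.comp
              ((homeomorphUnitSphereProd (𝔼 n)).symm.measurable.comp measurable_prodMk_left))
        · exact (hf.comp (measurable_subtype_coe.comp
            (homeomorphUnitSphereProd (𝔼 n)).symm.measurable)).aemeasurable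

open scoped ENNReal in
lemma setLIntegral_Ioi_comp_mul_left {a : ℝ} (ha : 0 < a) {G : ℝ → ℝ≥0∞} (hG : Measurable G) :
    ∫⁻ r in Set.Ioi (0 : ℝ), G (a * r) = ENNReal.ofReal a⁻¹ * ∫⁻ s in Set.Ioi (0 : ℝ), G s := by
  have h1 : ∫⁻ r, (Set.Ioi (0 : ℝ)).indicator G (a * r) =
      ENNReal.ofReal a⁻¹ * ∫⁻ s, (Set.Ioi (0 : ℝ)).indicator G s := by
    have hm := hG.indicator (measurableSet_Ioi (a := (0 : ℝ)))
    rw [← lintegral_map hm (measurable_const_mul a), Real.map_volume_mul_left ha.ne',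
      lintegral_smul_measure, abs_of_pos (inv_pos.2 ha), smul_eq_mul]
  rw [lintegral_indicator measurableSet_Ioi] at h1
  rw [← h1, ← lintegral_indicator measurableSet_Ioi]
  refine lintegral_congr fun r => ?_
  by_cases hr : 0 < r
  · simp [Set.indicator, hr, mul_pos ha hr]
  · have : ¬ 0 < a * r := by
      rw [mul_pos_iff_of_pos_left ha]; exact hr
    simp [Set.indicator, hr, this]

namespace IsNorm

variable {n : ℕ} {N : 𝔼 n → ℝ}

open scoped ENNReal in
/-- The integral of a homogeneous weight times a function of a norm, in polar coordinates. -/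
lemma lintegral_homogeneous_mul_comp (h : IsNorm N) (hn : 0 < n) {k : ℝ} {w : 𝔼 n → ℝ≥0∞}
    (hw : Measurable w) (hk : ∀ r : ℝ, 0 < r → ∀ x, w (r • x) = ENNReal.ofReal (r ^ k) * w x)
    {φ : ℝ → ℝ≥0∞} (hφ : Measurable φ) :
    ∫⁻ x, w x * φ (N x) =
      (∫⁻ θ : Metric.sphere (0 : 𝔼 n) 1, w θ * ENNReal.ofReal (N θ ^ (-((n : ℝ) + k)))
        ∂(volume : Measure (𝔼 n)).toSphere) *
      ∫⁻ s in Set.Ioi (0 : ℝ), ENNReal.ofReal (s ^ ((n : ℝ) - 1 + k)) * φ s := by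
  have hN := h.continuous.measurable
  rw [lintegral_polar (f := fun x => w x * φ (N x)) hn (hw.mul (hφ.comp hN)), ← lintegral_mul_const]
  swap
  · exact (hw.comp measurable_subtype_coe).mul
      ((hN.comp measurable_subtype_coe).pow_const _).ennreal_ofReal
  refine lintegral_congr fun θ => ?_
  have hθ : (θ : 𝔼 n) ≠ 0 := by
    have := θ.2; intro h0; rw [h0] at this; simp at this
  have ha := h.pos _ hθ
  set a := N θ with haa
  have hG : Measurable fun s : ℝ => ENNReal.ofReal (s ^ ((n : ℝ) - 1 + k)) * φ s := by fun_prop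
  have h2 := setLIntegral_Ioi_comp_mul_left ha hG
  calc ∫⁻ r in Set.Ioi (0 : ℝ), ENNReal.ofReal (r ^ ((n : ℝ) - 1)) *
        (w (r • (θ : 𝔼 n)) * φ (N (r • (θ : 𝔼 n))))
      = ∫⁻ r in Set.Ioi (0 : ℝ), (w θ * ENNReal.ofReal (a ^ (-((n : ℝ) - 1 + k)))) *
          (ENNReal.ofReal ((a * r) ^ ((n : ℝ) - 1 + k)) * φ (a * r)) := by
        refine setLIntegral_congr_fun measurableSet_Ioi fun r hr => ?_
        have hr' : 0 < r := hr
        have e1 : N (r • (θ : 𝔼 n)) = a * r := by rw [h.smul, abs_of_pos hr', mul_comm]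
        have e2 : r ^ ((n : ℝ) - 1) * r ^ k =
            a ^ (-((n : ℝ) - 1 + k)) * (a * r) ^ ((n : ℝ) - 1 + k) := by
          rw [Real.mul_rpow ha.le hr'.le, ← mul_assoc, ← Real.rpow_add ha, ← Real.rpow_add hr',
            neg_add_cancel, Real.rpow_zero, one_mul]
        simp only [e1, hk r hr']
        calc _ = (ENNReal.ofReal (r ^ ((n : ℝ) - 1)) * ENNReal.ofReal (r ^ k)) * (w θ * φ (a * r)) := by ring
          _ = (ENNReal.ofReal (a ^ (-((n : ℝ) - 1 + k))) * ENNReal.ofReal ((a * r) ^ ((n : ℝ) - 1 + k)))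
              * (w θ * φ (a * r)) := by
            rw [← ENNReal.ofReal_mul (by positivity), ← ENNReal.ofReal_mul (by positivity), e2]
          _ = _ := by ring
    _ = w θ * ENNReal.ofReal (a ^ (-((n : ℝ) - 1 + k))) * (ENNReal.ofReal a⁻¹ *
          ∫⁻ s in Set.Ioi (0 : ℝ), ENNReal.ofReal (s ^ ((n : ℝ) - 1 + k)) * φ s) := by
        rw [lintegral_const_mul _ (by fun_prop), h2]
    _ = _ := by
        have e3 : a ^ (-((n : ℝ) + k)) = a ^ (-((n : ℝ) - 1 + k)) * a⁻¹ := by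
          rw [← Real.rpow_neg_one a, ← Real.rpow_add ha]; ring_nf
        rw [e3, ENNReal.ofReal_mul (by positivity)]
        ring

lemma integral_homogeneous_mul_comp_sphere (h : IsNorm N) (hn : 0 < n) {k : ℝ} {w : 𝔼 n → ℝ}
    (hw : Measurable w) (hw0 : ∀ x, 0 ≤ w x)
    (hk : ∀ r : ℝ, 0 < r → ∀ x, w (r • x) = r ^ k * w x)
    {φ : ℝ → ℝ} (hφ : Measurable φ) (hφ0 : ∀ x, 0 ≤ φ x) :
    ∫ x, w x * φ (N x) =
      (∫ θ : Metric.sphere (0 : 𝔼 n) 1, w θ * N θ ^ (-((n : ℝ) + k))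
        ∂(volume : Measure (𝔼 n)).toSphere) *
      ∫ s in Set.Ioi (0 : ℝ), s ^ ((n : ℝ) - 1 + k) * φ s := by
  have hN := h.continuous.measurable
  have hN' : Measurable fun θ : Metric.sphere (0 : 𝔼 n) 1 => N θ := hN.comp measurable_subtype_coe
  have hw' : Measurable fun θ : Metric.sphere (0 : 𝔼 n) 1 => w θ := hw.comp measurable_subtype_coe
  rw [integral_eq_lintegral_of_nonneg_ae (.of_forall fun x => mul_nonneg (hw0 x) (hφ0 _))
      (by fun_prop),
    integral_eq_lintegral_of_nonneg_ae
      (f := fun θ : Metric.sphere (0 : 𝔼 n) 1 => w θ * N θ ^ (-((n : ℝ) + k)))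
      (.of_forall fun x => mul_nonneg (hw0 x) (Real.rpow_nonneg (h.nonneg _) _)) (by fun_prop),
    integral_eq_lintegral_of_nonneg_ae, ← ENNReal.toReal_mul]
  · congr 1
    have := h.lintegral_homogeneous_mul_comp hn (k := k) (w := fun x => ENNReal.ofReal (w x))
      (by fun_prop) (fun r hr x => by
        rw [hk r hr, ENNReal.ofReal_mul (Real.rpow_nonneg hr.le _)])
      (φ := fun s => ENNReal.ofReal (φ s)) (by fun_prop)
    convert this using 1
    · exact lintegral_congr fun x => ENNReal.ofReal_mul (hw0 x)
    · congr 1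
      · exact lintegral_congr fun x => ENNReal.ofReal_mul (hw0 x)
      · exact setLIntegral_congr_fun measurableSet_Ioi fun s hs =>
          ENNReal.ofReal_mul (Real.rpow_nonneg (le_of_lt hs) _)
  · filter_upwards [ae_restrict_mem measurableSet_Ioi] with s hs
    exact mul_nonneg (Real.rpow_nonneg (le_of_lt hs) _) (hφ0 _)
  · fun_prop

lemma integral_Ioi_rpow_mul_indicator {m : ℝ} (hm : 0 < m) :
    ∫ s in Set.Ioi (0 : ℝ), s ^ (m - 1) * (Set.Iic (1 : ℝ)).indicator 1 s = m⁻¹ := by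
  have h1 : ∀ s ∈ Set.Ioi (0 : ℝ), s ^ (m - 1) * (Set.Iic (1 : ℝ)).indicator 1 s =
      (Set.Iic (1 : ℝ)).indicator (fun s => s ^ (m - 1)) s := by
    intro s _
    by_cases hs : s ≤ 1 <;> simp [Set.indicator, hs]
  rw [setIntegral_congr_fun measurableSet_Ioi h1, setIntegral_indicator measurableSet_Iic,
    Set.Ioi_inter_Iic, ← intervalIntegral.integral_of_le zero_le_one, integral_rpow (by left; linarith)]
  simp [ne_of_gt hm]

/-- The integral of a homogeneous weight times a function of a norm. -/
lemma integral_homogeneous_mul_comp (h : IsNorm N) (hn : 0 < n) {k : ℝ} (hk0 : 0 ≤ k) {w : 𝔼 n → ℝ}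
    (hw : Measurable w) (hw0 : ∀ x, 0 ≤ w x)
    (hk : ∀ r : ℝ, 0 < r → ∀ x, w (r • x) = r ^ k * w x)
    {φ : ℝ → ℝ} (hφ : Measurable φ) (hφ0 : ∀ x, 0 ≤ φ x) :
    ∫ x, w x * φ (N x) = ((n + k) * ∫ s in Set.Ioi (0 : ℝ), s ^ ((n : ℝ) + k - 1) * φ s) *
      ∫ x in {x | N x ≤ 1}, w x := by
  have hn' : (0 : ℝ) < n := by exact_mod_cast hn
  have h1 := h.integral_homogeneous_mul_comp_sphere hn hw hw0 hk hφ hφ0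
  have h2 := h.integral_homogeneous_mul_comp_sphere hn hw hw0 hk
    (φ := (Set.Iic (1 : ℝ)).indicator 1) (measurable_const.indicator measurableSet_Iic)
    (fun x => Set.indicator_nonneg (by simp) _)
  have h3 : ∫ x in {x | N x ≤ 1}, w x = ∫ x, w x * (Set.Iic (1 : ℝ)).indicator 1 (N x) := by
    rw [← integral_indicator (h.measurableSet 1)]
    congr 1; ext x
    by_cases hx : N x ≤ 1 <;> simp [Set.indicator, hx]
  have e : (n : ℝ) - 1 + k = (n : ℝ) + k - 1 := by ring
  rw [e] at h1 h2
  rw [integral_Ioi_rpow_mul_indicator (by positivity)] at h2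
  rw [h1, h3, h2]
  field_simp

end IsNorm

/-- The absolute value of the determinant of a linear automorphism. -/
noncomputable def absDet {n : ℕ} (A : EuclideanSpace ℝ (Fin n) ≃ₗ[ℝ] EuclideanSpace ℝ (Fin n)) : ℝ :=
  |LinearMap.det (A : EuclideanSpace ℝ (Fin n) →ₗ[ℝ] EuclideanSpace ℝ (Fin n))|

section linear

variable {n : ℕ}

lemma absDet_pos (A : 𝔼 n ≃ₗ[ℝ] 𝔼 n) : 0 < absDet A := abs_pos.2 (LinearEquiv.isUnit_det' A).ne_zero

lemma integral_comp_linearEquiv (A : 𝔼 n ≃ₗ[ℝ] 𝔼 n) (g : 𝔼 n → ℝ) :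
    ∫ x, g (A x) = (absDet A)⁻¹ * ∫ x, g x := by
  have h1 := (A.toContinuousLinearEquiv.toHomeomorph.measurableEmbedding).integral_map
    (μ := volume) g
  have h2 := Measure.map_linearMap_addHaar_eq_smul_addHaar (volume : Measure (𝔼 n))
    (f := (A : 𝔼 n →ₗ[ℝ] 𝔼 n)) (LinearEquiv.isUnit_det' A).ne_zero
  have h3 : ⇑A.toContinuousLinearEquiv.toHomeomorph = ⇑(A : 𝔼 n →ₗ[ℝ] 𝔼 n) := rfl
  rw [h3, h2] at h1
  have h4 := h1.symm
  rw [integral_smul_measure, ENNReal.toReal_ofReal (abs_nonneg _), abs_inv] at h4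
  exact h4

lemma integrable_comp_linearEquiv (A : 𝔼 n ≃ₗ[ℝ] 𝔼 n) {g : 𝔼 n → ℝ} (hg : Integrable g) :
    Integrable fun x => g (A x) := by
  have h1 := (A.toContinuousLinearEquiv.toHomeomorph.measurableEmbedding).integrable_map_iff
    (μ := volume) (g := g)
  have h2 := Measure.map_linearMap_addHaar_eq_smul_addHaar (volume : Measure (𝔼 n))
    (f := (A : 𝔼 n →ₗ[ℝ] 𝔼 n)) (LinearEquiv.isUnit_det' A).ne_zero
  have h3 : ⇑A.toContinuousLinearEquiv.toHomeomorph = ⇑(A : 𝔼 n →ₗ[ℝ] 𝔼 n) := rfl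
  rw [h3, h2] at h1
  exact h1.1 (hg.smul_measure ENNReal.ofReal_ne_top)

lemma LinearMap.det_adjoint_real (f : 𝔼 n →ₗ[ℝ] 𝔼 n) :
    LinearMap.det (LinearMap.adjoint f) = LinearMap.det f := by
  have h := LinearMap.toMatrix_adjoint (EuclideanSpace.basisFun (Fin n) ℝ)
    (EuclideanSpace.basisFun (Fin n) ℝ) f
  rw [← LinearMap.det_toMatrix (EuclideanSpace.basisFun (Fin n) ℝ).toBasis, h,
    Matrix.det_conjTranspose, LinearMap.det_toMatrix]
  simp

lemma exists_adjoint_symm (A : 𝔼 n ≃ₗ[ℝ] 𝔼 n) : ∃ B : 𝔼 n ≃ₗ[ℝ] 𝔼 n,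
    absDet B = (absDet A)⁻¹ ∧ ∀ x y, ⟪A.symm x, y⟫ = ⟪x, B y⟫ := by
  have e1 : (LinearMap.adjoint (A.symm : 𝔼 n →ₗ[ℝ] 𝔼 n)) ∘ₗ LinearMap.adjoint (A : 𝔼 n →ₗ[ℝ] 𝔼 n)
      = LinearMap.id := by
    rw [← LinearMap.adjoint_comp]; simp
  have e2 : (LinearMap.adjoint (A : 𝔼 n →ₗ[ℝ] 𝔼 n)) ∘ₗ LinearMap.adjoint (A.symm : 𝔼 n →ₗ[ℝ] 𝔼 n)
      = LinearMap.id := by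
    rw [← LinearMap.adjoint_comp]; simp
  refine ⟨LinearEquiv.ofLinearMap _ _ e1 e2, ?_, fun x y => ?_⟩
  · have h1 : ((LinearEquiv.ofLinearMap _ _ e1 e2 : 𝔼 n ≃ₗ[ℝ] 𝔼 n) : 𝔼 n →ₗ[ℝ] 𝔼 n) =
      LinearMap.adjoint (A.symm : 𝔼 n →ₗ[ℝ] 𝔼 n) := by ext; simp
    unfold absDet
    rw [h1, LinearMap.det_adjoint_real, ← abs_inv]
    congr 1
    have h2 := LinearEquiv.det_symm_mul_det A
    exact eq_inv_of_mul_eq_one_left h2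
  · simp [LinearMap.adjoint_inner_right]

end linear

/-- A nonnegative integrable function with bounded support and positive integral. -/
structure IsNice {n : ℕ} (f : EuclideanSpace ℝ (Fin n) → ℝ) : Prop where
  nonneg : ∀ x, 0 ≤ f x
  integrable : Integrable f
  bounded_support : ∃ R : ℝ, ∀ x, R < ‖x‖ → f x = 0
  integral_pos : 0 < ∫ x, f x

/-- The (polar) `L_p`-centroid norm of a density `f`. -/
noncomputable def centroidNorm {n : ℕ} (p : ℝ) (f : EuclideanSpace ℝ (Fin n) → ℝ)
    (ξ : EuclideanSpace ℝ (Fin n)) : ℝ :=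
  (∫ x, f x * |⟪x, ξ⟫| ^ p) ^ (1 / p)

/-- The volume of the unit ball of `N`. -/
noncomputable def ballVol {n : ℕ} (N : EuclideanSpace ℝ (Fin n) → ℝ) : ℝ :=
  volume.real {x | N x ≤ 1}

namespace IsNice

variable {n : ℕ} {f g : 𝔼 n → ℝ} {p : ℝ}

lemma integrable_mul (hf : IsNice f) {w : 𝔼 n → ℝ} (hw : Continuous w) :
    Integrable fun x => f x * w x := by
  obtain ⟨R, hR⟩ := hf.bounded_support
  have h1 : IntegrableOn (fun x => f x * w x) (Metric.closedBall 0 R) :=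
    hf.integrable.integrableOn.mul_continuousOn hw.continuousOn (isCompact_closedBall 0 R)
  refine (integrableOn_iff_integrable_of_support_subset fun x hx => ?_).1 h1
  rw [mem_closedBall_zero_iff]
  by_contra hcon
  exact hx (by simp [hR x (not_le.1 hcon)])

lemma comp_linearEquiv (hf : IsNice f) (A : 𝔼 n ≃ₗ[ℝ] 𝔼 n) : IsNice fun x => f (A x) where
  nonneg x := hf.nonneg _
  integrable := integrable_comp_linearEquiv A hf.integrable
  bounded_support := by
    obtain ⟨R, hR⟩ := hf.bounded_support
    obtain ⟨c, hc, hN⟩ := (IsNorm.norm.comp_linearEquiv A).exists_ge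
    refine ⟨R / c, fun x hx => hR _ ?_⟩
    rw [div_lt_iff₀ hc, mul_comm] at hx
    exact hx.trans_le (hN x)
  integral_pos := by
    rw [integral_comp_linearEquiv]
    exact mul_pos (inv_pos.2 (absDet_pos A)) hf.integral_pos

lemma continuous_weight (hp : 0 ≤ p) (ξ : 𝔼 n) : Continuous fun x : 𝔼 n => |⟪x, ξ⟫| ^ p :=
  Continuous.rpow_const (by fun_prop) fun _ => Or.inr hp

lemma centroidNorm_rpow (hf : IsNice f) (hp : 0 < p) (ξ : 𝔼 n) :
    centroidNorm p f ξ ^ p = ∫ x, f x * |⟪x, ξ⟫| ^ p := by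
  unfold centroidNorm
  rw [one_div, Real.rpow_inv_rpow (integral_nonneg fun x => mul_nonneg (hf.nonneg x) (by positivity)) hp.ne']

lemma integral_weight_pos (hf : IsNice f) (hp : 0 < p) {ξ : 𝔼 n} (hξ : ξ ≠ 0) :
    0 < ∫ x, f x * |⟪x, ξ⟫| ^ p := by
  have h0 : ∀ x, 0 ≤ f x * |⟪x, ξ⟫| ^ p := fun x => mul_nonneg (hf.nonneg x) (by positivity)
  refine lt_of_le_of_ne (integral_nonneg h0) fun h => ?_
  have h1 := (integral_eq_zero_iff_of_nonneg h0 (hf.integrable_mul (continuous_weight hp.le ξ))).1 h.symm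
  have h2 : volume {x : 𝔼 n | ⟪x, ξ⟫ = 0} = 0 := by
    have h3 := Measure.addHaar_submodule (volume : Measure (𝔼 n))
      (LinearMap.ker ((innerₗ (𝔼 n)) ξ)) (by
        intro ht
        have : ξ ∈ LinearMap.ker ((innerₗ (𝔼 n)) ξ) := by rw [ht]; trivial
        simp at this; exact hξ this)
    convert h3 using 2
    ext x; simp [real_inner_comm]
  have h3 : f =ᵐ[volume] 0 := by
    have h4 : ∀ᵐ x : 𝔼 n, ⟪x, ξ⟫ ≠ 0 := by rw [ae_iff]; simpa using h2
    filter_upwards [h1, h4] with x hx hx'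
    have : |⟪x, ξ⟫| ^ p ≠ 0 := (Real.rpow_pos_of_pos (abs_pos.2 hx') p).ne'
    simpa [this] using hx
  have h5 := hf.integral_pos
  rw [integral_congr_ae h3] at h5
  simp at h5

lemma isNorm_centroidNorm (hf : IsNice f) (hp : 1 ≤ p) : IsNorm (centroidNorm p f) := by
  have hp0 : 0 < p := by linarith
  have hI : ∀ ξ, 0 ≤ ∫ x, f x * |⟪x, ξ⟫| ^ p := fun ξ =>
    integral_nonneg fun x => mul_nonneg (hf.nonneg x) (by positivity)
  have hsmul : ∀ (c : ℝ) ξ, centroidNorm p f (c • ξ) = |c| * centroidNorm p f ξ := by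
    intro c ξ
    have : ∀ x, f x * |⟪x, c • ξ⟫| ^ p = |c| ^ p * (f x * |⟪x, ξ⟫| ^ p) := by
      intro x
      rw [inner_smul_right, abs_mul, Real.mul_rpow (abs_nonneg _) (abs_nonneg _)]; ring
    unfold centroidNorm
    simp_rw [this]
    rw [integral_const_mul, Real.mul_rpow (by positivity) (hI ξ), one_div,
      Real.rpow_rpow_inv (abs_nonneg _) hp0.ne']
  have hpos : ∀ ξ, ξ ≠ 0 → 0 < centroidNorm p f ξ := fun ξ hξ =>
    Real.rpow_pos_of_pos (hf.integral_weight_pos hp0 hξ) _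
  have hadd0 : ∀ ξ η, ξ ≠ 0 → η ≠ 0 →
      centroidNorm p f (ξ + η) ≤ centroidNorm p f ξ + centroidNorm p f η := by
    intro ξ η hξ hη
    set a := centroidNorm p f ξ
    set b := centroidNorm p f η
    have ha : 0 < a := hpos ξ hξ
    have hb : 0 < b := hpos η hη
    have hga : ∫ x, f x * |⟪x, ξ⟫| ^ p = a ^ p := (hf.centroidNorm_rpow hp0 ξ).symm
    have hgb : ∫ x, f x * |⟪x, η⟫| ^ p = b ^ p := (hf.centroidNorm_rpow hp0 η).symm
    have hiξ := hf.integrable_mul (continuous_weight hp0.le ξ)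
    have hiη := hf.integrable_mul (continuous_weight hp0.le η)
    have key : ∫ x, f x * |⟪x, ξ + η⟫| ^ p ≤ (a + b) ^ p := by
      have hpt : ∀ x, f x * |⟪x, ξ + η⟫| ^ p ≤
          ((a + b) ^ p * (a / (a + b)) * (a ^ p)⁻¹) * (f x * |⟪x, ξ⟫| ^ p) +
          ((a + b) ^ p * (b / (a + b)) * (b ^ p)⁻¹) * (f x * |⟪x, η⟫| ^ p) := by
        intro x
        have hc := (convexOn_rpow hp).2
          (Set.mem_Ici.2 (by positivity : 0 ≤ |⟪x, ξ⟫| / a))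
          (Set.mem_Ici.2 (by positivity : 0 ≤ |⟪x, η⟫| / b))
          (by positivity : 0 ≤ a / (a + b)) (by positivity : 0 ≤ b / (a + b)) (by field_simp)
        simp only [smul_eq_mul] at hc
        have h1 : a / (a + b) * (|⟪x, ξ⟫| / a) + b / (a + b) * (|⟪x, η⟫| / b) =
            (|⟪x, ξ⟫| + |⟪x, η⟫|) / (a + b) := by field_simp
        rw [h1, Real.div_rpow (by positivity) (by positivity), Real.div_rpow (by positivity) ha.le,
          Real.div_rpow (by positivity) hb.le, div_le_iff₀ (by positivity)] at hc
        have h2 : |⟪x, ξ + η⟫| ^ p ≤ (|⟪x, ξ⟫| + |⟪x, η⟫|) ^ p := by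
          rw [inner_add_right]
          exact Real.rpow_le_rpow (abs_nonneg _) (abs_add_le _ _) hp0.le
        refine (mul_le_mul_of_nonneg_left (h2.trans hc) (hf.nonneg x)).trans_eq ?_
        field_simp
      refine (integral_mono (hf.integrable_mul (continuous_weight hp0.le _))
        ((hiξ.const_mul _).add (hiη.const_mul _)) hpt).trans_eq ?_
      simp only [Pi.add_apply]
      rw [integral_add (hiξ.const_mul _) (hiη.const_mul _), integral_const_mul, integral_const_mul,
        hga, hgb]
      have := (Real.rpow_pos_of_pos ha p).ne'
      have := (Real.rpow_pos_of_pos hb p).ne'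
      field_simp
    calc centroidNorm p f (ξ + η) ≤ ((a + b) ^ p) ^ (1 / p) :=
          Real.rpow_le_rpow (hI _) key (by positivity)
      _ = a + b := by rw [one_div, Real.rpow_rpow_inv (by positivity) hp0.ne']
  have h0 : centroidNorm p f 0 = 0 := by simpa using hsmul 0 0
  refine ⟨fun ξ η => ?_, hsmul, hpos⟩
  by_cases hξ : ξ = 0
  · simp [hξ, h0]
  by_cases hη : η = 0
  · simp [hη, h0]
  exact hadd0 ξ η hξ hη

/-- Symmetry of the double integral defining the centroid norms. -/
lemma integral_mul_centroidNorm_rpow_comm (hf : IsNice f) (hg : IsNice g) (hp : 0 < p) :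
    ∫ ξ, g ξ * centroidNorm p f ξ ^ p = ∫ x, f x * centroidNorm p g x ^ p := by
  simp_rw [hf.centroidNorm_rpow hp, hg.centroidNorm_rpow hp, ← integral_const_mul]
  rw [integral_integral_swap]
  · congr 1; ext x; congr 1; ext ξ
    rw [real_inner_comm]; ring
  · obtain ⟨R, hR⟩ := hf.bounded_support
    obtain ⟨S, hS⟩ := hg.bounded_support
    have hi := (hg.integrable.mul_prod hf.integrable).const_mul ((|R| * |S|) ^ p)
    have hc : Continuous fun z : 𝔼 n × 𝔼 n => |⟪z.2, z.1⟫| ^ p :=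
      Continuous.rpow_const (by fun_prop) fun _ => Or.inr hp.le
    refine hi.mono' ?_ (.of_forall fun z => ?_)
    · have h1 := (hg.integrable.mul_prod hf.integrable).aestronglyMeasurable.mul
        hc.aestronglyMeasurable
      refine h1.congr (.of_forall fun z => ?_)
      simp [Function.uncurry, mul_assoc]
    · simp only [Function.uncurry]
      rw [Real.norm_of_nonneg (mul_nonneg (hg.nonneg _) (mul_nonneg (hf.nonneg _) (by positivity)))]
      by_cases h1 : g z.1 = 0
      · simp [h1]
      by_cases h2 : f z.2 = 0
      · simp [h2]
      have h1' : ‖z.1‖ ≤ |S| := (not_lt.1 fun h => h1 (hS _ h)).trans (le_abs_self _)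
      have h2' : ‖z.2‖ ≤ |R| := (not_lt.1 fun h => h2 (hR _ h)).trans (le_abs_self _)
      have h3 : |⟪z.2, z.1⟫| ^ p ≤ (|R| * |S|) ^ p :=
        Real.rpow_le_rpow (abs_nonneg _) ((abs_real_inner_le_norm _ _).trans (by gcongr)) hp.le
      have := mul_le_mul_of_nonneg_left h3 (mul_nonneg (hg.nonneg z.1) (hf.nonneg z.2))
      linarith

end IsNice

/-- The `m`-th radial moment of a profile `φ`. -/
noncomputable def radMoment (m : ℝ) (φ : ℝ → ℝ) : ℝ := ∫ s in Set.Ioi (0 : ℝ), s ^ (m - 1) * φ s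

/-- The `L_p`-centroid norm of the uniform density on the unit ball of `N`. -/
noncomputable def ballCentroidNorm {n : ℕ} (p : ℝ) (N : EuclideanSpace ℝ (Fin n) → ℝ) :
    EuclideanSpace ℝ (Fin n) → ℝ :=
  centroidNorm p fun x => (Set.Iic (1 : ℝ)).indicator 1 (N x)

/-- The affine invariant functional maximized by Euclidean norms. -/
noncomputable def volProduct {n : ℕ} (p : ℝ) (N : EuclideanSpace ℝ (Fin n) → ℝ) : ℝ :=
  ballVol N ^ (((n : ℝ) + p) / p) * ballVol (ballCentroidNorm p N)

/-- `N` is a norm maximizing `volProduct`. -/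
structure IsMaximalNorm {n : ℕ} (p : ℝ) (N : EuclideanSpace ℝ (Fin n) → ℝ) : Prop where
  isNorm : IsNorm N
  le : ∀ M : EuclideanSpace ℝ (Fin n) → ℝ, IsNorm M → volProduct p M ≤ volProduct p N

lemma radMoment_indicator {m : ℝ} (hm : 0 < m) :
    radMoment m ((Set.Iic (1 : ℝ)).indicator 1) = m⁻¹ := IsNorm.integral_Ioi_rpow_mul_indicator hm

lemma radMoment_mul_rpow (m p : ℝ) (φ : ℝ → ℝ) :
    radMoment m (fun s => φ s * s ^ p) = radMoment (m + p) φ := by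
  refine setIntegral_congr_fun measurableSet_Ioi fun s hs => ?_
  have hs' : 0 < s := hs
  have : m + p - 1 = (m - 1) + p := by ring
  simp only [this, Real.rpow_add hs']
  ring

lemma indicator_Iic_nonneg (s : ℝ) : 0 ≤ (Set.Iic (1 : ℝ)).indicator (1 : ℝ → ℝ) s :=
  Set.indicator_nonneg (by simp) _

lemma measurable_indicator_Iic : Measurable ((Set.Iic (1 : ℝ)).indicator (1 : ℝ → ℝ)) :=
  measurable_one.indicator measurableSet_Iic

section centroid

variable {n : ℕ} {p : ℝ}

namespace IsNorm

variable {N : 𝔼 n → ℝ}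

lemma ballVol_pos (h : IsNorm N) : 0 < ballVol N :=
  ENNReal.toReal_pos h.volume_pos.ne' (h.volume_lt_top 1).ne

lemma isNice_comp (h : IsNorm N) {φ : ℝ → ℝ} (hφ : Measurable φ) (hφ0 : ∀ s, 0 ≤ φ s)
    {C ρ ε : ℝ} (hC : ∀ s, 0 ≤ s → φ s ≤ C) (hρ : ∀ s, ρ < s → φ s = 0) (hε : 0 < ε)
    (hpos : ∀ s, 0 ≤ s → s < ε → 0 < φ s) : IsNice fun x => φ (N x) := by
  have hm : Measurable fun x => φ (N x) := hφ.comp h.continuous.measurable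
  have hinteg : Integrable fun x => φ (N x) := by
    have h1 : IntegrableOn (fun x => φ (N x)) {x | N x ≤ ρ} := by
      refine Measure.integrableOn_of_bounded (M := C) (h.volume_lt_top ρ).ne
        hm.aestronglyMeasurable (.of_forall fun x => ?_)
      rw [Real.norm_of_nonneg (hφ0 _)]
      exact hC _ (h.nonneg x)
    refine (integrableOn_iff_integrable_of_support_subset fun x hx => ?_).1 h1
    by_contra hcon
    exact hx (hρ _ (not_le.1 hcon))
  refine ⟨fun x => hφ0 _, hinteg, ?_, ?_⟩
  · obtain ⟨c, hc, hN⟩ := h.exists_ge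
    refine ⟨ρ / c, fun x hx => hρ _ ?_⟩
    rw [div_lt_iff₀ hc, mul_comm] at hx
    exact hx.trans_le (hN x)
  · rw [integral_pos_iff_support_of_nonneg (fun x => hφ0 _) hinteg]
    have ho : IsOpen {x | N x < ε} := isOpen_lt h.continuous continuous_const
    refine lt_of_lt_of_le (ho.measure_pos volume ⟨0, by simpa [h.zero] using hε⟩)
      (measure_mono fun x hx => ?_)
    exact (hpos _ (h.nonneg x) hx).ne'

lemma isNice_ball (h : IsNorm N) : IsNice fun x => (Set.Iic (1 : ℝ)).indicator (1 : ℝ → ℝ) (N x) := by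
  refine h.isNice_comp measurable_indicator_Iic indicator_Iic_nonneg (C := 1) (ρ := 1) (ε := 1)
    (fun s _ => ?_) (fun s hs => ?_) one_pos fun s _ hs => ?_
  · by_cases hs : s ≤ 1 <;> simp [Set.indicator, hs]
  · simp [Set.indicator, hs]
  · simp [Set.indicator, hs.le]

lemma isNorm_ballCentroidNorm (h : IsNorm N) (hp : 1 ≤ p) : IsNorm (ballCentroidNorm p N) :=
  h.isNice_ball.isNorm_centroidNorm hp

lemma integral_ball (h : IsNorm N) (w : 𝔼 n → ℝ) :
    ∫ x, (Set.Iic (1 : ℝ)).indicator (1 : ℝ → ℝ) (N x) * w x = ∫ x in {x | N x ≤ 1}, w x := by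
  rw [← integral_indicator (h.measurableSet 1)]
  congr 1; ext x
  by_cases hx : N x ≤ 1 <;> simp [Set.indicator, hx]

lemma integral_comp (h : IsNorm N) (hn : 0 < n) {φ : ℝ → ℝ} (hφ : Measurable φ)
    (hφ0 : ∀ x, 0 ≤ φ x) : ∫ x, φ (N x) = (n * radMoment n φ) * ballVol N := by
  have h1 := h.integral_homogeneous_mul_comp hn (k := 0) le_rfl (w := fun _ => 1) measurable_const
    (fun _ => zero_le_one) (fun r _ x => by simp) hφ hφ0
  simp only [one_mul, add_zero] at h1
  rw [h1, integral_const]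
  simp [radMoment, ballVol, Measure.real]

lemma integral_comp_mul_rpow (h : IsNorm N) (hn : 0 < n) {φ : ℝ → ℝ} (hφ : Measurable φ)
    (hφ0 : ∀ x, 0 ≤ φ x) :
    ∫ x, φ (N x) * N x ^ p = (n * radMoment (n + p) φ) * ballVol N := by
  have h1 := h.integral_comp hn (φ := fun s => φ s * |s| ^ p)
    (hφ.mul (measurable_norm.pow_const p)) fun s => mul_nonneg (hφ0 s) (by positivity)
  rw [← radMoment_mul_rpow]
  have h2 : radMoment n (fun s => φ s * |s| ^ p) = radMoment n (fun s => φ s * s ^ p) := by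
    refine setIntegral_congr_fun measurableSet_Ioi fun s hs => ?_
    simp only [abs_of_pos (Set.mem_Ioi.1 hs)]
  rw [← h2, ← h1]
  congr 1; ext x
  rw [abs_of_nonneg (h.nonneg x)]

lemma centroidNorm_comp_rpow (h : IsNorm N) (hn : 0 < n) (hp : 0 < p) {φ : ℝ → ℝ}
    (hφ : IsNice fun x => φ (N x)) (hm : Measurable φ) (hφ0 : ∀ x, 0 ≤ φ x) (ξ : 𝔼 n) :
    centroidNorm p (fun x => φ (N x)) ξ ^ p =
      ((n + p) * radMoment (n + p) φ) * ballCentroidNorm p N ξ ^ p := by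
  unfold ballCentroidNorm
  rw [hφ.centroidNorm_rpow hp, h.isNice_ball.centroidNorm_rpow hp, h.integral_ball]
  have h1 := h.integral_homogeneous_mul_comp hn (k := p) hp.le (w := fun x => |⟪x, ξ⟫| ^ p)
    (IsNice.continuous_weight hp.le ξ).measurable
    (fun _ => by positivity) (fun r hr x => by
      rw [inner_smul_left, abs_mul, Real.mul_rpow (abs_nonneg _) (abs_nonneg _)]
      simp [abs_of_pos hr]) hm hφ0
  rw [radMoment, ← h1]
  congr 1; ext x; ring

lemma integral_sphere (h : IsNorm N) (hn : 0 < n) :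
    ∫ θ : Metric.sphere (0 : 𝔼 n) 1, N θ ^ (-(n : ℝ)) ∂(volume : Measure (𝔼 n)).toSphere =
      n * ballVol N := by
  have h1 := h.integral_homogeneous_mul_comp_sphere hn (k := 0) (w := fun _ => 1) measurable_const
    (fun _ => zero_le_one) (fun r _ x => by simp) measurable_indicator_Iic indicator_Iic_nonneg
  have h2 := h.integral_comp hn measurable_indicator_Iic indicator_Iic_nonneg
  have h3 := radMoment_indicator (m := n) (by exact_mod_cast hn)
  have hn' : (n : ℝ) ≠ 0 := by exact_mod_cast hn.ne'
  simp only [one_mul, add_zero] at h1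
  rw [h2] at h1
  unfold radMoment at h1 h3
  rw [h3] at h1
  field_simp at h1
  linarith

lemma ballVol_comp (h : IsNorm N) (A : 𝔼 n ≃ₗ[ℝ] 𝔼 n) :
    ballVol (fun x => N (A x)) = (absDet A)⁻¹ * ballVol N := by
  have e : ∀ {M : 𝔼 n → ℝ}, IsNorm M →
      ballVol M = ∫ x, (Set.Iic (1 : ℝ)).indicator (1 : ℝ → ℝ) (M x) := by
    intro M hM
    have := hM.integral_ball (fun _ => 1)
    simp only [mul_one] at this
    rw [this]; simp [ballVol, Measure.real]
  rw [e (h.comp_linearEquiv A), e h]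
  exact integral_comp_linearEquiv A fun x => (Set.Iic (1 : ℝ)).indicator (1 : ℝ → ℝ) (N x)

end IsNorm

/-- The linear automorphism `x ↦ c x`. -/
noncomputable def scaleEquiv (n : ℕ) {c : ℝ} (hc : 0 < c) :
    EuclideanSpace ℝ (Fin n) ≃ₗ[ℝ] EuclideanSpace ℝ (Fin n) :=
  LinearEquiv.smulOfNeZero ℝ _ c hc.ne'

lemma scaleEquiv_apply {c : ℝ} (hc : 0 < c) (x : 𝔼 n) : scaleEquiv n hc x = c • x := rfl

lemma absDet_scaleEquiv {c : ℝ} (hc : 0 < c) : absDet (scaleEquiv n hc) = c ^ (n : ℝ) := by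
  have : (scaleEquiv n hc : 𝔼 n →ₗ[ℝ] 𝔼 n) = c • LinearMap.id := by ext; simp [scaleEquiv_apply]
  rw [absDet, this, LinearMap.det_smul]
  simp [abs_of_pos hc]

lemma IsNorm.ballVol_const_mul {N : 𝔼 n → ℝ} (h : IsNorm N) {c : ℝ} (hc : 0 < c) :
    ballVol (fun x => c * N x) = c ^ (-(n : ℝ)) * ballVol N := by
  have h1 := h.ballVol_comp (scaleEquiv n hc)
  simp only [absDet_scaleEquiv, scaleEquiv_apply, h.smul, abs_of_pos hc] at h1
  rw [h1, Real.rpow_neg hc.le]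

lemma centroidNorm_comp_linearEquiv_rpow {f : 𝔼 n → ℝ} (hf : IsNice f) (hp : 0 < p)
    {A B : 𝔼 n ≃ₗ[ℝ] 𝔼 n} (hAB : ∀ x y, ⟪A.symm x, y⟫ = ⟪x, B y⟫) (ξ : 𝔼 n) :
    centroidNorm p (fun x => f (A x)) ξ ^ p = (absDet A)⁻¹ * centroidNorm p f (B ξ) ^ p := by
  rw [hf.centroidNorm_rpow hp, (hf.comp_linearEquiv A).centroidNorm_rpow hp,
    ← integral_comp_linearEquiv]
  congr 1; ext x
  rw [← hAB, LinearEquiv.symm_apply_apply]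

lemma centroidNorm_comp_linearEquiv {f : 𝔼 n → ℝ} (hf : IsNice f) (hp : 1 ≤ p)
    {A B : 𝔼 n ≃ₗ[ℝ] 𝔼 n} (hAB : ∀ x y, ⟪A.symm x, y⟫ = ⟪x, B y⟫) (ξ : 𝔼 n) :
    centroidNorm p (fun x => f (A x)) ξ = absDet A ^ (-(1 / p)) * centroidNorm p f (B ξ) := by
  have hp0 : 0 < p := by linarith
  have h1 := centroidNorm_comp_linearEquiv_rpow hf hp0 hAB ξ
  have ha := absDet_pos A
  have hN := hf.isNorm_centroidNorm hp
  have hN' := (hf.comp_linearEquiv A).isNorm_centroidNorm hp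
  rw [← Real.rpow_rpow_inv (hN'.nonneg ξ) hp0.ne', h1,
    Real.mul_rpow (by positivity) (Real.rpow_nonneg (hN.nonneg _) _),
    Real.rpow_rpow_inv (hN.nonneg _) hp0.ne', Real.inv_rpow ha.le, Real.rpow_neg ha.le, one_div]

lemma ballVol_centroidNorm_comp_linearEquiv {f : 𝔼 n → ℝ} (hf : IsNice f) (hp : 1 ≤ p)
    (A : 𝔼 n ≃ₗ[ℝ] 𝔼 n) :
    ballVol (centroidNorm p fun x => f (A x)) =
      absDet A ^ (((n : ℝ) + p) / p) * ballVol (centroidNorm p f) := by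
  obtain ⟨B, hB, hAB⟩ := exists_adjoint_symm A
  have ha := absDet_pos A
  have hN := hf.isNorm_centroidNorm hp
  have h1 : (centroidNorm p fun x => f (A x)) =
      fun ξ => absDet A ^ (-(1 / p)) * centroidNorm p f (B ξ) :=
    funext fun ξ => centroidNorm_comp_linearEquiv hf hp hAB ξ
  rw [h1, (hN.comp_linearEquiv B).ballVol_const_mul (by positivity), hN.ballVol_comp, hB, inv_inv,
    ← Real.rpow_mul ha.le, ← mul_assoc]
  congr 1
  nth_rw 2 [← Real.rpow_one (absDet A)]
  rw [← Real.rpow_add ha]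
  congr 1
  field_simp

lemma IsNorm.volProduct_comp {N : 𝔼 n → ℝ} (h : IsNorm N) (hp : 1 ≤ p) (A : 𝔼 n ≃ₗ[ℝ] 𝔼 n) :
    volProduct p (fun x => N (A x)) = volProduct p N := by
  have ha := absDet_pos A
  unfold volProduct
  rw [h.ballVol_comp, ballCentroidNorm, ballVol_centroidNorm_comp_linearEquiv h.isNice_ball hp,
    Real.mul_rpow (by positivity) h.ballVol_pos.le, Real.inv_rpow ha.le, ballCentroidNorm]
  have := (Real.rpow_pos_of_pos ha (((n : ℝ) + p) / p)).ne'
  field_simp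

lemma IsMaximalNorm.comp {N : 𝔼 n → ℝ} (h : IsMaximalNorm p N) (hp : 1 ≤ p) (A : 𝔼 n ≃ₗ[ℝ] 𝔼 n) :
    IsMaximalNorm p fun x => N (A x) :=
  ⟨h.isNorm.comp_linearEquiv A, fun M hM => (h.isNorm.volProduct_comp hp A).symm ▸ h.le M hM⟩

end centroid

lemma le_of_volume_inequalities {A A' b m t F Z c μ n p : ℝ} (hA : 0 < A) (hm : 0 < m)
    (hZ0 : 0 < Z) (hc0 : 0 < c) (hμ : 0 < μ) (hn : 0 < n) (hp : 0 < p)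
    (hb : b = m * μ ^ n) (hF : F = μ ^ p * (n / (n + p) * A)) (hZ : Z ≤ F)
    (hc : c ^ p * (n * m) = (n + p) * Z)
    (hiv : A ^ ((n + p) / p) * b ≤ m ^ ((n + p) / p) * t) (hA' : A' = c ^ (-n) * t) :
    A ≤ A' ∧ (A = A' → F = Z ∧ A ^ ((n + p) / p) * b = m ^ ((n + p) / p) * t) := by
  have hF0 : 0 < F := hZ0.trans_le hZ
  set ρ := F / Z with hρ
  have hρ1 : 1 ≤ ρ := (one_le_div hZ0).2 hZ
  have hx : A / m = (c / μ) ^ p * ρ := by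
    have hμp := (Real.rpow_pos_of_pos hμ p).ne'
    rw [Real.div_rpow hc0.le hμ.le, hρ, hF]
    have : c ^ p = (n + p) * Z / (n * m) := by field_simp; linarith
    rw [this]
    field_simp
  have hxs : (A / m) ^ (n / p) = (c / μ) ^ n * ρ ^ (n / p) := by
    rw [hx, Real.mul_rpow (by positivity) (by positivity), ← Real.rpow_mul (by positivity)]
    congr 2; field_simp
  have he : (n + p) / p = n / p + 1 := by field_simp
  have hmul : A ^ ((n + p) / p) * b = m ^ ((n + p) / p) * (c ^ n * (ρ ^ (n / p) * A)) := by
    have h1 : A = (A / m) * m := by field_simp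
    calc A ^ ((n + p) / p) * b = ((A / m) ^ ((n + p) / p) * m ^ ((n + p) / p)) * b := by
          rw [← Real.mul_rpow (by positivity) hm.le, ← h1]
      _ = m ^ ((n + p) / p) * ((A / m) ^ (n / p) * (A / m) * b) := by
          rw [he, Real.rpow_add_one (by positivity : A / m ≠ 0)]; ring
      _ = _ := by
          rw [hxs, hb, Real.div_rpow hc0.le hμ.le]
          have := (Real.rpow_pos_of_pos hμ n).ne'
          field_simp
  have hmp : 0 < m ^ ((n + p) / p) := by positivity
  have hcn : 0 < c ^ n := by positivity
  have ht : t = c ^ n * A' := by rw [hA', Real.rpow_neg hc0.le]; field_simp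
  rw [hmul, ht] at hiv
  have h2 : ρ ^ (n / p) * A ≤ A' := by
    have := le_of_mul_le_mul_left hiv hmp
    exact le_of_mul_le_mul_left this hcn
  have h3 : 1 ≤ ρ ^ (n / p) := Real.one_le_rpow hρ1 (by positivity)
  refine ⟨by nlinarith, fun h => ?_⟩
  have h4 : ρ ^ (n / p) = 1 := by
    apply le_antisymm _ h3
    rw [← h] at h2
    by_contra hcon
    nlinarith [not_le.1 hcon]
  have h5 : ρ = 1 := by
    by_contra hne
    exact absurd h4 (Real.one_lt_rpow (lt_of_le_of_ne hρ1 (Ne.symm hne)) (by positivity)).ne'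
  refine ⟨?_, ?_⟩
  · rw [hρ, div_eq_one_iff_eq hZ0.ne'] at h5; exact h5
  · rw [hmul, h4, one_mul, ht, h]

section comparison

variable {n : ℕ} {p : ℝ}

theorem IsMaximalNorm.ballVol_centroidNorm_le {M f : 𝔼 n → ℝ} (hM : IsMaximalNorm p M) (hn : 0 < n)
    (hp : 1 ≤ p) (hf : IsNice f) {φ : ℝ → ℝ} (hφ : Measurable φ) (hφ0 : ∀ s, 0 ≤ φ s)
    (hφM : IsNice fun x => φ (M x))
    (hyp : ∀ H : 𝔼 n → ℝ, IsNorm H → ballVol H = ballVol M →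
      ∫ x, φ (H x) * H x ^ p ≤ ∫ x, f x * H x ^ p) :
    ballVol (centroidNorm p f) ≤ ballVol (centroidNorm p fun x => φ (M x)) ∧
    (ballVol (centroidNorm p f) = ballVol (centroidNorm p fun x => φ (M x)) →
      IsMaximalNorm p (centroidNorm p f) ∧ ∃ μ : ℝ, 0 < μ ∧
        ballVol (fun x => μ * ballCentroidNorm p (centroidNorm p f) x) = ballVol M ∧
        ∫ x, f x * (μ * ballCentroidNorm p (centroidNorm p f) x) ^ p =
          ∫ x, φ (μ * ballCentroidNorm p (centroidNorm p f) x) *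
            (μ * ballCentroidNorm p (centroidNorm p f) x) ^ p) := by
  have hp0 : 0 < p := by linarith
  have hn' : (0 : ℝ) < n := by exact_mod_cast hn
  have hMn := hM.isNorm
  have hN := hf.isNorm_centroidNorm hp
  set N := centroidNorm p f with hNdef
  have hT := hN.isNorm_ballCentroidNorm hp
  set T := ballCentroidNorm p N with hTdef
  have hTM := hMn.isNorm_ballCentroidNorm hp
  have hA := hN.ballVol_pos
  have hm := hMn.ballVol_pos
  have hb := hT.ballVol_pos
  set A := ballVol N with hAdef
  set b := ballVol T with hbdef
  set m := ballVol M with hmdef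
  set r := radMoment (n + p) φ with hr
  have hr0 : 0 < r := by
    obtain ⟨ξ, hξ⟩ : ∃ ξ : 𝔼 n, ξ ≠ 0 := by
      have : Nonempty (Fin n) := ⟨⟨0, hn⟩⟩
      exact exists_ne 0
    have h1 := hMn.centroidNorm_comp_rpow hn hp0 hφM hφ hφ0 ξ
    have h2 : 0 < centroidNorm p (fun x => φ (M x)) ξ ^ p :=
      Real.rpow_pos_of_pos ((hφM.isNorm_centroidNorm hp).pos ξ hξ) _
    have h3 : 0 < ballCentroidNorm p M ξ ^ p := Real.rpow_pos_of_pos (hTM.pos ξ hξ) _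
    rw [h1] at h2
    have h4 := pos_of_mul_pos_left h2 h3.le
    exact pos_of_mul_pos_right h4 (by positivity)
  set c := ((n + p) * r) ^ (1 / p) with hc
  have hc0 : 0 < c := by positivity
  have hcp : c ^ p = (n + p) * r := by rw [hc, one_div, Real.rpow_inv_rpow (by positivity) hp0.ne']
  have hN' : (centroidNorm p fun x => φ (M x)) = fun ξ => c * ballCentroidNorm p M ξ := by
    ext ξ
    have h1 := hMn.centroidNorm_comp_rpow hn hp0 hφM hφ hφ0 ξ
    rw [← hr, ← hcp, ← Real.mul_rpow hc0.le (hTM.nonneg ξ)] at h1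
    exact (Real.rpow_left_inj ((hφM.isNorm_centroidNorm hp).nonneg ξ)
      (mul_nonneg hc0.le (hTM.nonneg ξ)) hp0.ne').1 h1
  have hA' : ballVol (centroidNorm p fun x => φ (M x)) =
      c ^ (-(n : ℝ)) * ballVol (ballCentroidNorm p M) := by
    rw [hN', hTM.ballVol_const_mul hc0]
  set μ := (b / m) ^ (1 / (n : ℝ)) with hμ
  have hμ0 : 0 < μ := by positivity
  have hμn : μ ^ (n : ℝ) = b / m := by
    rw [hμ, one_div, Real.rpow_inv_rpow (by positivity) hn'.ne']
  have hH := hT.const_mul hμ0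
  have hHvol : ballVol (fun x => μ * T x) = m := by
    rw [hT.ballVol_const_mul hμ0, Real.rpow_neg hμ0.le, hμn, ← hbdef]; field_simp
  have hFT : ∫ x, f x * T x ^ p = n / (n + p) * A := by
    have h1 := hf.integral_mul_centroidNorm_rpow_comm hN.isNice_ball hp0
    have h2 := hN.integral_comp_mul_rpow (p := p) hn measurable_indicator_Iic indicator_Iic_nonneg
    rw [radMoment_indicator (by positivity), h1] at h2
    rw [hTdef, ballCentroidNorm, h2]
    field_simp
    rfl
  have hF : ∫ x, f x * (μ * T x) ^ p = μ ^ p * (n / (n + p) * A) := by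
    rw [← hFT, ← integral_const_mul]
    congr 1; ext x
    rw [Real.mul_rpow hμ0.le (hT.nonneg x)]; ring
  have hZ : ∫ x, φ (μ * T x) * (μ * T x) ^ p = n * r * m := by
    have := hH.integral_comp_mul_rpow (p := p) hn hφ hφ0
    rw [this, hHvol]
  have hle := hyp _ hH hHvol
  have hiv := hM.le N hN
  unfold volProduct at hiv
  obtain ⟨h1, h2⟩ := le_of_volume_inequalities (A := A) (b := b) (m := m)
    (F := ∫ x, f x * (μ * T x) ^ p) (Z := ∫ x, φ (μ * T x) * (μ * T x) ^ p) (c := c) (μ := μ) hA hm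
    (by rw [hZ]; positivity) hc0 hμ0 hn' hp0 (by rw [hμn]; field_simp) hF hle
    (by rw [hZ, hcp]; ring) hiv hA'
  refine ⟨h1, fun he => ?_⟩
  obtain ⟨h3, h4⟩ := h2 he
  refine ⟨⟨hN, fun K hK => ?_⟩, μ, hμ0, hHvol, h3⟩
  have h5 : volProduct p N = volProduct p M := h4
  exact h5 ▸ hM.le K hK

end comparison

lemma rpow_tangent_lt {l a b : ℝ} (hl : 1 < l) (ha : 0 ≤ a) (hb : 0 ≤ b) (hab : b ≠ a) :
    a ^ l + l * a ^ (l - 1) * (b - a) < b ^ l := by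
  rcases ha.eq_or_lt with rfl | ha
  · rw [Real.zero_rpow (by linarith), Real.zero_rpow (by linarith)]
    have := Real.rpow_pos_of_pos (lt_of_le_of_ne hb hab.symm) l
    linarith
  · have h1 := one_add_mul_self_lt_rpow_one_add (s := b / a - 1) (p := l)
      (by have : 0 ≤ b / a := by positivity
          linarith) (by rw [sub_ne_zero, Ne, div_eq_one_iff_eq ha.ne']; exact hab) hl
    rw [add_sub_cancel, Real.div_rpow hb ha.le, lt_div_iff₀ (by positivity)] at h1
    have h2 : a ^ l = a ^ (l - 1) * a := by
      rw [← Real.rpow_add_one ha.ne']; congr 1; ring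
    have h3 : (1 + l * (b / a - 1)) * a ^ l = a ^ l + l * a ^ (l - 1) * (b - a) := by
      rw [h2]; field_simp
    linarith

lemma rpow_profile_tangent_lt {l κ h b : ℝ} (hl : 1 < l) (hκ : 0 < κ) (hb : 0 ≤ b)
    (hab : b ≠ κ * max (1 - h) 0 ^ (1 / (l - 1))) :
    (κ * max (1 - h) 0 ^ (1 / (l - 1))) ^ l +
      l * κ ^ (l - 1) * ((1 - h) * (b - κ * max (1 - h) 0 ^ (1 / (l - 1)))) < b ^ l := by
  set a := κ * max (1 - h) 0 ^ (1 / (l - 1)) with ha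
  have ha0 : 0 ≤ a := by positivity
  have h1 := rpow_tangent_lt hl ha0 hb hab
  have hl' : (0 : ℝ) < l - 1 := by linarith
  have h2 : a ^ (l - 1) = κ ^ (l - 1) * max (1 - h) 0 := by
    rw [ha, Real.mul_rpow hκ.le (by positivity), one_div, Real.rpow_inv_rpow (by positivity) hl'.ne']
  have h3 : (1 - h) * (b - a) ≤ max (1 - h) 0 * (b - a) := by
    rcases le_total 0 (1 - h) with h4 | h4
    · rw [max_eq_left h4]
    · have : a = 0 := by rw [ha, max_eq_right h4, Real.zero_rpow (by positivity), mul_zero]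
      rw [max_eq_right h4, this, sub_zero, zero_mul]
      exact mul_nonpos_of_nonpos_of_nonneg h4 hb
  have h5 : 0 < l * κ ^ (l - 1) := by positivity
  rw [h2] at h1
  nlinarith

theorem integral_profile_mul_le {α : Type*} [MeasurableSpace α] {μ : Measure α} {l κ : ℝ}
    (hl : 1 < l) (hκ : 0 < κ) {f h φ : α → ℝ} (hφ : φ = fun x => κ * max (1 - h x) 0 ^ (1 / (l - 1)))
    (hf0 : ∀ x, 0 ≤ f x) (hf : Integrable f μ) (hφi : Integrable φ μ)
    (hfl : Integrable (fun x => f x ^ l) μ) (hφl : Integrable (fun x => φ x ^ l) μ)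
    (hfh : Integrable (fun x => f x * h x) μ) (hφh : Integrable (fun x => φ x * h x) μ)
    (h1 : ∫ x, f x ∂μ = ∫ x, φ x ∂μ) (h2 : ∫ x, f x ^ l ∂μ = ∫ x, φ x ^ l ∂μ) :
    ∫ x, φ x * h x ∂μ ≤ ∫ x, f x * h x ∂μ ∧
      (∫ x, f x * h x ∂μ = ∫ x, φ x * h x ∂μ → f =ᵐ[μ] φ) := by
  set D : α → ℝ := fun x => (f x ^ l - φ x ^ l) -
    l * κ ^ (l - 1) * ((f x - φ x) - (f x * h x - φ x * h x)) with hD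
  have hDpos : ∀ x, f x ≠ φ x → 0 < D x := by
    intro x hx
    have hx' : f x ≠ κ * max (1 - h x) 0 ^ (1 / (l - 1)) := by rw [hφ] at hx; exact hx
    have h3 := rpow_profile_tangent_lt hl hκ (hf0 x) hx'
    have h4 : φ x = κ * max (1 - h x) 0 ^ (1 / (l - 1)) := by rw [hφ]
    rw [← h4] at h3
    simp only [hD]
    linarith [h3]
  have hD0 : ∀ x, 0 ≤ D x := by
    intro x
    by_cases hx : f x = φ x
    · simp [hD, hx]
    · exact (hDpos x hx).le
  have hDi : Integrable D μ := by fun_prop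
  have hDint : ∫ x, D x ∂μ = l * κ ^ (l - 1) * (∫ x, f x * h x ∂μ - ∫ x, φ x * h x ∂μ) := by
    simp only [hD]
    rw [integral_sub, integral_sub hfl hφl, integral_const_mul, integral_sub,
      integral_sub hf hφi, integral_sub hfh hφh, h1, h2]
    · ring
    all_goals fun_prop
  have hc : 0 < l * κ ^ (l - 1) := by positivity
  refine ⟨?_, fun he => ?_⟩
  · have := integral_nonneg (μ := μ) (f := D) hD0
    rw [hDint] at this
    have := nonneg_of_mul_nonneg_right this hc
    linarith
  · rw [he, sub_self, mul_zero, integral_eq_zero_iff_of_nonneg (f := D) hD0 hDi] at hDint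
    filter_upwards [hDint] with x hx
    by_contra hne
    exact (hDpos x hne).ne' hx

lemma integral_ball_mul_rpow_le {n : ℕ} {p : ℝ} (hp : 0 ≤ p) {H f : 𝔼 n → ℝ} (hH : IsNorm H)
    (hf : IsNice f) (hf1 : ∀ x, f x ≤ 1) (hfH : ∫ x, f x = ballVol H) :
    ∫ x, (Set.Iic (1 : ℝ)).indicator (1 : ℝ → ℝ) (H x) * H x ^ p ≤ ∫ x, f x * H x ^ p := by
  have hb := hH.isNice_ball
  have hc : Continuous fun x => H x ^ p := hH.continuous.rpow_const fun _ => Or.inr hp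
  have h1 := hb.integrable_mul hc
  have h2 := hf.integrable_mul hc
  have h3 : ∫ x, (Set.Iic (1 : ℝ)).indicator (1 : ℝ → ℝ) (H x) = ballVol H := by
    have := hH.integral_ball (fun _ => 1)
    simp only [mul_one] at this
    rw [this]; simp [ballVol]
  have h4 : 0 ≤ ∫ x, ((f x * H x ^ p - (Set.Iic (1 : ℝ)).indicator (1 : ℝ → ℝ) (H x) * H x ^ p)
      - (f x - (Set.Iic (1 : ℝ)).indicator (1 : ℝ → ℝ) (H x))) := by
    refine integral_nonneg fun x => ?_
    have hf0 := hf.nonneg x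
    have hf1 := hf1 x
    by_cases hx : H x ≤ 1
    · have := Real.rpow_le_one (hH.nonneg x) hx hp
      simp only [Set.indicator, Set.mem_Iic, hx, if_true, Pi.zero_apply, Pi.one_apply]
      nlinarith
    · have := Real.one_le_rpow (not_le.1 hx).le hp
      simp only [Set.indicator, Set.mem_Iic, hx, if_false, Pi.zero_apply]
      nlinarith
  have h5 := hf.integrable
  have h6 := hb.integrable
  rw [integral_sub, integral_sub h2 h1, integral_sub h5 h6, hfH, h3] at h4
  · linarith
  all_goals fun_prop

section fibre

variable {p : ℝ}

lemma abs_midpoint_rpow_le (hp : 1 ≤ p) (a b : ℝ) :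
    |(a + b) / 2| ^ p ≤ (|a| ^ p + |b| ^ p) / 2 := by
  have h1 : |(a + b) / 2| ≤ (|a| + |b|) / 2 := by
    rw [abs_div, abs_two]; linarith [abs_add_le a b]
  have h2 := (convexOn_rpow hp).2 (Set.mem_Ici.2 (abs_nonneg a)) (Set.mem_Ici.2 (abs_nonneg b))
    (by norm_num : (0 : ℝ) ≤ 1 / 2) (by norm_num : (0 : ℝ) ≤ 1 / 2) (by norm_num)
  simp only [smul_eq_mul] at h2
  calc |(a + b) / 2| ^ p ≤ ((|a| + |b|) / 2) ^ p := by gcongr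
    _ = (1 / 2 * |a| + 1 / 2 * |b|) ^ p := by congr 1; ring
    _ ≤ _ := by linarith

/-- The `p`-th absolute moment of an affine function over a centred interval. -/
noncomputable def affineMoment (p l t c : ℝ) : ℝ := ∫ s in -l..l, |t * s + c| ^ p

lemma continuous_affine_rpow (hp : 1 ≤ p) (t c : ℝ) : Continuous fun s : ℝ => |t * s + c| ^ p :=
  Continuous.rpow_const (by fun_prop) fun _ => Or.inr (by linarith)

lemma affineMoment_neg (p l t c : ℝ) : affineMoment p l t (-c) = affineMoment p l t c := by
  have h := intervalIntegral.integral_comp_neg (a := -l) (b := l) fun s => |t * s + c| ^ p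
  rw [neg_neg] at h
  rw [affineMoment, affineMoment, ← h]
  congr 1; ext s
  rw [← abs_neg]; congr 2; ring

lemma affineMoment_midpoint_le (hp : 1 ≤ p) {l : ℝ} (hl : 0 ≤ l) (t a b : ℝ) :
    affineMoment p l t ((a + b) / 2) ≤ (affineMoment p l t a + affineMoment p l t b) / 2 := by
  have ia := (continuous_affine_rpow hp t a).intervalIntegrable (μ := volume) (-l) l
  have ib := (continuous_affine_rpow hp t b).intervalIntegrable (μ := volume) (-l) l
  unfold affineMoment
  rw [← intervalIntegral.integral_add ia ib, ← intervalIntegral.integral_div]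
  refine intervalIntegral.integral_mono_on (by linarith)
    ((continuous_affine_rpow hp t _).intervalIntegrable _ _) ((ia.add ib).div_const 2) fun s _ => ?_
  convert abs_midpoint_rpow_le hp (t * s + a) (t * s + b) using 3
  ring

lemma affineMoment_zero_lt (hp : 1 ≤ p) {l c : ℝ} (hl : 0 < l) (hc : c ≠ 0) (t : ℝ) :
    affineMoment p l t 0 < affineMoment p l t c := by
  have ia := (continuous_affine_rpow hp t c).intervalIntegrable (μ := volume) (-l) l
  have ib := (continuous_affine_rpow hp t (-c)).intervalIntegrable (μ := volume) (-l) l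
  have h1 : affineMoment p l t c = (affineMoment p l t c + affineMoment p l t (-c)) / 2 := by
    rw [affineMoment_neg]; ring
  rw [h1]
  unfold affineMoment
  rw [← intervalIntegral.integral_add ia ib, ← intervalIntegral.integral_div]
  refine intervalIntegral.integral_lt_integral_of_continuousOn_of_le_of_exists_lt (by linarith)
    (continuous_affine_rpow hp t _).continuousOn
    (((continuous_affine_rpow hp t _).add (continuous_affine_rpow hp t _)).div_const 2).continuousOn
    (fun s _ => ?_) ⟨0, ⟨by linarith, by linarith⟩, ?_⟩
  · convert abs_midpoint_rpow_le hp (t * s + c) (t * s + -c) using 3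
    ring
  · simp only [mul_zero, zero_add, abs_zero, abs_neg]
    rw [Real.zero_rpow (by linarith)]
    have := Real.rpow_pos_of_pos (abs_pos.2 hc) p
    linarith

lemma integral_Ioo_affine {l : ℝ} (hl : 0 ≤ l) (t c : ℝ) :
    ∫ s in Set.Ioo (-l) l, |t * s + c| ^ p = affineMoment p l t c := by
  rw [affineMoment, intervalIntegral.integral_of_le (by linarith), integral_Ioc_eq_integral_Ioo]

lemma integral_Icc_affine {a b : ℝ} (hab : a ≤ b) (t c : ℝ) :
    ∫ s in Set.Icc a b, |t * s + c| ^ p = affineMoment p ((b - a) / 2) t (t * ((a + b) / 2) + c) := by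
  rw [affineMoment, integral_Icc_eq_integral_Ioc, ← intervalIntegral.integral_of_le hab]
  have h := intervalIntegral.integral_comp_add_right (a := -((b - a) / 2)) (b := (b - a) / 2)
    (fun s => |t * s + c| ^ p) ((a + b) / 2)
  rw [show -((b - a) / 2) + (a + b) / 2 = a by ring, show (b - a) / 2 + (a + b) / 2 = b by ring] at h
  rw [← h]
  congr 1; ext s; congr 2; ring

/-- Centring a segment decreases its affine moments. -/
lemma integral_Ioo_le_integral_segment (hp : 1 ≤ p) {F : Set ℝ}
    (hF : F = ∅ ∨ ∃ a b, a ≤ b ∧ F = Set.Icc a b) (t a b : ℝ) :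
    ∫ s in Set.Ioo (-(volume.real F / 2)) (volume.real F / 2), |t * s + (a + b) / 2| ^ p ≤
      ((∫ s in F, |t * s + a| ^ p) + ∫ s in F, |t * s + -b| ^ p) / 2 := by
  rcases hF with rfl | ⟨u, v, huv, rfl⟩
  · simp
  · have hv : volume.real (Set.Icc u v) = v - u := by
      simp [Measure.real, Real.volume_Icc, huv]
    have hl : 0 ≤ (v - u) / 2 := by linarith
    rw [hv, integral_Ioo_affine hl, integral_Icc_affine huv, integral_Icc_affine huv]
    have h1 := affineMoment_midpoint_le hp hl t (t * ((u + v) / 2) + a) (-(t * ((u + v) / 2) + -b))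
    rw [affineMoment_neg] at h1
    convert h1 using 2
    ring

lemma symmetric_of_integral_Ioo_eq (hp : 1 ≤ p) {F : Set ℝ}
    (hF : F = ∅ ∨ ∃ a b, a ≤ b ∧ F = Set.Icc a b) {t c : ℝ} (ht : t ≠ 0) (hvol : 0 < volume.real F)
    (h : ∫ s in Set.Ioo (-(volume.real F / 2)) (volume.real F / 2), |t * s + 0| ^ p =
      ∫ s in F, |t * s + c| ^ p) (s : ℝ) : 2 * (-c / t) - s ∈ F ↔ s ∈ F := by
  rcases hF with rfl | ⟨u, v, huv, rfl⟩
  · simp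
  · have hv : volume.real (Set.Icc u v) = v - u := by
      simp [Measure.real, Real.volume_Icc, huv]
    rw [hv] at hvol h
    have hl : 0 < (v - u) / 2 := by linarith
    rw [integral_Ioo_affine hl.le, integral_Icc_affine huv] at h
    have h1 : t * ((u + v) / 2) + c = 0 := by
      by_contra hne
      exact (affineMoment_zero_lt hp hl hne t).ne h
    have h2 : -c / t = (u + v) / 2 := by field_simp; linarith
    rw [h2]
    simp only [Set.mem_Icc]
    constructor <;> rintro ⟨h3, h4⟩ <;> constructor <;> linarith

end fibre

section prekopa

variable {d : ℕ} {u h : (Fin d → ℝ) → ℝ}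

lemma integral_le_of_midpoint (hu : Continuous u) (hh : Measurable h) (hu0 : ∀ y, 0 ≤ u y)
    (hh0 : ∀ y, 0 ≤ h y) (hui : Integrable u) (hhi : Integrable h)
    (H : ∀ x y, u x * u (-y) ≤ h ((2⁻¹ : ℝ) • (x + y)) ^ 2) : ∫ y, u y ≤ ∫ y, h y := by
  have h1 := lintegral_mul_lintegral_le_sq (u := fun x => ENNReal.ofReal (u x))
    (v := fun x => ENNReal.ofReal (u (-x))) (h := fun x => ENNReal.ofReal (h x))
    (by fun_prop) (by fun_prop) (by fun_prop) (fun x y => by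
      rw [← ENNReal.ofReal_mul (hu0 _), ← ENNReal.ofReal_pow (hh0 _)]
      exact ENNReal.ofReal_le_ofReal (H x y))
  have h2 : Integrable fun y => u (-y) := hui.comp_neg
  rw [← ofReal_integral_eq_lintegral_ofReal hui (ae_of_all _ hu0),
    ← ofReal_integral_eq_lintegral_ofReal h2 (ae_of_all _ fun y => hu0 _),
    ← ofReal_integral_eq_lintegral_ofReal hhi (ae_of_all _ hh0), integral_neg_eq_self u,
    ← ENNReal.ofReal_mul (integral_nonneg hu0), ← ENNReal.ofReal_pow (integral_nonneg hh0),
    ENNReal.ofReal_le_ofReal_iff (by positivity)] at h1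
  rw [← sq] at h1
  exact (pow_le_pow_iff_left₀ (integral_nonneg hu0) (integral_nonneg hh0) two_ne_zero).1 h1

lemma le_max_of_integral_eq (hu : Continuous u) (hh : Continuous h) (hu0 : ∀ y, 0 ≤ u y)
    (hh0 : ∀ y, 0 ≤ h y) (hui : Integrable u) (hhi : Integrable h)
    (H : ∀ x y, u x * u (-y) ≤ h ((2⁻¹ : ℝ) • (x + y)) ^ 2) (heq : ∫ y, u y = ∫ y, h y)
    {Y : Fin d → ℝ} (hY : ∀ y, u y ≤ u Y) (y : Fin d → ℝ) : h y ≤ u Y := by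
  have hi : Integrable fun y => min (h y) (u Y) := by
    refine hhi.mono' (by fun_prop) (ae_of_all _ fun y => ?_)
    rw [Real.norm_eq_abs, abs_of_nonneg (le_min (hh0 y) (hu0 Y))]
    exact min_le_left _ _
  have h1 := integral_le_of_midpoint (h := fun y => min (h y) (u Y)) hu (by fun_prop) hu0
    (fun y => le_min (hh0 y) (hu0 Y)) hui hi fun x y => by
      rcases le_total (h ((2⁻¹ : ℝ) • (x + y))) (u Y) with hc | hc
      · simp only [min_eq_left hc]; exact H x y
      · simp only [min_eq_right hc, sq]
        exact mul_le_mul (hY _) (hY _) (hu0 _) (hu0 _)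
  have h2 : ∫ y, (h y - min (h y) (u Y)) = 0 := by
    refine le_antisymm ?_ (integral_nonneg fun y => sub_nonneg.2 (min_le_left _ _))
    rw [integral_sub hhi hi]; linarith
  rw [integral_eq_zero_iff_of_nonneg (fun y => sub_nonneg.2 (min_le_left _ _)) (hhi.sub hi)] at h2
  have h3 := ((show Continuous fun y => h y - min (h y) (u Y) by fun_prop).ae_eq_iff_eq volume
    continuous_zero).1 h2
  have h4 := congrFun h3 y
  simp only [Pi.zero_apply] at h4
  have := min_le_right (h y) (u Y)
  linarith

end prekopa

section cons

variable {d : ℕ}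

/-- The point of `ℝ^(d+1)` with first coordinate `s` and remaining coordinates `y`. -/
noncomputable def consE (s : ℝ) (y : Fin d → ℝ) : EuclideanSpace ℝ (Fin (d + 1)) :=
  WithLp.toLp 2 (Fin.cons s y)

lemma inner_consE (s t : ℝ) (x y : Fin d → ℝ) : ⟪consE s x, consE t y⟫ = t * s + ∑ i, x i * y i := by
  simp only [consE, PiLp.inner_apply, Fin.sum_univ_succ, Fin.cons_zero, Fin.cons_succ]
  simp [mul_comm]

lemma consE_add (s t : ℝ) (x y : Fin d → ℝ) : consE s x + consE t y = consE (s + t) (x + y) := by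
  ext i; refine Fin.cases ?_ (fun j => ?_) i <;> simp [consE]

lemma consE_smul (r s : ℝ) (x : Fin d → ℝ) : r • consE s x = consE (r * s) (r • x) := by
  ext i; refine Fin.cases ?_ (fun j => ?_) i <;> simp [consE]

lemma consE_apply_self (x : 𝔼 (d + 1)) : consE (x 0) (fun i => x i.succ) = x := by
  ext i; refine Fin.cases ?_ (fun j => ?_) i <;> simp [consE]

lemma continuous_consE : Continuous fun z : ℝ × (Fin d → ℝ) => consE z.1 z.2 := by
  refine (PiLp.continuous_toLp 2 _).comp (continuous_pi fun i => ?_)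
  refine Fin.cases ?_ (fun j => ?_) i
  · simpa using continuous_fst
  · simpa [Function.comp_def] using (continuous_apply j).comp continuous_snd

lemma abs_le_norm_consE (s : ℝ) (y : Fin d → ℝ) : |s| ≤ ‖consE s y‖ := by
  simpa [consE] using PiLp.norm_apply_le (consE s y) 0

lemma norm_le_norm_consE (s : ℝ) (y : Fin d → ℝ) : ‖y‖ ≤ ‖consE s y‖ := by
  refine (pi_norm_le_iff_of_nonneg (norm_nonneg _)).2 fun i => ?_
  simpa [consE] using PiLp.norm_apply_le (consE s y) i.succ

variable (d) in
/-- Splitting off the first coordinate. -/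
noncomputable def consEquiv : ℝ × (Fin d → ℝ) ≃ᵐ EuclideanSpace ℝ (Fin (d + 1)) :=
  (MeasurableEquiv.piFinSuccAbove (fun _ : Fin (d + 1) => ℝ) 0).symm.trans
    (MeasurableEquiv.toLp 2 (Fin (d + 1) → ℝ))

lemma consEquiv_apply (z : ℝ × (Fin d → ℝ)) : consEquiv d z = consE z.1 z.2 := by
  simp [consEquiv, consE, MeasurableEquiv.piFinSuccAbove, Fin.insertNthEquiv]

lemma measurePreserving_consEquiv : MeasurePreserving (consEquiv d) (volume.prod volume) volume :=
  (volume_preserving_piFinSuccAbove (fun _ : Fin (d + 1) => ℝ) 0).symm.trans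
    (PiLp.volume_preserving_toLp _)

variable {g : 𝔼 (d + 1) → ℝ}

lemma integrable_consE (hg : Integrable g) :
    Integrable (fun z : ℝ × (Fin d → ℝ) => g (consE z.1 z.2)) (volume.prod volume) := by
  have := (measurePreserving_consEquiv (d := d)).integrable_comp_emb (consEquiv d).measurableEmbedding
    (g := g)
  simpa [Function.comp_def, consEquiv_apply] using this.2 hg

lemma integral_consE (g : 𝔼 (d + 1) → ℝ) :
    ∫ z : ℝ × (Fin d → ℝ), g (consE z.1 z.2) ∂(volume.prod volume) = ∫ x, g x := by
  have := (measurePreserving_consEquiv (d := d)).integral_comp (consEquiv d).measurableEmbedding g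
  simpa [consEquiv_apply] using this

end cons

section steiner

variable {d : ℕ} {N : 𝔼 (d + 1) → ℝ}

/-- The fibre of the unit ball of `N` over `y`, in the direction of the first coordinate. -/
def fibre {d : ℕ} (N : EuclideanSpace ℝ (Fin (d + 1)) → ℝ) (y : Fin d → ℝ) : Set ℝ :=
  {s | N (consE s y) ≤ 1}

/-- Half the length of a fibre. -/
noncomputable def halfLength {d : ℕ} (N : EuclideanSpace ℝ (Fin (d + 1)) → ℝ) (y : Fin d → ℝ) : ℝ :=
  volume.real (fibre N y) / 2

open Classical in
/-- The indicator of the Steiner symmetral of the unit ball of `N`. -/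
noncomputable def steinerInd {d : ℕ} (N : EuclideanSpace ℝ (Fin (d + 1)) → ℝ)
    (x : EuclideanSpace ℝ (Fin (d + 1))) : ℝ :=
  if |x 0| < halfLength N (fun i => x i.succ) then 1 else 0

lemma steinerInd_consE_mul (y : Fin d → ℝ) (g : ℝ → ℝ) (s : ℝ) :
    steinerInd N (consE s y) * g s = (Set.Ioo (-halfLength N y) (halfLength N y)).indicator g s := by
  simp [steinerInd, consE, Set.indicator, abs_lt]

lemma integral_steinerInd_consE (y : Fin d → ℝ) (g : ℝ → ℝ) :
    ∫ s, steinerInd N (consE s y) * g s = ∫ s in Set.Ioo (-halfLength N y) (halfLength N y), g s := by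
  simp_rw [steinerInd_consE_mul]
  exact integral_indicator measurableSet_Ioo

namespace IsNorm

lemma isClosed_fibre (h : IsNorm N) (y : Fin d → ℝ) : IsClosed (fibre N y) :=
  isClosed_le (h.continuous.comp (continuous_consE.comp (by fun_prop : Continuous fun s => (s, y))))
    continuous_const

lemma integral_ball_consE (h : IsNorm N) (y : Fin d → ℝ) (g : ℝ → ℝ) :
    ∫ s, (Set.Iic (1 : ℝ)).indicator (1 : ℝ → ℝ) (N (consE s y)) * g s = ∫ s in fibre N y, g s := by
  rw [← integral_indicator (h.isClosed_fibre y).measurableSet]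
  congr 1; ext s
  by_cases hs : N (consE s y) ≤ 1 <;> simp [fibre, Set.indicator, hs]

lemma exists_radius (h : IsNorm N) : ∃ R, 0 ≤ R ∧ ∀ x, N x ≤ 1 → ‖x‖ ≤ R := by
  obtain ⟨c, hc, hN⟩ := h.exists_ge
  refine ⟨1 / c, by positivity, fun x hx => ?_⟩
  rw [le_div_iff₀ hc, mul_comm]
  exact (hN x).trans hx

lemma fibre_eq (h : IsNorm N) (y : Fin d → ℝ) :
    fibre N y = ∅ ∨ ∃ a b, a ≤ b ∧ fibre N y = Set.Icc a b := by
  rcases (fibre N y).eq_empty_or_nonempty with h0 | h0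
  · exact Or.inl h0
  right
  obtain ⟨R, -, hR⟩ := h.exists_radius
  have hconv : Convex ℝ (fibre N y) := by
    intro s hs t ht a b ha hb hab
    have e : consE (a • s + b • t) y = a • consE s y + b • consE t y := by
      rw [consE_smul, consE_smul, consE_add, ← add_smul, hab, one_smul]; rfl
    have h1 : N (consE s y) ≤ 1 := hs
    have h2 : N (consE t y) ≤ 1 := ht
    have h3 := h.add_le (a • consE s y) (b • consE t y)
    rw [h.smul, h.smul, abs_of_nonneg ha, abs_of_nonneg hb] at h3
    show N _ ≤ 1
    rw [e]
    nlinarith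
  have hcomp : IsCompact (fibre N y) := by
    refine (isCompact_Icc (a := -R) (b := R)).of_isClosed_subset (h.isClosed_fibre y) fun s hs => ?_
    exact abs_le.1 ((abs_le_norm_consE s y).trans (hR _ hs))
  refine ⟨_, _, ?_, eq_Icc_of_connected_compact ⟨h0, hconv.isPreconnected⟩ hcomp⟩
  exact csInf_le_csSup h0 hcomp.bddBelow hcomp.bddAbove

lemma measurable_halfLength (h : IsNorm N) : Measurable (halfLength N) := by
  have h1 : MeasurableSet {z : ℝ × (Fin d → ℝ) | N (consE z.1 z.2) ≤ 1} :=
    (isClosed_le (h.continuous.comp continuous_consE) continuous_const).measurableSet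
  exact (measurable_measure_prodMk_right (μ := volume) h1).ennreal_toReal.div_const 2

lemma halfLength_le (h : IsNorm N) : ∃ R, 0 ≤ R ∧ ∀ s y, |s| < halfLength N y → ‖consE s y‖ ≤ R := by
  obtain ⟨R, hR0, hR⟩ := h.exists_radius
  refine ⟨3 * R, by positivity, fun s y hs => ?_⟩
  have hl : halfLength N y ≤ R := by
    have h1 : volume.real (fibre N y) ≤ volume.real (Set.Icc (-R) R) :=
      measureReal_mono (fun s hs => abs_le.1 ((abs_le_norm_consE s y).trans (hR _ hs)))
        (by simp)
    rw [Measure.real, Measure.real, Real.volume_Icc, ENNReal.toReal_ofReal (by linarith)] at h1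
    rw [halfLength, Measure.real]; linarith
  have hne : (fibre N y).Nonempty := by
    rw [Set.nonempty_iff_ne_empty]
    intro h0
    simp only [halfLength, h0, measureReal_empty, zero_div] at hs
    exact absurd hs (abs_nonneg s).not_gt
  obtain ⟨s', hs'⟩ := hne
  have e : consE s y = consE s' y + consE (s - s') 0 := by rw [consE_add]; simp
  have h2 : ‖consE (d := d) (s - s') 0‖ = |s - s'| := by
    simp [consE, EuclideanSpace.norm_eq, Fin.sum_univ_succ, Real.sqrt_sq_eq_abs]
  have h3 := hR _ hs'
  have h4 := abs_le_norm_consE s' y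
  have h5 := abs_sub s s'
  calc ‖consE s y‖ ≤ ‖consE s' y‖ + |s - s'| := by rw [e, ← h2]; exact norm_add_le _ _
    _ ≤ R + (|s| + |s'|) := by gcongr
    _ ≤ 3 * R := by linarith

lemma measurable_steinerInd (h : IsNorm N) : Measurable (steinerInd N) := by
  refine Measurable.ite (measurableSet_lt ?_ ?_) measurable_const measurable_const
  · fun_prop
  · exact h.measurable_halfLength.comp (by fun_prop)

lemma integrable_steinerInd (h : IsNorm N) : Integrable (steinerInd N) := by
  obtain ⟨R, hR0, hR⟩ := h.halfLength_le
  have h1 : IntegrableOn (steinerInd N) (Metric.closedBall 0 R) := by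
    refine Measure.integrableOn_of_bounded (M := 1) measure_closedBall_lt_top.ne
      h.measurable_steinerInd.aestronglyMeasurable (ae_of_all _ fun x => ?_)
    unfold steinerInd; split_ifs <;> simp
  refine (integrableOn_iff_integrable_of_support_subset fun x hx => ?_).1 h1
  by_contra hcon
  refine hx ?_
  unfold steinerInd
  rw [if_neg]
  intro hlt
  have := hR _ _ hlt
  rw [consE_apply_self] at this
  exact hcon (mem_closedBall_zero_iff.2 this)

lemma integral_steinerInd (h : IsNorm N) : ∫ x, steinerInd N x = ballVol N := by
  have h2 : ∫ x, (Set.Iic (1 : ℝ)).indicator (1 : ℝ → ℝ) (N x) = ballVol N := by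
    have := h.integral_ball (fun _ => 1)
    simp only [mul_one] at this
    rw [this]; simp [ballVol]
  rw [← h2, ← integral_consE, ← integral_consE,
    integral_prod_symm _ (integrable_consE h.integrable_steinerInd),
    integral_prod_symm _ (integrable_consE h.isNice_ball.integrable)]
  congr 1; ext y
  have e1 := integral_steinerInd_consE (N := N) y (fun _ => 1)
  have e2 := h.integral_ball_consE y (fun _ => 1)
  have hl : 0 ≤ halfLength N y := by unfold halfLength; positivity
  simp only [mul_one] at e1 e2
  rw [e1, e2]
  simp only [integral_const, smul_eq_mul, mul_one]
  simp only [Measure.real, Measure.restrict_apply, MeasurableSet.univ, Set.univ_inter, Real.volume_Ioo]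
  rw [ENNReal.toReal_ofReal (by linarith), halfLength, Measure.real]; ring

lemma isNice_steinerInd (h : IsNorm N) : IsNice (steinerInd N) where
  nonneg x := by unfold steinerInd; split_ifs <;> simp
  integrable := h.integrable_steinerInd
  bounded_support := by
    obtain ⟨R, hR0, hR⟩ := h.halfLength_le
    refine ⟨R, fun x hx => ?_⟩
    unfold steinerInd
    rw [if_neg]
    intro hlt
    have := hR _ _ hlt
    rw [consE_apply_self] at this
    linarith
  integral_pos := by rw [h.integral_steinerInd]; exact h.ballVol_pos

lemma eq_of_ae_ball_eq {n : ℕ} {N M : 𝔼 n → ℝ} (hN : IsNorm N) (hM : IsNorm M)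
    (h : ∀ᵐ x, N x ≤ 1 → M x ≤ 1) (x : 𝔼 n) : M x ≤ N x := by
  by_contra! hlt
  obtain ⟨r, h1, h2⟩ := exists_between hlt
  have hr : 0 < r := (hN.nonneg x).trans_lt h1
  have ho : IsOpen {z | N z < 1 ∧ 1 < M z} :=
    (isOpen_lt hN.continuous continuous_const).inter (isOpen_lt continuous_const hM.continuous)
  have hmem : r⁻¹ • x ∈ {z | N z < 1 ∧ 1 < M z} := by
    refine ⟨?_, ?_⟩
    · rw [hN.smul, abs_of_pos (by positivity), inv_mul_lt_iff₀ hr]; linarith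
    · rw [hM.smul, abs_of_pos (by positivity), lt_inv_mul_iff₀ hr]; linarith
  have hpos := ho.measure_pos volume ⟨_, hmem⟩
  refine hpos.ne' (measure_mono_null ?_ h)
  rintro z ⟨h1, h2⟩ h3
  linarith [h3 h1.le]

lemma integrable_exp_neg_rpow {n : ℕ} {N : 𝔼 n → ℝ} (h : IsNorm N) {p : ℝ} (hp : 1 ≤ p) :
    Integrable fun x => Real.exp (-N x ^ p) := by
  obtain ⟨c, hc, hN⟩ := h.exists_ge
  have hcont : Continuous fun x => Real.exp (-N x ^ p) :=
    Real.continuous_exp.comp (h.continuous.rpow_const fun _ => Or.inr (by linarith)).neg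
  have h1 : Integrable fun x : 𝔼 n => Real.exp 1 * Real.exp (-(c * ‖x‖)) := by
    refine Integrable.const_mul ?_ _
    rcases subsingleton_or_nontrivial (𝔼 n) with hs | hs
    · exact Continuous.integrable_of_hasCompactSupport (by fun_prop)
        (HasCompactSupport.of_compactSpace _)
    · rw [integrable_fun_norm_addHaar volume (f := fun r => Real.exp (-(c * r)))]
      have h2 := integrableOn_rpow_mul_exp_neg_mul_rpow
        (p := 1) (s := ((Module.finrank ℝ (𝔼 n) - 1 : ℕ) : ℝ)) (b := c)
        (by have : (0 : ℝ) ≤ ((Module.finrank ℝ (𝔼 n) - 1 : ℕ) : ℝ) := Nat.cast_nonneg _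
            linarith) one_pos hc
      refine h2.congr_fun (fun r _ => ?_) measurableSet_Ioi
      simp
  refine h1.mono' hcont.aestronglyMeasurable (ae_of_all _ fun x => ?_)
  rw [Real.norm_eq_abs, Real.abs_exp, ← Real.exp_add]
  refine Real.exp_le_exp.2 ?_
  have h3 := hN x
  have h4 : N x - 1 ≤ N x ^ p := by
    rcases le_total 1 (N x) with h5 | h5
    · have := Real.self_le_rpow_of_one_le h5 hp; linarith
    · have := Real.rpow_nonneg (h.nonneg x) p; linarith
  linarith

end IsNorm

end steiner

section steiner

variable {d : ℕ} {N : 𝔼 (d + 1) → ℝ} {p : ℝ}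

lemma IsNice.centroidNorm_consE_rpow {f : 𝔼 (d + 1) → ℝ} (hf : IsNice f) (hp : 0 < p) (t : ℝ)
    (y : Fin d → ℝ) :
    Integrable (fun x : Fin d → ℝ => ∫ s, f (consE s x) * |t * s + ∑ i, x i * y i| ^ p) ∧
    centroidNorm p f (consE t y) ^ p =
      ∫ x : Fin d → ℝ, ∫ s, f (consE s x) * |t * s + ∑ i, x i * y i| ^ p := by
  have hi := integrable_consE (hf.integrable_mul (IsNice.continuous_weight hp.le (consE t y)))
  simp only [inner_consE] at hi
  refine ⟨hi.integral_prod_right, ?_⟩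
  rw [hf.centroidNorm_rpow hp, ← integral_consE]
  simp only [inner_consE]
  exact integral_prod_symm _ hi

lemma IsNorm.fibre_moment_le (h : IsNorm N) (hp : 1 ≤ p) (t : ℝ) (y z x : Fin d → ℝ) :
    ∫ s, steinerInd N (consE s x) * |t * s + ∑ i, x i * ((2⁻¹ : ℝ) • (y + z)) i| ^ p ≤
      ((∫ s, (Set.Iic (1 : ℝ)).indicator (1 : ℝ → ℝ) (N (consE s x)) * |t * s + ∑ i, x i * y i| ^ p) +
      ∫ s, (Set.Iic (1 : ℝ)).indicator (1 : ℝ → ℝ) (N (consE s x)) *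
        |t * s + ∑ i, x i * (-z) i| ^ p) / 2 := by
  rw [integral_steinerInd_consE x fun s => |t * s + ∑ i, x i * ((2⁻¹ : ℝ) • (y + z)) i| ^ p,
    h.integral_ball_consE x fun s => |t * s + ∑ i, x i * y i| ^ p,
    h.integral_ball_consE x fun s => |t * s + ∑ i, x i * (-z) i| ^ p]
  have h1 := integral_Ioo_le_integral_segment hp (h.fibre_eq x) t (∑ i, x i * y i) (∑ i, x i * z i)
  have e1 : ∑ i, x i * ((2⁻¹ : ℝ) • (y + z)) i = ((∑ i, x i * y i) + ∑ i, x i * z i) / 2 := by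
    rw [← Finset.sum_add_distrib, Finset.sum_div]
    refine Finset.sum_congr rfl fun i _ => ?_
    simp only [Pi.smul_apply, Pi.add_apply, smul_eq_mul]; ring
  have e2 : ∑ i, x i * (-z) i = -∑ i, x i * z i := by simp
  rw [e1, e2]
  exact h1

lemma IsNorm.centroidNorm_steinerInd_le (h : IsNorm N) (hp : 1 ≤ p) (t : ℝ) (y z : Fin d → ℝ) :
    centroidNorm p (steinerInd N) (consE t ((2⁻¹ : ℝ) • (y + z))) ^ p ≤
      (ballCentroidNorm p N (consE t y) ^ p + ballCentroidNorm p N (consE t (-z)) ^ p) / 2 := by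
  have hp0 : 0 < p := by linarith
  obtain ⟨i1, e1⟩ := h.isNice_steinerInd.centroidNorm_consE_rpow hp0 t ((2⁻¹ : ℝ) • (y + z))
  obtain ⟨i2, e2⟩ := h.isNice_ball.centroidNorm_consE_rpow hp0 t y
  obtain ⟨i3, e3⟩ := h.isNice_ball.centroidNorm_consE_rpow hp0 t (-z)
  unfold ballCentroidNorm
  rw [e1, e2, e3, ← integral_add i2 i3, ← integral_div]
  exact integral_mono i1 ((i2.add i3).div_const 2) fun x => h.fibre_moment_le hp t y z x

lemma IsNorm.integrable_exp_consE {M : 𝔼 (d + 1) → ℝ} (h : IsNorm M) (hp : 1 ≤ p) :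
    Integrable (fun z : ℝ × (Fin d → ℝ) => Real.exp (-M (consE z.1 z.2) ^ p))
      (volume.prod volume) := integrable_consE (h.integrable_exp_neg_rpow hp)

lemma IsNorm.continuous_exp_consE {M : 𝔼 (d + 1) → ℝ} (h : IsNorm M) (hp : 1 ≤ p) (t : ℝ) :
    Continuous fun y : Fin d → ℝ => Real.exp (-M (consE t y) ^ p) := by
  refine Real.continuous_exp.comp (Continuous.rpow_const ?_ fun _ => Or.inr (by linarith)).neg
  exact h.continuous.comp (continuous_consE.comp (by fun_prop : Continuous fun y => (t, y)))

lemma IsNorm.exp_midpoint_le (h : IsNorm N) (hp : 1 ≤ p) (t : ℝ) (y z : Fin d → ℝ) :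
    Real.exp (-ballCentroidNorm p N (consE t y) ^ p) *
      Real.exp (-ballCentroidNorm p N (consE t (-z)) ^ p) ≤
      Real.exp (-centroidNorm p (steinerInd N) (consE t ((2⁻¹ : ℝ) • (y + z))) ^ p) ^ 2 := by
  rw [← Real.exp_add, ← Real.exp_nat_mul]
  refine Real.exp_le_exp.2 ?_
  have := h.centroidNorm_steinerInd_le hp t y z
  push_cast
  linarith

lemma IsMaximalNorm.exists_integral_exp_eq (h : IsMaximalNorm p N) (hp : 1 ≤ p) : ∃ t : ℝ, t ≠ 0 ∧
    Integrable (fun y : Fin d → ℝ => Real.exp (-ballCentroidNorm p N (consE t y) ^ p)) ∧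
    Integrable (fun y : Fin d → ℝ => Real.exp (-centroidNorm p (steinerInd N) (consE t y) ^ p)) ∧
    ∫ y : Fin d → ℝ, Real.exp (-ballCentroidNorm p N (consE t y) ^ p) =
      ∫ y : Fin d → ℝ, Real.exp (-centroidNorm p (steinerInd N) (consE t y) ^ p) := by
  have hN := h.isNorm
  have hp0 : 0 < p := by linarith
  have hT := hN.isNorm_ballCentroidNorm hp
  have hS := hN.isNice_steinerInd.isNorm_centroidNorm hp
  have iT := hT.integrable_exp_consE hp
  have iS := hS.integrable_exp_consE hp
  have hle : ∀ᵐ t : ℝ, ∫ y : Fin d → ℝ, Real.exp (-ballCentroidNorm p N (consE t y) ^ p) ≤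
      ∫ y : Fin d → ℝ, Real.exp (-centroidNorm p (steinerInd N) (consE t y) ^ p) := by
    filter_upwards [iT.prod_right_ae, iS.prod_right_ae] with t h1 h2
    exact integral_le_of_midpoint (hT.continuous_exp_consE hp t)
      (hS.continuous_exp_consE hp t).measurable (fun _ => (Real.exp_pos _).le)
      (fun _ => (Real.exp_pos _).le) h1 h2 fun y z => hN.exp_midpoint_le hp t y z
  have hvol : ballVol (centroidNorm p (steinerInd N)) ≤ ballVol (ballCentroidNorm p N) := by
    refine (h.ballVol_centroidNorm_le (Nat.succ_pos d) hp hN.isNice_steinerInd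
      measurable_indicator_Iic indicator_Iic_nonneg hN.isNice_ball fun H hH hHv => ?_).1
    refine integral_ball_mul_rpow_le hp0.le hH hN.isNice_steinerInd (fun x => ?_) ?_
    · unfold steinerInd; split_ifs <;> simp
    · rw [hN.integral_steinerInd, hHv]
  have hm : Measurable fun s : ℝ => Real.exp (-s ^ p) := by fun_prop
  have hinteg : ∫ x, Real.exp (-centroidNorm p (steinerInd N) x ^ p) ≤
      ∫ x, Real.exp (-ballCentroidNorm p N x ^ p) := by
    rw [hS.integral_comp (Nat.succ_pos d) hm fun _ => (Real.exp_pos _).le,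
      hT.integral_comp (Nat.succ_pos d) hm fun _ => (Real.exp_pos _).le]
    refine mul_le_mul_of_nonneg_left hvol (mul_nonneg (by positivity) ?_)
    exact setIntegral_nonneg measurableSet_Ioi fun s hs =>
      mul_nonneg (Real.rpow_nonneg (le_of_lt hs) _) (Real.exp_pos _).le
  have hzero : ∫ t : ℝ, ((∫ y : Fin d → ℝ, Real.exp (-centroidNorm p (steinerInd N) (consE t y) ^ p)) -
      ∫ y : Fin d → ℝ, Real.exp (-ballCentroidNorm p N (consE t y) ^ p)) = 0 := by
    refine le_antisymm ?_ (integral_nonneg_of_ae (hle.mono fun t ht => sub_nonneg.2 ht))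
    rw [integral_sub iS.integral_prod_left iT.integral_prod_left, ← integral_prod _ iS,
      ← integral_prod _ iT, integral_consE fun x => Real.exp (-centroidNorm p (steinerInd N) x ^ p),
      integral_consE fun x => Real.exp (-ballCentroidNorm p N x ^ p)]
    linarith
  rw [integral_eq_zero_iff_of_nonneg_ae (hle.mono fun t ht => sub_nonneg.2 ht)
    (iS.integral_prod_left.sub iT.integral_prod_left)] at hzero
  have hne : ∀ᵐ t : ℝ, t ≠ 0 := Measure.ae_ne volume 0
  obtain ⟨t, h1, h2, h3, h4⟩ := (hzero.and (hne.and (iT.prod_right_ae.and iS.prod_right_ae))).exists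
  exact ⟨t, h2, h3, h4, (sub_eq_zero.1 h1).symm⟩

/-- The fibres of the unit ball of a maximal norm have collinear midpoints. -/
theorem IsMaximalNorm.ae_fibre_symmetric (h : IsMaximalNorm p N) (hp : 1 ≤ p) : ∃ w : Fin d → ℝ,
    ∀ᵐ x : Fin d → ℝ, 0 < volume.real (fibre N x) →
      ∀ s, 2 * (∑ i, x i * w i) - s ∈ fibre N x ↔ s ∈ fibre N x := by
  have hN := h.isNorm
  have hp0 : 0 < p := by linarith
  have hT := hN.isNorm_ballCentroidNorm hp
  have hS := hN.isNice_steinerInd.isNorm_centroidNorm hp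
  obtain ⟨t, ht, i1, i2, heq⟩ := h.exists_integral_exp_eq hp
  obtain ⟨Y, hY⟩ : ∃ Y : Fin d → ℝ, ∀ y, ballCentroidNorm p N (consE t Y) ≤
      ballCentroidNorm p N (consE t y) := by
    refine Continuous.exists_forall_le
      (hT.continuous.comp (continuous_consE.comp (by fun_prop : Continuous fun y => (t, y)))) ?_
    obtain ⟨c, hc, hcN⟩ := hT.exists_ge
    refine Filter.tendsto_atTop_mono (fun y => ?_)
      ((tendsto_norm_cocompact_atTop (E := Fin d → ℝ)).const_mul_atTop hc)
    exact (mul_le_mul_of_nonneg_left (norm_le_norm_consE t y) hc.le).trans (hcN _)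
  have h1 := le_max_of_integral_eq (hT.continuous_exp_consE hp t) (hS.continuous_exp_consE hp t)
    (fun _ => (Real.exp_pos _).le) (fun _ => (Real.exp_pos _).le) i1 i2
    (fun y z => hN.exp_midpoint_le hp t y z) heq (Y := Y) (fun y => Real.exp_le_exp.2
      (neg_le_neg (Real.rpow_le_rpow (hT.nonneg _) (hY y) hp0.le))) 0
  rw [Real.exp_le_exp, neg_le_neg_iff] at h1
  obtain ⟨j1, e1⟩ := hN.isNice_steinerInd.centroidNorm_consE_rpow hp0 t 0
  obtain ⟨j2, e2⟩ := hN.isNice_ball.centroidNorm_consE_rpow hp0 t Y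
  unfold ballCentroidNorm at h1
  rw [e1, e2] at h1
  have hle : ∀ x : Fin d → ℝ, ∫ s, steinerInd N (consE s x) * |t * s + ∑ i, x i * (0 : Fin d → ℝ) i| ^ p ≤
      ∫ s, (Set.Iic (1 : ℝ)).indicator (1 : ℝ → ℝ) (N (consE s x)) * |t * s + ∑ i, x i * Y i| ^ p := by
    intro x
    have := hN.fibre_moment_le hp t Y (-Y) x
    simp only [add_neg_cancel, smul_zero, neg_neg, add_self_div_two] at this
    exact this
  have hz : ∫ x : Fin d → ℝ, ((∫ s, (Set.Iic (1 : ℝ)).indicator (1 : ℝ → ℝ) (N (consE s x)) *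
      |t * s + ∑ i, x i * Y i| ^ p) -
      ∫ s, steinerInd N (consE s x) * |t * s + ∑ i, x i * (0 : Fin d → ℝ) i| ^ p) = 0 := by
    refine le_antisymm ?_ (integral_nonneg fun x => sub_nonneg.2 (hle x))
    rw [integral_sub j2 j1]
    linarith
  rw [integral_eq_zero_iff_of_nonneg (fun x => sub_nonneg.2 (hle x)) (j2.sub j1)] at hz
  refine ⟨fun i => -Y i / t, ?_⟩
  filter_upwards [hz] with x hx hvol s
  have hx' := (sub_eq_zero.1 hx).symm
  simp only [Pi.zero_apply, mul_zero, Finset.sum_const_zero] at hx'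
  rw [integral_steinerInd_consE x fun s => |t * s + 0| ^ p,
    hN.integral_ball_consE x fun s => |t * s + ∑ i, x i * Y i| ^ p] at hx'
  have h3 := symmetric_of_integral_Ioo_eq hp (hN.fibre_eq x) ht hvol hx' s
  rw [← h3]
  have e : ∑ i, x i * (-Y i / t) = -(∑ i, x i * Y i) / t := by
    rw [← Finset.sum_neg_distrib, Finset.sum_div]
    exact Finset.sum_congr rfl fun i _ => by ring
  rw [e]

end steiner

/-- The skew reflection `x ↦ x + 2⟪v, x⟫e`, an involution when `⟪v, e⟫ = -1`. -/
noncomputable def skewReflection {n : ℕ} (e v : EuclideanSpace ℝ (Fin n)) (h : ⟪v, e⟫ = -1) :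
    EuclideanSpace ℝ (Fin n) ≃ₗ[ℝ] EuclideanSpace ℝ (Fin n) :=
  LinearEquiv.ofInvolutive
    { toFun := fun x => x + (2 * ⟪v, x⟫) • e
      map_add' := fun x y => by simp only [inner_add_right]; module
      map_smul' := fun c x => by simp only [inner_smul_right, RingHom.id_apply]; module }
    fun x => by
      simp only [LinearMap.coe_mk, AddHom.coe_mk, inner_add_right, inner_smul_right, h]
      module

section euclidean

variable {n d : ℕ} {p : ℝ}

lemma skewReflection_apply {e v : 𝔼 n} (h : ⟪v, e⟫ = -1) (x : 𝔼 n) :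
    skewReflection e v h x = x + (2 * ⟪v, x⟫) • e := rfl

lemma skewReflection_symm_apply {e v : 𝔼 n} (h : ⟪v, e⟫ = -1) (x : 𝔼 n) :
    (skewReflection e v h).symm x = x + (2 * ⟪v, x⟫) • e := rfl

lemma skewReflection_involutive {e v : 𝔼 n} (h : ⟪v, e⟫ = -1) (x : 𝔼 n) :
    skewReflection e v h (skewReflection e v h x) = x :=
  (skewReflection e v h).symm_apply_apply x

lemma IsMaximalNorm.exists_skewReflection_consE {N : 𝔼 (d + 1) → ℝ} (h : IsMaximalNorm p N)
    (hp : 1 ≤ p) : ∃ (v : 𝔼 (d + 1)) (hv : ⟪v, consE 1 (0 : Fin d → ℝ)⟫ = -1),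
      ∀ x, N (skewReflection _ v hv x) = N x := by
  obtain ⟨w, hw⟩ := h.ae_fibre_symmetric hp
  have hN := h.isNorm
  have hv : ⟪consE (-1) w, consE 1 (0 : Fin d → ℝ)⟫ = -1 := by rw [inner_consE]; simp
  refine ⟨consE (-1) w, hv, ?_⟩
  set R := skewReflection _ _ hv with hR
  have hRc : ∀ s x, R (consE s x) = consE (2 * (∑ i, x i * w i) - s) x := by
    intro s x
    rw [hR, skewReflection_apply, inner_consE, consE_smul, consE_add]
    simp only [smul_zero, add_zero, mul_one]
    congr 1
    rw [Finset.sum_congr rfl fun i _ => mul_comm (w i) (x i)]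
    ring
  have hae : ∀ᵐ x, N x ≤ 1 → N (R x) ≤ 1 := by
    have hcR : Continuous R := R.toLinearMap.continuous_of_finiteDimensional
    set S : Set (𝔼 (d + 1)) := {x | N x ≤ 1 ∧ 1 < N (R x)} with hS
    have hSm : MeasurableSet S :=
      (isClosed_le hN.continuous continuous_const).measurableSet.inter
        (isOpen_lt continuous_const (hN.continuous.comp hcR)).measurableSet
    have h0 : volume S = 0 := by
      rw [← (measurePreserving_consEquiv (d := d)).measure_preimage_equiv S,
        Measure.prod_apply_symm ((consEquiv d).measurable hSm), lintegral_eq_zero_iff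
          (measurable_measure_prodMk_right ((consEquiv d).measurable hSm))]
      filter_upwards [hw] with y hy
      have hsub : ((fun s => (s, y)) ⁻¹' (consEquiv d ⁻¹' S)) ⊆ fibre N y := by
        intro s hs
        simp only [Set.mem_preimage, consEquiv_apply] at hs
        exact hs.1
      obtain hpos | hzero := (measureReal_nonneg (μ := volume) (s := fibre N y)).lt_or_eq
      · have : ((fun s => (s, y)) ⁻¹' (consEquiv d ⁻¹' S)) = ∅ := by
          rw [Set.eq_empty_iff_forall_notMem]
          intro s hs
          simp only [Set.mem_preimage, consEquiv_apply] at hs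
          have h2 := hs.2
          rw [hRc] at h2
          exact absurd ((hy hpos s).2 hs.1) (not_le.2 h2)
        simp [this]
      · refine measure_mono_null hsub ?_
        rw [measureReal_def, eq_comm, ENNReal.toReal_eq_zero_iff] at hzero
        refine hzero.resolve_right ?_
        obtain ⟨R, -, h2⟩ := hN.exists_radius
        refine ((Metric.isBounded_closedBall (x := (0 : ℝ)) (r := R)).subset ?_).measure_lt_top.ne
        intro s hs
        rw [mem_closedBall_zero_iff]
        exact (abs_le_norm_consE s y).trans (h2 _ hs)
    filter_upwards [measure_eq_zero_iff_ae_notMem.1 h0] with x hx h1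
    by_contra! h2
    exact hx ⟨h1, h2⟩
  have hle := hN.eq_of_ae_ball_eq (hN.comp_linearEquiv R) hae
  intro x
  refine le_antisymm (hle x) ?_
  have := hle (R x)
  rwa [skewReflection_involutive] at this

lemma exists_linearIsometryEquiv_apply {e e' : 𝔼 n} (h : ‖e‖ = ‖e'‖) :
    ∃ O : 𝔼 n ≃ₗᵢ[ℝ] 𝔼 n, O e = e' :=
  ⟨_, Submodule.reflection_sub h⟩

lemma IsMaximalNorm.exists_skewReflection {N : 𝔼 (d + 1) → ℝ} (h : IsMaximalNorm p N)
    (hp : 1 ≤ p) {e : 𝔼 (d + 1)} (he : ‖e‖ = 1) : ∃ (v : 𝔼 (d + 1)) (hv : ⟪v, e⟫ = -1),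
      ∀ x, N (skewReflection e v hv x) = N x := by
  have h0 : ‖consE 1 (0 : Fin d → ℝ)‖ = ‖e‖ := by
    rw [he, ← sq_eq_sq₀ (norm_nonneg _) zero_le_one, ← real_inner_self_eq_norm_sq, inner_consE]
    simp
  obtain ⟨O, hO⟩ := exists_linearIsometryEquiv_apply h0
  obtain ⟨v, hv, hv'⟩ := (h.comp hp O.toLinearEquiv).exists_skewReflection_consE hp
  refine ⟨O v, by rw [← hO, O.inner_map_map, hv], fun x => ?_⟩
  have := hv' (O.symm x)
  simp only [skewReflection_apply, LinearIsometryEquiv.coe_toLinearEquiv, map_add, map_smul, hO,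
    LinearIsometryEquiv.apply_symm_apply] at this ⊢
  rw [← this, ← O.inner_map_map v, O.apply_symm_apply]

lemma IsMaximalNorm.reflection_invariant {N : 𝔼 (d + 1) → ℝ} (h : IsMaximalNorm p N)
    (hp : 1 ≤ p) {κ : ℝ} (hκ : 0 < κ) (h2 : ∀ ξ, ballCentroidNorm 2 N ξ = κ * ‖ξ‖)
    {e : 𝔼 (d + 1)} (he : ‖e‖ = 1) (x : 𝔼 (d + 1)) : N (x - (2 * ⟪e, x⟫) • e) = N x := by
  obtain ⟨v, hv, hR⟩ := h.exists_skewReflection hp he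
  have hN := h.isNorm
  set R := skewReflection e v hv with hRd
  have hNR : (fun x => N (R x)) = N := funext hR
  have hdet : absDet R = 1 := by
    have := hN.ballVol_comp R
    rw [hNR] at this
    have h3 := hN.ballVol_pos
    have h4 : (absDet R)⁻¹ = 1 := by
      have : ((absDet R)⁻¹ - 1) * ballVol N = 0 := by linarith
      rcases mul_eq_zero.1 this with h | h <;> linarith
    rw [← inv_inv (absDet R), h4, inv_one]
  obtain ⟨B, -, hB⟩ := exists_adjoint_symm R
  have hBe : B e = e + (2 : ℝ) • v := by
    refine ext_inner_left ℝ fun y => ?_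
    rw [← hB, hRd, skewReflection_symm_apply, inner_add_left, inner_smul_left, inner_add_right,
      inner_smul_right, real_inner_self_eq_norm_sq, he, real_inner_comm y v]
    simp
  have h5 := centroidNorm_comp_linearEquiv hN.isNice_ball (p := 2) one_le_two hB e
  simp only [hR, hdet, Real.one_rpow, one_mul] at h5
  have h6 : ballCentroidNorm 2 N e = ballCentroidNorm 2 N (B e) := h5
  rw [h2, h2, hBe] at h6
  have h7 := mul_left_cancel₀ hκ.ne' h6
  have h8 : ‖e + (2 : ℝ) • v‖ ^ 2 = 1 - 4 + 4 * ‖v‖ ^ 2 := by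
    rw [norm_add_sq_real, inner_smul_right, norm_smul, he, real_inner_comm, hv]
    norm_num
    ring
  rw [← h7, he] at h8
  have h9 : ‖v + e‖ ^ 2 = 0 := by
    rw [norm_add_sq_real, hv, he]; linarith
  have h10 : v = -e := eq_neg_of_add_eq_zero_left (norm_eq_zero.1 (pow_eq_zero_iff two_ne_zero |>.1 h9))
  rw [← hR x, hRd, skewReflection_apply, h10, inner_neg_left]
  congr 1
  module

lemma IsMaximalNorm.exists_eq_const_mul_norm {N : 𝔼 (d + 1) → ℝ} (h : IsMaximalNorm p N)
    (hp : 1 ≤ p) {κ : ℝ} (hκ : 0 < κ) (h2 : ∀ ξ, ballCentroidNorm 2 N ξ = κ * ‖ξ‖) :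
    ∃ c : ℝ, 0 < c ∧ ∀ x, N x = c * ‖x‖ := by
  have hN := h.isNorm
  have key : ∀ x y : 𝔼 (d + 1), ‖x‖ = ‖y‖ → N x = N y := by
    intro x y hxy
    by_cases hne : x = y
    · rw [hne]
    have hpos : 0 < ‖x - y‖ := norm_pos_iff.2 (sub_ne_zero.2 hne)
    have he : ‖(‖x - y‖⁻¹ : ℝ) • (x - y)‖ = 1 := by
      rw [norm_smul, norm_inv, norm_norm, inv_mul_cancel₀ hpos.ne']
    rw [← h.reflection_invariant hp hκ h2 he x]
    congr 1
    have h3 : ‖x - y‖ ^ 2 = 2 * ⟪x - y, x⟫ := by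
      rw [norm_sub_sq_real, inner_sub_left, real_inner_self_eq_norm_sq, hxy, real_inner_comm]
      ring
    rw [inner_smul_left, smul_smul]
    have h4 : 2 * ((starRingEnd ℝ) ‖x - y‖⁻¹ * ⟪x - y, x⟫) * ‖x - y‖⁻¹ = 1 := by
      simp only [conj_trivial]
      field_simp
      linarith
    rw [h4]
    module
  set e : 𝔼 (d + 1) := consE 1 (0 : Fin d → ℝ)
  have h0 : ‖e‖ = 1 := by
    rw [← sq_eq_sq₀ (norm_nonneg _) zero_le_one, ← real_inner_self_eq_norm_sq, inner_consE]
    simp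
  refine ⟨N e, hN.pos _ (norm_ne_zero_iff.1 (by rw [h0]; exact one_ne_zero)), fun x => ?_⟩
  rw [key x (‖x‖ • e) (by rw [norm_smul, norm_norm, h0, mul_one]), hN.smul, abs_norm, mul_comm]

open scoped MatrixOrder Matrix.Norms.L2Operator in
lemma IsNice.exists_centroidNorm_two_eq {f : 𝔼 n → ℝ} (hf : IsNice f) :
    ∃ B : 𝔼 n ≃ₗ[ℝ] 𝔼 n, ∀ ξ, centroidNorm 2 f ξ = ‖B ξ‖ := by
  have hsq : ∀ ξ, centroidNorm 2 f ξ ^ 2 = ∫ x, f x * ⟪x, ξ⟫ ^ 2 := by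
    intro ξ
    rw [← Real.rpow_two, hf.centroidNorm_rpow two_pos]
    simp
  set Q : Matrix (Fin n) (Fin n) ℝ := fun i j => ∫ x, f x * (x i * x j) with hQ
  have hinteg : ∀ i j, Integrable fun x : 𝔼 n => f x * (x i * x j) := fun i j =>
    hf.integrable_mul (by fun_prop)
  have hQv : ∀ ξ : Fin n → ℝ, ξ ⬝ᵥ Q.mulVec ξ = ∫ x : 𝔼 n, f x * ⟪x, WithLp.toLp 2 ξ⟫ ^ 2 := by
    intro ξ
    have e1 : ∀ x : 𝔼 n, f x * ⟪x, WithLp.toLp 2 ξ⟫ ^ 2 =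
        ∑ i, ∑ j, ξ i * (f x * (x i * x j) * ξ j) := by
      intro x
      rw [PiLp.inner_apply, sq, Finset.sum_mul_sum, Finset.mul_sum]
      refine Finset.sum_congr rfl fun i _ => ?_
      rw [Finset.mul_sum]
      refine Finset.sum_congr rfl fun j _ => ?_
      simp
      ring
    simp only [e1]
    rw [integral_finsetSum _ fun i _ => integrable_finsetSum _ fun j _ =>
      ((hinteg i j).mul_const _).const_mul _]
    simp only [dotProduct, Matrix.mulVec, Finset.mul_sum]
    refine Finset.sum_congr rfl fun i _ => ?_
    rw [integral_finsetSum _ fun j _ => ((hinteg i j).mul_const _).const_mul _]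
    refine Finset.sum_congr rfl fun j _ => ?_
    rw [integral_const_mul, integral_mul_const]
  have hpsd : Q.PosSemidef := by
    refine Matrix.PosSemidef.of_dotProduct_mulVec_nonneg ?_ fun ξ => ?_
    · ext i j
      rw [Matrix.conjTranspose_apply, star_trivial]
      simp only [hQ, mul_comm]
    · rw [star_trivial, hQv]
      exact integral_nonneg fun x => mul_nonneg (hf.nonneg x) (sq_nonneg _)
  obtain ⟨B, hB⟩ := CStarAlgebra.nonneg_iff_eq_star_mul_self.mp hpsd.nonneg
  have hBn : ∀ ξ : 𝔼 n, centroidNorm 2 f ξ = ‖Matrix.toEuclideanLin B ξ‖ := by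
    intro ξ
    have h1 := hQv (WithLp.ofLp ξ)
    rw [WithLp.toLp_ofLp, ← hsq, hB, Matrix.star_eq_conjTranspose, ← Matrix.mulVec_mulVec,
      Matrix.dotProduct_mulVec, Matrix.vecMul_conjTranspose] at h1
    have hn := (hf.isNorm_centroidNorm one_le_two).nonneg ξ
    rw [← sq_eq_sq₀ hn (norm_nonneg _), ← h1, EuclideanSpace.norm_sq_eq]
    simp [dotProduct, sq]
  have hinj : Function.Injective (Matrix.toEuclideanLin B) := by
    rw [injective_iff_map_eq_zero]
    intro x hx
    by_contra hne
    have := (hf.isNorm_centroidNorm one_le_two).pos x hne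
    rw [hBn, hx, norm_zero] at this
    exact lt_irrefl _ this
  exact ⟨LinearEquiv.ofInjectiveEndo _ hinj, hBn⟩

theorem IsMaximalNorm.exists_linearEquiv_comp_eq_norm {N : 𝔼 (d + 1) → ℝ} (h : IsMaximalNorm p N)
    (hp : 1 ≤ p) : ∃ A : 𝔼 (d + 1) ≃ₗ[ℝ] 𝔼 (d + 1), ∀ x, N (A x) = ‖x‖ := by
  have hN := h.isNorm
  obtain ⟨B, hB⟩ := hN.isNice_ball.exists_centroidNorm_two_eq
  obtain ⟨C, -, hC⟩ := exists_adjoint_symm B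
  have hA : ∀ x y, ⟪C.symm.symm x, y⟫ = ⟪x, B.symm y⟫ := by
    intro x y
    rw [LinearEquiv.symm_symm, real_inner_comm, ← B.symm_apply_apply (B.symm y), B.apply_symm_apply]
    rw [← hC, real_inner_comm]
  have h2 : ∀ ξ, ballCentroidNorm 2 (fun x => N (C.symm x)) ξ =
      absDet C.symm ^ (-(1 / 2 : ℝ)) * ‖ξ‖ := by
    intro ξ
    have := centroidNorm_comp_linearEquiv hN.isNice_ball one_le_two hA ξ
    rw [hB, B.apply_symm_apply] at this
    exact this
  obtain ⟨c, hc, hcN⟩ := (h.comp hp C.symm).exists_eq_const_mul_norm hp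
    (Real.rpow_pos_of_pos (absDet_pos _) _) h2
  refine ⟨(scaleEquiv _ (inv_pos.2 hc)).trans C.symm, fun x => ?_⟩
  simp only [LinearEquiv.trans_apply, scaleEquiv_apply, hcN, norm_smul, norm_inv, Real.norm_eq_abs,
    abs_of_pos hc]
  field_simp

lemma IsMaximalNorm.isMaximalNorm_norm {N : 𝔼 (d + 1) → ℝ} (h : IsMaximalNorm p N)
    (hp : 1 ≤ p) : IsMaximalNorm p fun x : 𝔼 (d + 1) => ‖x‖ := by
  obtain ⟨A, hA⟩ := h.exists_linearEquiv_comp_eq_norm hp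
  have := h.comp hp A
  rwa [show (fun x => N (A x)) = fun x => ‖x‖ from funext hA] at this

end euclidean

section existence

variable {n : ℕ} {p : ℝ}

lemma IsNorm.isCompact_ball {N : 𝔼 n → ℝ} (h : IsNorm N) (r : ℝ) : IsCompact {x | N x ≤ r} :=
  Metric.isCompact_of_isClosed_isBounded (h.isClosed r) (h.isBounded r)

lemma IsNorm.sum_le {N : 𝔼 n → ℝ} (h : IsNorm N) {ι : Type*} (s : Finset ι) (v : ι → 𝔼 n) :
    N (∑ i ∈ s, v i) ≤ ∑ i ∈ s, N (v i) := by
  classical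
  induction s using Finset.induction_on with
  | empty => simp [h.zero]
  | insert i s hi ih =>
    rw [Finset.sum_insert hi, Finset.sum_insert hi]
    exact (h.add_le _ _).trans (by linarith)

/-- Auerbach's lemma, in a weak form. -/
lemma IsNorm.exists_linearEquiv_bounds {N : 𝔼 n → ℝ} (h : IsNorm N) (hn : 0 < n) :
    ∃ A : 𝔼 n ≃ₗ[ℝ] 𝔼 n, ∀ x, (n : ℝ)⁻¹ * ‖x‖ ≤ N (A x) ∧ N (A x) ≤ n * ‖x‖ := by
  have hn' : (0 : ℝ) < n := Nat.cast_pos.2 hn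
  set S : Set (Fin n → 𝔼 n) := Set.univ.pi fun _ => {x | N x ≤ 1} with hS
  set D : (Fin n → 𝔼 n) → Matrix (Fin n) (Fin n) ℝ := fun V => Matrix.of fun i j => V j i with hD
  have hSc : IsCompact S := isCompact_univ_pi fun _ => h.isCompact_ball 1
  have hDc : Continuous fun V => |(D V).det| := by
    refine (Continuous.matrix_det ?_).abs
    refine continuous_matrix fun i j => ?_
    simp only [hD, Matrix.of_apply]
    fun_prop
  obtain ⟨C, hC, hNC⟩ := h.exists_le
  have hunit : (fun j => EuclideanSpace.single j C⁻¹) ∈ S := by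
    intro j _
    refine (hNC _).trans ?_
    rw [PiLp.norm_single, norm_inv, Real.norm_eq_abs, abs_of_pos hC,
      mul_inv_cancel₀ hC.ne']
  obtain ⟨V, hV, hmax⟩ := hSc.exists_isMaxOn ⟨_, hunit⟩ hDc.continuousOn
  have hdet : 0 < |(D V).det| := by
    refine lt_of_lt_of_le ?_ (hmax hunit)
    have : D (fun j => EuclideanSpace.single j C⁻¹) = Matrix.diagonal fun _ => C⁻¹ := by
      ext i j
      simp [hD, Matrix.diagonal_apply]
    simp only [this, Matrix.det_diagonal, Finset.prod_const]
    positivity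
  set A := Matrix.toEuclideanLin (D V) with hA
  have hAsum : ∀ x, A x = ∑ j, x j • V j := by
    intro x
    ext i
    simp [hA, hD, Matrix.toEuclideanLin, Matrix.mulVec, dotProduct, mul_comm]
  have hlow : ∀ x i, |x i| ≤ N (A x) := by
    intro x i
    refine le_of_forall_gt_imp_ge_of_dense fun r hr => ?_
    have hr0 : 0 < r := (h.nonneg _).trans_lt hr
    have hmem : Function.update V i (r⁻¹ • A x) ∈ S := by
      intro j _
      by_cases hj : j = i
      · subst hj
        simp only [Function.update_self, Set.mem_ofPred_eq]
        rw [h.smul, abs_of_pos (inv_pos.2 hr0), inv_mul_le_iff₀ hr0]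
        linarith
      · rw [Function.update_of_ne hj]; exact hV j trivial
    have hle : |(D (Function.update V i (r⁻¹ • A x))).det| ≤ |(D V).det| := hmax hmem
    have hDu : D (Function.update V i (r⁻¹ • A x)) =
        (D V).updateCol i (r⁻¹ • (D V).mulVec x) := by
      ext k j
      by_cases hj : j = i
      · subst hj; simp [hD, hA, Matrix.toEuclideanLin]
      · simp [hD, hj]
    have hcr : (D V).cramer ((D V).mulVec x) i = (D V).det * x i := by
      rw [Matrix.cramer_eq_adjugate_mulVec, Matrix.mulVec_mulVec, Matrix.adjugate_mul,
        Matrix.smul_mulVec, Matrix.one_mulVec]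
      rfl
    rw [hDu, Matrix.det_updateCol_smul, ← Matrix.cramer_apply, hcr, abs_mul, abs_mul,
      abs_of_pos (inv_pos.2 hr0), inv_mul_le_iff₀ hr0, mul_comm r] at hle
    exact le_of_mul_le_mul_left hle hdet
  have hinj : Function.Injective A := by
    rw [injective_iff_map_eq_zero]
    intro x hx
    ext i
    have := hlow x i
    rw [hx, h.zero] at this
    exact abs_eq_zero.1 (le_antisymm this (abs_nonneg _))
  refine ⟨LinearEquiv.ofInjectiveEndo A hinj, fun x => ⟨?_, ?_⟩⟩
  · have h1 : ‖x‖ ≤ ∑ i, |x i| := by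
      have h2 : x = ∑ i, EuclideanSpace.single i (x i) := by
        ext j; simp [Finset.sum_apply, Pi.single_apply]
      calc ‖x‖ = ‖∑ i, EuclideanSpace.single i (x i)‖ := by rw [← h2]
        _ ≤ ∑ i, ‖EuclideanSpace.single i (x i)‖ := norm_sum_le _ _
        _ = _ := by simp
    rw [inv_mul_le_iff₀ hn']
    refine h1.trans ((Finset.sum_le_sum fun i _ => hlow x i).trans ?_)
    simp
  · change N (A x) ≤ _
    rw [hAsum]
    refine (h.sum_le _ _).trans ?_
    calc ∑ i, N (x i • V i) ≤ ∑ i : Fin n, ‖x‖ := by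
          refine Finset.sum_le_sum fun i _ => ?_
          rw [h.smul]
          calc |x i| * N (V i) ≤ ‖x‖ * 1 := by
                refine mul_le_mul (PiLp.norm_apply_le x i) (hV i trivial) (h.nonneg _) (norm_nonneg _)
            _ = _ := mul_one _
      _ = _ := by simp

/-- The norms that are comparable to the Euclidean norm with prescribed constants. -/
def boundedNorms (n : ℕ) (a b : ℝ) : Set C(EuclideanSpace ℝ (Fin n), ℝ) :=
  {N | IsNorm N ∧ ∀ x, a * ‖x‖ ≤ N x ∧ N x ≤ b * ‖x‖}

lemma isCompact_boundedNorms {a b : ℝ} (ha : 0 < a) : IsCompact (boundedNorms n a b) := by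
  refine ArzelaAscoli.isCompact_of_equicontinuous _ ?_ ?_
  · have himg : ContinuousMap.toFun '' boundedNorms n a b =
        {N : 𝔼 n → ℝ | (∀ x y, N (x + y) ≤ N x + N y) ∧ (∀ (c : ℝ) x, N (c • x) = |c| * N x) ∧
          ∀ x, a * ‖x‖ ≤ N x ∧ N x ≤ b * ‖x‖} := by
      ext N
      constructor
      · rintro ⟨M, ⟨hM, hb⟩, rfl⟩
        exact ⟨hM.add_le, hM.smul, hb⟩
      · rintro ⟨h1, h2, h3⟩
        have hN : IsNorm N := ⟨h1, h2, fun x hx =>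
          lt_of_lt_of_le (mul_pos ha (norm_pos_iff.2 hx)) (h3 x).1⟩
        exact ⟨⟨N, hN.continuous⟩, ⟨hN, h3⟩, rfl⟩
    rw [himg]
    refine IsCompact.of_isClosed_subset (isCompact_univ_pi fun x : 𝔼 n =>
      isCompact_Icc (a := a * ‖x‖) (b := b * ‖x‖)) ?_ fun N hN x _ => hN.2.2 x
    have h1 : IsClosed {N : 𝔼 n → ℝ | ∀ x y, N (x + y) ≤ N x + N y} := by
      simp only [Set.ofPred_forall]
      exact isClosed_iInter fun x => isClosed_iInter fun y => isClosed_le (by fun_prop) (by fun_prop)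
    have h2 : IsClosed {N : 𝔼 n → ℝ | ∀ (c : ℝ) x, N (c • x) = |c| * N x} := by
      simp only [Set.ofPred_forall]
      exact isClosed_iInter fun x => isClosed_iInter fun y => isClosed_eq (by fun_prop) (by fun_prop)
    have h3 : IsClosed {N : 𝔼 n → ℝ | ∀ x, a * ‖x‖ ≤ N x ∧ N x ≤ b * ‖x‖} := by
      simp only [Set.ofPred_forall]
      refine isClosed_iInter fun x => ?_
      have h4 : IsClosed {N : 𝔼 n → ℝ | a * ‖x‖ ≤ N x} := isClosed_le (by fun_prop) (by fun_prop)
      have h5 : IsClosed {N : 𝔼 n → ℝ | N x ≤ b * ‖x‖} := isClosed_le (by fun_prop) (by fun_prop)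
      exact h4.inter h5
    exact h1.inter (h2.inter h3)
  · refine (LipschitzWith.uniformEquicontinuous _ (Real.toNNReal b) ?_).equicontinuous
    rintro ⟨N, hN, hb⟩
    refine LipschitzWith.of_dist_le_mul fun x y => ?_
    have key : ∀ x y, N x - N y ≤ Real.toNNReal b * ‖x - y‖ := fun x y =>
      (hN.sub_le x y).trans ((hb _).2.trans
        (mul_le_mul_of_nonneg_right (Real.le_coe_toNNReal b) (norm_nonneg _)))
    rw [Real.dist_eq, dist_eq_norm]
    refine abs_le.2 ⟨?_, key x y⟩
    have := key y x
    rw [norm_sub_rev] at this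
    change -(_ : ℝ) ≤ N x - N y
    linarith

lemma isNice_tent {N : 𝔼 n → ℝ} (h : IsNorm N) : IsNice fun x => max (1 - N x) 0 :=
  h.isNice_comp (φ := fun s => max (1 - s) 0) (C := 1) (ρ := 1) (ε := 1) (by fun_prop)
    (fun s => le_max_right _ _) (fun s hs => max_le (by linarith) zero_le_one)
    (fun s hs => max_eq_right (by linarith)) one_pos (fun s _ hs => lt_max_of_lt_left (by linarith))

lemma continuousOn_integral_tent_mul {a b : ℝ} (ha : 0 < a) {w : 𝔼 n → ℝ} (hw : Continuous w)
    (hw0 : ∀ x, 0 ≤ w x) :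
    ContinuousOn (fun N : C(𝔼 n, ℝ) => ∫ x, max (1 - N x) 0 * w x) (boundedNorms n a b) := by
  have hM : IsNorm fun x : 𝔼 n => a * ‖x‖ := IsNorm.norm.const_mul ha
  refine continuousOn_of_dominated (bound := fun x => max (1 - a * ‖x‖) 0 * w x) ?_ ?_
    ((isNice_tent hM).integrable_mul hw) ?_
  · intro N _
    exact (by fun_prop : Continuous fun x => max (1 - N x) 0 * w x).aestronglyMeasurable
  · intro N hN
    refine Filter.Eventually.of_forall fun x => ?_
    rw [Real.norm_of_nonneg (mul_nonneg (le_max_right _ _) (hw0 x))]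
    have := (hN.2 x).1
    gcongr
    exact hw0 x
  · exact Filter.Eventually.of_forall fun x =>
      (by fun_prop : Continuous fun N : C(𝔼 n, ℝ) => max (1 - N x) 0 * w x).continuousOn

lemma continuousOn_integral_tent_centroidNorm (hp : 1 ≤ p) {a b : ℝ} (ha : 0 < a) (hb : 0 < b) :
    ContinuousOn (fun N : C(𝔼 n, ℝ) =>
      ∫ ξ, max (1 - centroidNorm p (fun x => max (1 - N x) 0) ξ) 0) (boundedNorms n a b) := by
  have hp0 : 0 < p := by linarith
  have hM : IsNorm fun x : 𝔼 n => b * ‖x‖ := IsNorm.norm.const_mul hb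
  refine continuousOn_of_dominated
    (bound := fun ξ => max (1 - centroidNorm p (fun x => max (1 - b * ‖x‖) 0) ξ) 0) ?_ ?_
    (isNice_tent ((isNice_tent hM).isNorm_centroidNorm hp)).integrable ?_
  · intro N hN
    have := ((isNice_tent hN.1).isNorm_centroidNorm hp).continuous
    exact (by fun_prop : Continuous fun ξ =>
      max (1 - centroidNorm p (fun x => max (1 - N x) 0) ξ) 0).aestronglyMeasurable
  · intro N hN
    refine Filter.Eventually.of_forall fun ξ => ?_
    rw [Real.norm_of_nonneg (le_max_right _ _)]
    refine max_le_max_right _ (sub_le_sub_left ?_ _)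
    have hc := IsNice.continuous_weight hp0.le ξ
    refine Real.rpow_le_rpow (integral_nonneg fun x => by positivity) ?_ (by positivity)
    refine integral_mono ((isNice_tent hM).integrable_mul hc) ((isNice_tent hN.1).integrable_mul hc)
      fun x => ?_
    have := (hN.2 x).2
    dsimp only
    gcongr
  · refine Filter.Eventually.of_forall fun ξ => ?_
    refine (continuousOn_const.sub ?_).sup continuousOn_const
    exact (continuousOn_integral_tent_mul ha (IsNice.continuous_weight hp0.le ξ)
      fun x => by positivity).rpow_const fun _ _ => Or.inr (by positivity)

lemma exists_volProduct_eq (hn : 0 < n) (hp : 1 ≤ p) : ∃ κ : ℝ, 0 < κ ∧ ∀ N : 𝔼 n → ℝ, IsNorm N →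
    (∫ x, max (1 - N x) 0) ^ ((n + p) / p) *
      (∫ ξ, max (1 - centroidNorm p (fun x => max (1 - N x) 0) ξ) 0) = κ * volProduct p N := by
  have hp0 : 0 < p := by linarith
  have hn' : (0 : ℝ) < n := Nat.cast_pos.2 hn
  set φ : ℝ → ℝ := fun s => max (1 - s) 0 with hφ
  have hφm : Measurable φ := by fun_prop
  have hφ0 : ∀ s, 0 ≤ φ s := fun s => le_max_right _ _
  set m := n * radMoment n φ
  set k := (n + p) * radMoment (n + p) φ
  have hm : ∀ N : 𝔼 n → ℝ, IsNorm N → ∫ x, φ (N x) = m * ballVol N := fun N hN =>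
    hN.integral_comp hn hφm hφ0
  have hk : ∀ N : 𝔼 n → ℝ, IsNorm N → ∀ ξ, centroidNorm p (fun x => φ (N x)) ξ ^ p =
      k * ballCentroidNorm p N ξ ^ p := fun N hN ξ =>
    hN.centroidNorm_comp_rpow hn hp0 (isNice_tent hN) hφm hφ0 ξ
  have hm0 : 0 < m := by
    have h1 := (isNice_tent (IsNorm.norm (n := n))).integral_pos
    have h2 := hm _ IsNorm.norm
    have h3 := (IsNorm.norm (n := n)).ballVol_pos
    simp only [hφ] at h2
    rw [h2] at h1
    exact pos_of_mul_pos_left h1 h3.le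
  have hk0 : 0 < k := by
    have hN := IsNorm.norm (n := n)
    set e : 𝔼 n := EuclideanSpace.single ⟨0, hn⟩ 1
    have he : e ≠ 0 := by
      rw [← norm_ne_zero_iff]; simp [e]
    have h1 := ((isNice_tent hN).isNorm_centroidNorm hp).pos e he
    have h2 := hk _ hN e
    have h3 := (hN.isNorm_ballCentroidNorm hp).pos e he
    have h4 : 0 < k * ballCentroidNorm p (fun x : 𝔼 n => ‖x‖) e ^ p := by
      rw [← h2]; exact Real.rpow_pos_of_pos h1 _
    exact pos_of_mul_pos_left h4 (by positivity)
  refine ⟨m ^ ((n + p) / p) * m * (k ^ (1 / p)) ^ (-(n : ℝ)), by positivity, fun N hN => ?_⟩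
  have hc : centroidNorm p (fun x => φ (N x)) = fun ξ => k ^ (1 / p) * ballCentroidNorm p N ξ := by
    funext ξ
    have h5 := ((isNice_tent hN).isNorm_centroidNorm hp).nonneg ξ
    have h6 := (hN.isNorm_ballCentroidNorm hp).nonneg ξ
    rw [← Real.rpow_left_inj h5 (by positivity) hp0.ne', hk N hN, Real.mul_rpow (by positivity) h6,
      ← Real.rpow_mul hk0.le, one_div_mul_cancel hp0.ne', Real.rpow_one]
  have hT := hN.isNorm_ballCentroidNorm hp
  have h1 := hm _ (hT.const_mul (Real.rpow_pos_of_pos hk0 (1 / p)))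
  have h2 : ∫ ξ, max (1 - centroidNorm p (fun x => φ (N x)) ξ) 0 =
      m * ((k ^ (1 / p)) ^ (-(n : ℝ)) * ballVol (ballCentroidNorm p N)) := by
    rw [hc, ← hT.ballVol_const_mul (by positivity), ← h1]
  rw [h2, show ∫ x, max (1 - N x) 0 = m * ballVol N from hm N hN,
    Real.mul_rpow hm0.le hN.ballVol_pos.le, volProduct]
  ring

theorem exists_isMaximalNorm (hn : 0 < n) (hp : 1 ≤ p) : ∃ N : 𝔼 n → ℝ, IsMaximalNorm p N := by
  have hn' : (0 : ℝ) < n := Nat.cast_pos.2 hn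
  obtain ⟨κ, hκ, h⟩ := exists_volProduct_eq hn hp
  have hc := ((continuousOn_integral_tent_mul (n := n) (a := (n : ℝ)⁻¹) (b := n) (inv_pos.2 hn')
    (w := fun _ => 1) continuous_const fun _ => zero_le_one).rpow_const
      (p := (n + p) / p) fun _ _ => Or.inr (by positivity)).mul
    (continuousOn_integral_tent_centroidNorm (n := n) (p := p) hp (inv_pos.2 hn') hn')
  have hne : (boundedNorms n (n : ℝ)⁻¹ n).Nonempty := by
    refine ⟨⟨fun x => ‖x‖, continuous_norm⟩, IsNorm.norm, fun x => ⟨?_, ?_⟩⟩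
    · refine mul_le_of_le_one_left (norm_nonneg x) (inv_le_one_of_one_le₀ ?_)
      exact_mod_cast hn
    · refine le_mul_of_one_le_left (norm_nonneg x) ?_
      exact_mod_cast hn
  obtain ⟨N, hN, hmax⟩ := (isCompact_boundedNorms (inv_pos.2 hn')).exists_isMaxOn hne hc
  refine ⟨N, hN.1, fun M hM => ?_⟩
  obtain ⟨A, hA⟩ := hM.exists_linearEquiv_bounds hn
  have hMA := hM.comp_linearEquiv A
  have hle := hmax (show (⟨fun x => M (A x), hMA.continuous⟩ : C(𝔼 n, ℝ)) ∈ _ from ⟨hMA, hA⟩)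
  simp only [mul_one, Set.mem_ofPred_eq, Pi.mul_apply, ContinuousMap.coe_mk] at hle
  rw [h _ hMA, h _ hN.1, hM.volProduct_comp hp] at hle
  exact le_of_mul_le_mul_left hle hκ

lemma isMaximalNorm_norm (hn : 0 < n) (hp : 1 ≤ p) : IsMaximalNorm p fun x : 𝔼 n => ‖x‖ := by
  obtain ⟨d, rfl⟩ := Nat.exists_eq_succ_of_ne_zero hn.ne'
  obtain ⟨N, hN⟩ := exists_isMaximalNorm hn hp
  exact hN.isMaximalNorm_norm hp

end existence

lemma integral_Ioo_rpow_mul_one_sub_rpow {a b : ℝ} (ha : 0 < a) (hb : 0 < b) :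
    ∫ x in Set.Ioo (0 : ℝ) 1, x ^ (a - 1) * (1 - x) ^ (b - 1) = ProbabilityTheory.beta a b := by
  rw [ProbabilityTheory.beta_eq_betaIntegralReal a b ha hb, Complex.betaIntegral,
    intervalIntegral.integral_of_le (by norm_num), ← integral_Ioc_eq_integral_Ioo,
    ← RCLike.re_eq_complex_re, ← integral_re]
  · refine setIntegral_congr_fun measurableSet_Ioc fun x ⟨hx1, hx2⟩ => ?_
    norm_cast
    rw [← Complex.ofReal_cpow hx1.le, ← Complex.ofReal_cpow (by linarith), RCLike.re_eq_complex_re,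
      Complex.re_mul_ofReal, Complex.ofReal_re]
  · have := Complex.betaIntegral_convergent (u := a) (v := b) (by simpa) (by simpa)
    rwa [intervalIntegrable_iff_integrableOn_Ioc_of_le (by norm_num), IntegrableOn] at this

lemma radMoment_profile {m p α : ℝ} (hm : 0 < m) (hp : 0 < p) (hα : 0 < α) :
    radMoment m (fun s => max (1 - s ^ p) 0 ^ α) = 1 / p * ProbabilityTheory.beta (m / p) (α + 1) := by
  have h := integral_comp_rpow_Ioi_of_pos
    (g := fun y : ℝ => y ^ (m / p - 1) * max (1 - y) 0 ^ α) hp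
  have h1 : ∫ x in Set.Ioi (0 : ℝ), (p * x ^ (p - 1)) •
      ((x ^ p) ^ (m / p - 1) * max (1 - x ^ p) 0 ^ α) =
      p * radMoment m (fun s => max (1 - s ^ p) 0 ^ α) := by
    rw [radMoment, ← integral_const_mul]
    refine setIntegral_congr_fun measurableSet_Ioi fun x hx => ?_
    have hx' : 0 < x := hx
    have : x ^ (m - 1) = x ^ (p - 1) * (x ^ p) ^ (m / p - 1) := by
      rw [← Real.rpow_mul hx'.le, ← Real.rpow_add hx']
      congr 1; field_simp; ring
    simp only [this, smul_eq_mul]; ring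
  have h2 : ∫ y in Set.Ioi (0 : ℝ), y ^ (m / p - 1) * max (1 - y) 0 ^ α =
      ProbabilityTheory.beta (m / p) (α + 1) := by
    rw [← integral_Ioo_rpow_mul_one_sub_rpow (by positivity) (by positivity)]
    rw [← integral_indicator measurableSet_Ioi, ← integral_indicator measurableSet_Ioo]
    congr 1; ext y
    by_cases hy : 0 < y <;> by_cases hy1 : y < 1
    · simp [hy, hy1, max_eq_left (sub_pos.2 hy1).le]
    · simp [hy, hy1, max_eq_right (sub_nonpos.2 (not_lt.1 hy1)), hα.ne']
    · simp [hy]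
    · simp [hy]
  rw [h1, h2] at h
  rw [← h]; field_simp

lemma radMoment_exp_neg_sq {m : ℝ} (hm : 0 < m) :
    radMoment m (fun s => rexp (-s ^ (2 : ℕ))) = Real.Gamma (m / 2) / 2 := by
  have := integral_rpow_mul_exp_neg_rpow (p := 2) (q := m - 1) (by norm_num) (by linarith)
  rw [sub_add_cancel] at this
  rw [radMoment, ← one_div_mul_eq_div, ← this]
  simp

lemma ballVol_norm {n : ℕ} (hn : 0 < n) :
    ballVol (fun x : 𝔼 n => ‖x‖) = π ^ ((n : ℝ) / 2) / Real.Gamma (((n : ℝ) + 2) / 2) := by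
  have hn' : (0 : ℝ) < n := by exact_mod_cast hn
  have h1 := (IsNorm.norm (n := n)).integral_comp hn (φ := fun s => rexp (-s ^ 2)) (by fun_prop)
    fun _ => (exp_pos _).le
  rw [radMoment_exp_neg_sq hn'] at h1
  have h2 := GaussianFourier.integral_rexp_neg_mul_sq_norm (V := 𝔼 n) one_pos
  simp only [neg_mul, one_mul, div_one, finrank_euclideanSpace, Fintype.card_fin] at h2
  rw [h2] at h1
  have h3 : Real.Gamma (((n : ℝ) + 2) / 2) = n / 2 * Real.Gamma (n / 2) := by
    rw [← Real.Gamma_add_one (by positivity)]; congr 1; ring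
  have := Real.Gamma_pos_of_pos (half_pos hn')
  rw [h1, h3]; field_simp

lemma integral_abs_rpow_mul_exp_neg_sq {p : ℝ} (hp : 0 < p) :
    ∫ s : ℝ, |s| ^ p * rexp (-s ^ 2) = Real.Gamma ((p + 1) / 2) := by
  have h := integral_comp_abs (f := fun s => s ^ p * rexp (-s ^ 2))
  simp only [sq_abs] at h
  have h1 := radMoment_exp_neg_sq (m := p + 1) (by linarith)
  rw [radMoment, add_sub_cancel_right] at h1
  rw [h, h1]; ring

lemma integral_abs_inner_rpow_mul_gaussian {d : ℕ} {p : ℝ} (hp : 0 < p) :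
    ∫ x : 𝔼 (d + 1), |⟪x, consE 1 0⟫| ^ p * rexp (-‖x‖ ^ 2) =
      Real.Gamma ((p + 1) / 2) * π ^ ((d : ℝ) / 2) := by
  rw [← integral_consE]
  have h1 : ∀ z : ℝ × (Fin d → ℝ), |⟪consE z.1 z.2, consE 1 0⟫| ^ p * rexp (-‖consE z.1 z.2‖ ^ 2) =
      (|z.1| ^ p * rexp (-z.1 ^ 2)) * ∏ i, rexp (-(z.2 i) ^ 2) := by
    intro z
    rw [inner_consE, ← real_inner_self_eq_norm_sq, inner_consE, ← Real.exp_sum, mul_assoc,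
      ← Real.exp_add]
    congr 2
    · simp
    · simp only [Finset.sum_neg_distrib, neg_add, pow_two]
  simp only [h1]
  rw [integral_prod_mul (fun s : ℝ => |s| ^ p * rexp (-s ^ 2))
    (fun y : Fin d → ℝ => ∏ i, rexp (-(y i) ^ 2)), integral_abs_rpow_mul_exp_neg_sq hp]
  congr 1
  rw [integral_fintype_prod_volume_eq_pow (fun s : ℝ => rexp (-s ^ 2))]
  have := integral_gaussian 1
  simp only [neg_mul, one_mul, div_one] at this
  rw [this, Fintype.card_fin, Real.sqrt_eq_rpow, ← Real.rpow_natCast, ← Real.rpow_mul pi_pos.le]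
  congr 1; ring

/-- The `p`-th power of the constant `ballCentroidNorm p ‖·‖ / ‖·‖`. -/
noncomputable def ballCentroidConst (n : ℕ) (p : ℝ) : ℝ :=
  Real.Gamma ((p + 1) / 2) * π ^ (((n : ℝ) - 1) / 2) / Real.Gamma (((n : ℝ) + p + 2) / 2)

lemma ballCentroidConst_pos (n : ℕ) {p : ℝ} (hp : 0 < p) : 0 < ballCentroidConst n p := by
  have h1 := Real.Gamma_pos_of_pos (show 0 < (p + 1) / 2 by linarith)
  have h2 := Real.Gamma_pos_of_pos (show 0 < ((n : ℝ) + p + 2) / 2 by positivity)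
  have := pi_pos
  unfold ballCentroidConst; positivity

lemma ballCentroidNorm_norm_consE {d : ℕ} {p : ℝ} (hp : 1 ≤ p) :
    ballCentroidNorm p (fun x : 𝔼 (d + 1) => ‖x‖) (consE 1 0) ^ p =
      ballCentroidConst (d + 1) p := by
  have hp0 : 0 < p := by linarith
  have h1 := (IsNorm.norm (n := d + 1)).integral_homogeneous_mul_comp (Nat.succ_pos d) (k := p)
    hp0.le (w := fun x => |⟪x, consE 1 0⟫| ^ p) (φ := fun s => rexp (-s ^ 2))
    (IsNice.continuous_weight hp0.le _).measurable
    (fun _ => by positivity) (fun r hr x => by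
      rw [inner_smul_left, abs_mul, Real.mul_rpow (abs_nonneg _) (abs_nonneg _)]
      simp [abs_of_pos hr]) (by fun_prop) fun _ => (exp_pos _).le
  have h2 : 0 < ((d + 1 : ℕ) : ℝ) + p := by positivity
  have h3 := radMoment_exp_neg_sq h2
  rw [radMoment] at h3
  rw [h3, integral_abs_inner_rpow_mul_gaussian hp0] at h1
  rw [ballCentroidNorm, IsNorm.norm.isNice_ball.centroidNorm_rpow hp0, IsNorm.norm.integral_ball]
  have h4 : Real.Gamma ((((d + 1 : ℕ) : ℝ) + p + 2) / 2) =
      (((d + 1 : ℕ) : ℝ) + p) / 2 * Real.Gamma ((((d + 1 : ℕ) : ℝ) + p) / 2) := by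
    rw [← Real.Gamma_add_one (by positivity)]; congr 1; ring
  have h5 := Real.Gamma_pos_of_pos (half_pos h2)
  have h6 : (((d + 1 : ℕ) : ℝ) - 1) / 2 = d / 2 := by push_cast; ring
  rw [ballCentroidConst, h4, h6, h1]
  field_simp

lemma ballCentroidNorm_norm {n : ℕ} (hn : 0 < n) {p : ℝ} (hp : 1 ≤ p) (ξ : 𝔼 n) :
    ballCentroidNorm p (fun x : 𝔼 n => ‖x‖) ξ = ballCentroidConst n p ^ (1 / p) * ‖ξ‖ := by
  obtain ⟨d, rfl⟩ : ∃ d, n = d + 1 := ⟨n - 1, by omega⟩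
  have hp0 : 0 < p := by linarith
  have hN := (IsNorm.norm (n := d + 1)).isNorm_ballCentroidNorm hp
  rcases eq_or_ne ξ 0 with rfl | hξ
  · simp [hN.zero]
  have hξ' : 0 < ‖ξ‖ := norm_pos_iff.2 hξ
  have he : ‖(consE 1 0 : 𝔼 (d + 1))‖ = 1 := by
    have : ‖(consE 1 0 : 𝔼 (d + 1))‖ ^ 2 = 1 := by
      rw [← real_inner_self_eq_norm_sq, inner_consE]; simp
    nlinarith [norm_nonneg (consE 1 0 : 𝔼 (d + 1))]
  obtain ⟨O, hO⟩ := exists_linearIsometryEquiv_apply (n := d + 1) (e := ‖ξ‖ • consE 1 0) (e' := ξ)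
    (by rw [norm_smul, he]; simp)
  have h1 : ∀ η : 𝔼 (d + 1), ballCentroidNorm p (fun x => ‖x‖) (O η) =
      ballCentroidNorm p (fun x => ‖x‖) η := by
    intro η
    unfold ballCentroidNorm centroidNorm
    rw [← O.measurePreserving.integral_comp O.toHomeomorph.measurableEmbedding]
    simp
  rw [← hO, h1, hN.smul, abs_of_pos hξ', O.norm_map, norm_smul, he,
    ← ballCentroidNorm_norm_consE hp, one_div, Real.rpow_rpow_inv (hN.nonneg _) hp0.ne']
  simp; ring

lemma log_Rnp_add_log_ballCentroidConst {n : ℕ} (hn : 0 < n) {p : ℝ} (hp : 0 < p) :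
    0 < Rnp n p ∧ p * Real.log (Rnp n p) + n * Real.log (ballCentroidConst n p) =
      n * Real.log 2 + (n + 2 * p) * Real.log (ballVol fun x : 𝔼 n => ‖x‖) := by
  have h1 := Real.Gamma_pos_of_pos (show 0 < (p + 1) / 2 by linarith)
  have h2 := Real.Gamma_pos_of_pos (show 0 < ((n : ℝ) + p + 2) / 2 by positivity)
  have h3 := Real.Gamma_pos_of_pos (show 0 < ((n : ℝ) + 2) / 2 by positivity)
  have h4 := pi_pos
  refine ⟨by unfold Rnp; positivity, ?_⟩
  rw [ballVol_norm hn]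
  unfold Rnp ballCentroidConst
  generalize Real.Gamma ((p + 1) / 2) = x at *
  generalize Real.Gamma (((n : ℝ) + p + 2) / 2) = y at *
  generalize Real.Gamma (((n : ℝ) + 2) / 2) = z at *
  simp (disch := positivity) only [Real.log_mul, Real.log_div, Real.log_rpow, Real.log_pow]
  field_simp
  push_cast
  ring

lemma extremal_identity {t L β ω n p C R : ℝ} (ht : 0 < t) (hL : 0 < L) (hβ : 0 < β) (hω : 0 < ω)
    (hp : 0 < p) (hC : 0 < C) (hR : 0 < R) (hn : n = t * p)
    (h : p * Real.log R + n * Real.log C = n * Real.log 2 + (n + 2 * p) * Real.log ω) :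
    (t * ω * β) ^ (n + L * p) =
      2 ^ (-n) * ((n / (n + p)) ^ n *
        (t * (n / (L * p) + 1) ^ (L - 1) * (L * p / n + 1) ^ t * β) ^ p * R ^ p * n ^ p) *
        (t * ω * β * (L / (t + L))) ^ ((L - 1) * p) *
        (n * (((n + p) / p * (β * (t / (t + L))) * C) ^ (-t) * ω)) ^ (-p) := by
  have e1 : n / (n + p) = t / (t + 1) := by rw [hn]; field_simp
  have e2 : n / (L * p) + 1 = (t + L) / L := by rw [hn]; field_simp
  have e3 : L * p / n + 1 = (t + L) / t := by rw [hn]; field_simp; ring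
  have e4 : (n + p) / p = t + 1 := by rw [hn]; field_simp
  have hn0 : 0 < n := by rw [hn]; positivity
  rw [e1, e2, e3, e4]
  apply Real.log_injOn_pos (Set.mem_Ioi.2 (by positivity)) (Set.mem_Ioi.2 (by positivity))
  simp (disch := positivity) only [Real.log_mul, Real.log_div, Real.log_rpow]
  have h' : p * Real.log R = n * Real.log 2 + (n + 2 * p) * Real.log ω - n * Real.log C := by
    linarith
  simp only [mul_add, mul_sub]
  rw [h']
  generalize Real.log n = ln
  subst hn
  ring

/-- The equality case of the inequality, in terms of `centroidNorm`. -/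
def IsExtremal {n : ℕ} (p lam : ℝ) (f : EuclideanSpace ℝ (Fin n) → ℝ) : Prop :=
  (∫ x, f x) ^ ((n : ℝ) + lam / (lam - 1) * p) =
    2 ^ (-(n : ℝ)) * bnpl n p lam * (∫ x, f x ^ lam) ^ ((lam / (lam - 1) - 1) * p) *
      (n * ballVol (centroidNorm p f)) ^ (-p)

lemma IsNice.isExtremal_iff {n : ℕ} (hn : 0 < n) {p lam : ℝ} (hp : 1 ≤ p) (hl : 1 < lam)
    {f : 𝔼 n → ℝ} (hf : IsNice f) :
    IsExtremal p lam f ↔ (∫ x, f x) ^ ((n : ℝ) + (lam / (lam - 1)) * p) =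
      2 ^ (-(n : ℝ)) * bnpl n p lam *
        ((∫ x, |f x| ^ lam) ^ (1 / lam)) ^ ((lam / (lam - 1)) * p) *
        (∫ ξ : Metric.sphere (0 : EuclideanSpace ℝ (Fin n)) 1,
            (∫ x, f x * |⟪x, (ξ : EuclideanSpace ℝ (Fin n))⟫| ^ p) ^ (-(n : ℝ) / p)
          ∂((volume : Measure (EuclideanSpace ℝ (Fin n))).toSphere)) ^ (-p) := by
  have hp0 : 0 < p := by linarith
  have hN := hf.isNorm_centroidNorm hp
  have h1 : ∀ ξ : 𝔼 n, (∫ x, f x * |⟪x, ξ⟫| ^ p) ^ (-(n : ℝ) / p) =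
      centroidNorm p f ξ ^ (-(n : ℝ)) := by
    intro ξ
    rw [← hf.centroidNorm_rpow hp0, ← Real.rpow_mul (hN.nonneg _)]
    congr 1; field_simp
  have h2 : 0 ≤ ∫ x, f x ^ lam := integral_nonneg fun x => Real.rpow_nonneg (hf.nonneg x) _
  have hl1 : lam - 1 ≠ 0 := by linarith
  have hl0 : lam ≠ 0 := by linarith
  simp only [h1, hN.integral_sphere hn, abs_of_nonneg (hf.nonneg _)]
  rw [IsExtremal, ← Real.rpow_mul h2]
  have : 1 / lam * (lam / (lam - 1) * p) = (lam / (lam - 1) - 1) * p := by field_simp; ring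
  rw [this]

section scaling

variable {n : ℕ} {p κ : ℝ} {f : 𝔼 n → ℝ}

lemma IsNice.const_mul (hf : IsNice f) (hκ : 0 < κ) : IsNice fun x => κ * f x where
  nonneg x := mul_nonneg hκ.le (hf.nonneg x)
  integrable := hf.integrable.const_mul κ
  bounded_support := by
    obtain ⟨R, hR⟩ := hf.bounded_support
    exact ⟨R, fun x hx => by rw [hR x hx, mul_zero]⟩
  integral_pos := by rw [integral_const_mul]; exact mul_pos hκ hf.integral_pos

lemma IsNice.ballVol_centroidNorm_const_mul (hf : IsNice f) (hp : 1 ≤ p) (hκ : 0 < κ) :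
    ballVol (centroidNorm p fun x => κ * f x) = κ ^ (-((n : ℝ) / p)) * ballVol (centroidNorm p f) := by
  have h1 : centroidNorm p (fun x => κ * f x) = fun ξ => κ ^ (1 / p) * centroidNorm p f ξ := by
    ext ξ
    simp only [centroidNorm, mul_assoc, integral_const_mul]
    exact Real.mul_rpow hκ.le
      (integral_nonneg fun x => mul_nonneg (hf.nonneg x) (by positivity))
  rw [h1, (hf.isNorm_centroidNorm hp).ballVol_const_mul (by positivity), ← Real.rpow_mul hκ.le]
  congr 2; ring

lemma IsExtremal.const_mul_comp {lam : ℝ} (h : IsExtremal p lam f) (hf : IsNice f) (hp : 1 ≤ p)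
    (hl : 1 < lam) (hfl : 0 < ∫ x, f x ^ lam) (hn : 0 < n) (hκ : 0 < κ) (A : 𝔼 n ≃ₗ[ℝ] 𝔼 n) :
    IsExtremal p lam fun x => κ * f (A x) := by
  have hp0 : 0 < p := by linarith
  have ha := absDet_pos A
  have hV := (hf.isNorm_centroidNorm hp).ballVol_pos
  have hI := hf.integral_pos
  have hn0 : (0 : ℝ) < n := by exact_mod_cast hn
  have hl1 : lam - 1 ≠ 0 := by linarith
  unfold IsExtremal at h ⊢
  have h1 : ∀ x, (κ * f (A x)) ^ lam = κ ^ lam * f (A x) ^ lam := fun x =>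
    Real.mul_rpow hκ.le (hf.nonneg _)
  simp only [h1]
  rw [(hf.comp_linearEquiv A).ballVol_centroidNorm_const_mul hp hκ,
    ballVol_centroidNorm_comp_linearEquiv hf hp A, integral_const_mul, integral_const_mul,
    integral_comp_linearEquiv A f, integral_comp_linearEquiv A fun x => f x ^ lam]
  generalize absDet A = a at *
  generalize ballVol (centroidNorm p f) = V at *
  generalize ∫ x, f x = I at *
  generalize ∫ x, f x ^ lam = J at *
  have e1 : (κ * (a⁻¹ * I)) ^ ((n : ℝ) + lam / (lam - 1) * p) =
      (κ * a⁻¹) ^ ((n : ℝ) + lam / (lam - 1) * p) * I ^ ((n : ℝ) + lam / (lam - 1) * p) := by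
    rw [← Real.mul_rpow (by positivity) hI.le, mul_assoc]
  have e2 : (κ * a⁻¹) ^ ((n : ℝ) + lam / (lam - 1) * p) =
      (κ ^ lam * a⁻¹) ^ ((lam / (lam - 1) - 1) * p) *
        (κ ^ (-((n : ℝ) / p)) * a ^ (((n : ℝ) + p) / p)) ^ (-p) := by
    apply Real.log_injOn_pos (Set.mem_Ioi.2 (by positivity)) (Set.mem_Ioi.2 (by positivity))
    simp (disch := positivity) only [Real.log_mul, Real.log_inv, Real.log_rpow]
    field_simp
    ring
  have e3 : (κ ^ lam * (a⁻¹ * J)) ^ ((lam / (lam - 1) - 1) * p) =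
      (κ ^ lam * a⁻¹) ^ ((lam / (lam - 1) - 1) * p) * J ^ ((lam / (lam - 1) - 1) * p) := by
    rw [← Real.mul_rpow (by positivity) hfl.le, mul_assoc]
  have e4 : (n * (κ ^ (-((n : ℝ) / p)) * (a ^ (((n : ℝ) + p) / p) * V))) ^ (-p) =
      (κ ^ (-((n : ℝ) / p)) * a ^ (((n : ℝ) + p) / p)) ^ (-p) * (n * V) ^ (-p) := by
    rw [← Real.mul_rpow (by positivity) (by positivity)]; congr 1; ring
  rw [e1, e2, e3, e4, h]
  ring

end scaling

section profile

variable {n : ℕ} {p lam q : ℝ}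

lemma measurable_profile (p q : ℝ) : Measurable fun s : ℝ => max (1 - s ^ p) 0 ^ q := by
  fun_prop

lemma profile_nonneg (p q s : ℝ) : 0 ≤ max (1 - s ^ p) 0 ^ q :=
  Real.rpow_nonneg (le_max_right _ _) _

lemma IsNorm.isNice_profile {N : 𝔼 n → ℝ} (h : IsNorm N) (hp : 0 < p) (hq : 0 < q) :
    IsNice fun x => max (1 - N x ^ p) 0 ^ q := by
  refine h.isNice_comp (φ := fun s => max (1 - s ^ p) 0 ^ q) (C := 1) (ρ := 1) (ε := 1)
    (measurable_profile p q) (profile_nonneg p q) (fun s hs => ?_) (fun s hs => ?_) one_pos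
    fun s hs hs1 => ?_
  · refine Real.rpow_le_one (le_max_right _ _) (max_le ?_ zero_le_one) hq.le
    linarith [Real.rpow_nonneg hs p]
  · have := Real.one_lt_rpow hs hp
    simp only [max_eq_right (show 1 - s ^ p ≤ 0 by linarith), Real.zero_rpow hq.ne']
  · have := Real.rpow_lt_one hs hs1 hp
    exact Real.rpow_pos_of_pos (lt_max_of_lt_left (by linarith)) _

lemma beta_add_one_right {a b : ℝ} (ha : 0 < a) (hb : 0 < b) :
    ProbabilityTheory.beta a (b + 1) = ProbabilityTheory.beta a b * (b / (a + b)) := by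
  unfold ProbabilityTheory.beta
  have := Real.Gamma_pos_of_pos (add_pos ha hb)
  rw [← add_assoc, Real.Gamma_add_one hb.ne', Real.Gamma_add_one (add_pos ha hb).ne']
  field_simp

lemma beta_add_one_left {a b : ℝ} (ha : 0 < a) (hb : 0 < b) :
    ProbabilityTheory.beta (a + 1) b = ProbabilityTheory.beta a b * (a / (a + b)) := by
  unfold ProbabilityTheory.beta
  have := Real.Gamma_pos_of_pos (add_pos ha hb)
  rw [add_right_comm, Real.Gamma_add_one ha.ne', Real.Gamma_add_one (add_pos ha hb).ne']
  field_simp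

lemma profile_rpow (s : ℝ) :
    (max (1 - s ^ p) 0 ^ (1 / (lam - 1))) ^ lam = max (1 - s ^ p) 0 ^ (lam / (lam - 1)) := by
  rw [← Real.rpow_mul (le_max_right _ _)]; congr 1; ring

lemma isExtremal_profile_norm (hn : 0 < n) (hp : 1 ≤ p) (hl : 1 < lam) :
    IsExtremal p lam fun x : 𝔼 n => max (1 - ‖x‖ ^ p) 0 ^ (1 / (lam - 1)) := by
  have hp0 : 0 < p := by linarith
  have hn0 : (0 : ℝ) < n := by exact_mod_cast hn
  have hq : 0 < 1 / (lam - 1) := one_div_pos.2 (by linarith)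
  have hL : 1 / (lam - 1) + 1 = lam / (lam - 1) := by
    have : lam - 1 ≠ 0 := by linarith
    field_simp; ring
  have hL0 : 0 < lam / (lam - 1) := by linarith
  have ht : 0 < (n : ℝ) / p := by positivity
  have hN := IsNorm.norm (n := n)
  have hnice := hN.isNice_profile hp0 hq
  have hβ := ProbabilityTheory.beta_pos ht hL0
  have hω := hN.ballVol_pos
  have hC := ballCentroidConst_pos n hp0
  obtain ⟨hR, hlog⟩ := log_Rnp_add_log_ballCentroidConst hn hp0
  have h1 := hN.integral_comp hn (measurable_profile p (1 / (lam - 1))) (profile_nonneg p _)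
  rw [radMoment_profile hn0 hp0 hq, hL] at h1
  have h2 := hN.integral_comp hn (measurable_profile p (lam / (lam - 1))) (profile_nonneg p _)
  rw [radMoment_profile hn0 hp0 hL0, beta_add_one_right ht hL0] at h2
  have h3 : ballVol (centroidNorm p fun x : 𝔼 n => max (1 - ‖x‖ ^ p) 0 ^ (1 / (lam - 1))) =
      ((n + p) / p * (ProbabilityTheory.beta (n / p) (lam / (lam - 1)) *
        (n / p / (n / p + lam / (lam - 1)))) * ballCentroidConst n p) ^ (-(n / p : ℝ)) *
        ballVol fun x : 𝔼 n => ‖x‖ := by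
    have h4 : centroidNorm p (fun x : 𝔼 n => max (1 - ‖x‖ ^ p) 0 ^ (1 / (lam - 1))) = fun ξ =>
        ((n + p) / p * (ProbabilityTheory.beta (n / p) (lam / (lam - 1)) *
        (n / p / (n / p + lam / (lam - 1)))) * ballCentroidConst n p) ^ (1 / p) * ‖ξ‖ := by
      ext ξ
      have h5 := hN.centroidNorm_comp_rpow hn hp0 (φ := fun s => max (1 - s ^ p) 0 ^ (1 / (lam - 1)))
        hnice (measurable_profile p _) (profile_nonneg p _) ξ
      have h6 := radMoment_profile (m := n + p) (p := p) (by positivity) hp0 hq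
      have h7 : ((n : ℝ) + p) / p = n / p + 1 := by field_simp
      rw [h7, hL, beta_add_one_left ht hL0] at h6
      rw [h6, ballCentroidNorm_norm hn hp, Real.mul_rpow (by positivity) (norm_nonneg _),
        ← Real.rpow_mul hC.le, one_div_mul_cancel hp0.ne', Real.rpow_one] at h5
      rw [← Real.rpow_rpow_inv ((hnice.isNorm_centroidNorm hp).nonneg ξ) hp0.ne', h5]
      rw [← mul_assoc, Real.mul_rpow (by positivity) (by positivity),
        Real.rpow_rpow_inv (norm_nonneg _) hp0.ne', one_div p]
      congr 2; ring
    rw [h4, hN.ballVol_const_mul (by positivity), ← Real.rpow_mul (by positivity)]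
    congr 2; ring
  unfold IsExtremal
  simp only [profile_rpow]
  rw [h1, h2, h3]
  have := extremal_identity ht hL0 hβ hω hp0 hC hR (by field_simp) hlog
  convert this using 1
  · congr 1; field_simp
  · rw [bnpl, anpl]
    congr 2
    congr 1
    field_simp

end profile

section extremizers

variable {n : ℕ} {p lam : ℝ} {f : 𝔼 n → ℝ}

lemma Continuous.isNice (hf : Continuous f) (h0 : ∀ x, 0 ≤ f x) (hs : HasCompactSupport f)
    (hne : f ≠ 0) : IsNice f where
  nonneg := h0
  integrable := hf.integrable_of_hasCompactSupport hs
  bounded_support := by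
    obtain ⟨R, hR⟩ := hs.isCompact.isBounded.subset_closedBall 0
    refine ⟨R, fun x hx => image_eq_zero_of_notMem_tsupport fun h => ?_⟩
    have := hR h
    rw [mem_closedBall_zero_iff] at this
    linarith
  integral_pos := by
    obtain ⟨x, hx⟩ := Function.ne_iff.1 hne
    exact hf.integral_pos_of_hasCompactSupport_nonneg_nonzero hs h0 hx

lemma Continuous.isNice_rpow (hf : Continuous f) (h0 : ∀ x, 0 ≤ f x) (hs : HasCompactSupport f)
    (hne : f ≠ 0) (hl : 0 < lam) : IsNice fun x => f x ^ lam := by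
  refine (hf.rpow_const fun x => Or.inr hl.le).isNice (fun x => Real.rpow_nonneg (h0 x) _)
    (hs.comp_left (g := fun s : ℝ => s ^ lam) (Real.zero_rpow hl.ne')) fun h => hne ?_
  ext x
  have := congrFun h x
  rwa [Pi.zero_apply, Real.rpow_eq_zero (h0 x) hl.ne'] at this

lemma IsExtremal.ballVol_centroidNorm_eq {g : 𝔼 n → ℝ} (hn : 0 < n) (hp : 1 ≤ p)
    (hf : IsExtremal p lam f) (hg : IsExtremal p lam g) (hfn : IsNice f) (hgn : IsNice g)
    (h1 : ∫ x, f x = ∫ x, g x) (h2 : ∫ x, f x ^ lam = ∫ x, g x ^ lam) :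
    ballVol (centroidNorm p f) = ballVol (centroidNorm p g) := by
  have hn0 : (0 : ℝ) < n := by exact_mod_cast hn
  have hVf := (hfn.isNorm_centroidNorm hp).ballVol_pos
  have hVg := (hgn.isNorm_centroidNorm hp).ballVol_pos
  unfold IsExtremal at hf hg
  have hpos := Real.rpow_pos_of_pos hgn.integral_pos ((n : ℝ) + lam / (lam - 1) * p)
  rw [h1, h2, hg] at hf
  rw [hg] at hpos
  have h3 := mul_left_cancel₀ (left_ne_zero_of_mul hpos.ne') hf
  have h4 := Real.rpow_left_injOn (x := -p) (by linarith) (Set.mem_Ici.2 (by positivity))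
    (Set.mem_Ici.2 (by positivity)) h3
  exact (mul_left_cancel₀ hn0.ne' h4).symm

lemma IsMaximalNorm.exists_ballCentroidNorm_eq {N : 𝔼 n → ℝ} (hN : IsMaximalNorm p N) (hn : 0 < n)
    (hp : 1 ≤ p) {μ : ℝ} (hμ : 0 < μ) :
    ∃ A : 𝔼 n ≃ₗ[ℝ] 𝔼 n, ∀ x, μ * ballCentroidNorm p N x = ‖A x‖ := by
  obtain ⟨d, rfl⟩ : ∃ d, n = d + 1 := ⟨n - 1, by omega⟩
  obtain ⟨A, hA⟩ := hN.exists_linearEquiv_comp_eq_norm hp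
  obtain ⟨B, -, hAB⟩ := exists_adjoint_symm A.symm
  have hNA : N = fun x => ‖A.symm x‖ := by
    ext x; rw [← hA, LinearEquiv.apply_symm_apply]
  have hc := ballCentroidConst_pos (d + 1) (show 0 < p by linarith)
  have ha := absDet_pos A.symm
  set c := μ * absDet A.symm ^ (-(1 / p)) * ballCentroidConst (d + 1) p ^ (1 / p) with hcdef
  have hc0 : 0 < c := by positivity
  refine ⟨B.trans (scaleEquiv (d + 1) hc0), fun x => ?_⟩
  have h1 := centroidNorm_comp_linearEquiv (IsNorm.norm (n := d + 1)).isNice_ball hp hAB x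
  have h2 : ballCentroidNorm p N x = absDet A.symm ^ (-(1 / p)) *
      ballCentroidNorm p (fun x : 𝔼 (d + 1) => ‖x‖) (B x) := by rw [hNA]; exact h1
  rw [LinearEquiv.trans_apply, scaleEquiv_apply, norm_smul, Real.norm_of_nonneg hc0.le, h2,
    ballCentroidNorm_norm hn hp, hcdef]
  ring

theorem IsExtremal.exists_eq_profile (hn : 0 < n) (hp : 1 ≤ p) (hl : 1 < lam)
    (hf : IsExtremal p lam f) (hc : Continuous f) (hfn : IsNice f)
    (hfl : Integrable fun x => f x ^ lam)
    (h1 : ∫ x, f x = ∫ x : 𝔼 n, max (1 - ‖x‖ ^ p) 0 ^ (1 / (lam - 1)))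
    (h2 : ∫ x, f x ^ lam = ∫ x : 𝔼 n, (max (1 - ‖x‖ ^ p) 0 ^ (1 / (lam - 1))) ^ lam) :
    ∃ A : 𝔼 n ≃ₗ[ℝ] 𝔼 n, ∀ x, f x = max (1 - ‖A x‖ ^ p) 0 ^ (1 / (lam - 1)) := by
  have hp0 : 0 < p := by linarith
  have hq : 0 < 1 / (lam - 1) := one_div_pos.2 (by linarith)
  have hL : 0 < lam / (lam - 1) := div_pos (by linarith) (by linarith)
  have hMn := IsNorm.norm (n := n)
  have hcomp : ∀ H : 𝔼 n → ℝ, IsNorm H → ballVol H = ballVol (fun x : 𝔼 n => ‖x‖) →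
      ∫ x, max (1 - H x ^ p) 0 ^ (1 / (lam - 1)) * H x ^ p ≤ ∫ x, f x * H x ^ p ∧
      (∫ x, f x * H x ^ p = ∫ x, max (1 - H x ^ p) 0 ^ (1 / (lam - 1)) * H x ^ p →
        f =ᵐ[volume] fun x => max (1 - H x ^ p) 0 ^ (1 / (lam - 1))) := by
    intro H hH hHv
    have hHp : Continuous fun x => H x ^ p := hH.continuous.rpow_const fun _ => Or.inr hp0.le
    have hprof := hH.isNice_profile hp0 hq
    refine integral_profile_mul_le hl one_pos (by simp only [one_mul]) hfn.nonneg hfn.integrable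
      hprof.integrable hfl ?_ (hfn.integrable_mul hHp) (hprof.integrable_mul hHp) ?_ ?_
    · simp only [profile_rpow]
      exact (hH.isNice_profile hp0 hL).integrable
    · rw [h1, hH.integral_comp hn (measurable_profile p _) (profile_nonneg p _),
        hMn.integral_comp hn (measurable_profile p _) (profile_nonneg p _), hHv]
    · rw [h2]
      simp only [profile_rpow]
      rw [hH.integral_comp hn (measurable_profile p _) (profile_nonneg p _),
        hMn.integral_comp hn (measurable_profile p _) (profile_nonneg p _), hHv]
  have hprof := hMn.isNice_profile hp0 hq
  have hV := hf.ballVol_centroidNorm_eq hn hp (isExtremal_profile_norm hn hp hl) hfn hprof h1 h2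
  obtain ⟨hmax, μ, hμ, hv, he⟩ := ((isMaximalNorm_norm hn hp).ballVol_centroidNorm_le hn hp hfn
    (measurable_profile p (1 / (lam - 1))) (profile_nonneg p _) hprof
    fun H hH hHv => (hcomp H hH hHv).1).2 hV
  have hT := (hmax.isNorm.isNorm_ballCentroidNorm hp).const_mul hμ
  have hae := (hcomp _ hT hv).2 he
  obtain ⟨A, hA⟩ := hmax.exists_ballCentroidNorm_eq hn hp hμ
  refine ⟨A, fun x => ?_⟩
  have hcont : Continuous fun x => max (1 - (μ * ballCentroidNorm p (centroidNorm p f) x) ^ p) 0 ^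
      (1 / (lam - 1)) := by
    refine Continuous.rpow_const (Continuous.max (continuous_const.sub
      (hT.continuous.rpow_const fun _ => Or.inr hp0.le)) continuous_const) fun _ => Or.inr hq.le
  rw [← hA]
  exact congrFun ((hc.ae_eq_iff_eq volume hcont).1 hae) x

lemma exists_matrix_of_linearEquiv (A : 𝔼 n ≃ₗ[ℝ] 𝔼 n) :
    ∃ B : Matrix (Fin n) (Fin n) ℝ, IsUnit B.det ∧ ∀ x, matApply B x = A x := by
  let e := (EuclideanSpace.equiv (Fin n) ℝ).toLinearEquiv
  let A' := (e.symm.trans A).trans e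
  refine ⟨LinearMap.toMatrix' (A' : (Fin n → ℝ) →ₗ[ℝ] (Fin n → ℝ)), ?_, fun x => ?_⟩
  · rw [LinearMap.det_toMatrix']
    exact LinearEquiv.isUnit_det' A'
  · rw [matApply, LinearMap.toMatrix'_mulVec]
    simp [A', e]

lemma exists_linearEquiv_of_matrix {B : Matrix (Fin n) (Fin n) ℝ} (hB : IsUnit B.det) :
    ∃ A : 𝔼 n ≃ₗ[ℝ] 𝔼 n, ∀ x, matApply B x = A x := by
  let e := (EuclideanSpace.equiv (Fin n) ℝ).toLinearEquiv
  let A' := (e.trans (Matrix.toLinearEquiv' B (B.invertibleOfIsUnitDet hB))).trans e.symm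
  exact ⟨A', fun x => rfl⟩

end extremizers

/-- Equality case of the symmetric functional `L_p` Blaschke–Santaló inequality for
`λ ∈ (1, ∞)`: equality holds iff `f(x) = a (1 - |Bx|^p)₊^{1/(λ-1)}` for some `a > 0`
and invertible matrix `B`. -/
theorem functional_BS_symmetric_equality_case (n : ℕ) (hn : 2 ≤ n) (p : ℝ) (hp : 1 ≤ p)
    (lam : ℝ) (hlam : 1 < lam)
    (f : EuclideanSpace ℝ (Fin n) → ℝ) (hf_cont : Continuous f)
    (hf_nonneg : ∀ x, 0 ≤ f x) (hf_supp : HasCompactSupport f) (hf_ne : f ≠ 0) :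
    (∫ x, f x) ^ ((n : ℝ) + (lam / (lam - 1)) * p) =
      2 ^ (-(n : ℝ)) * bnpl n p lam *
        ((∫ x, |f x| ^ lam) ^ (1 / lam)) ^ ((lam / (lam - 1)) * p) *
        (∫ ξ : Metric.sphere (0 : EuclideanSpace ℝ (Fin n)) 1,
            (∫ x, f x * |⟪x, (ξ : EuclideanSpace ℝ (Fin n))⟫| ^ p) ^ (-(n : ℝ) / p)
          ∂((volume : Measure (EuclideanSpace ℝ (Fin n))).toSphere)) ^ (-p) ↔
      ∃ a : ℝ, 0 < a ∧ ∃ B : Matrix (Fin n) (Fin n) ℝ, IsUnit B.det ∧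
        ∀ x, f x = a * (max (1 - ‖matApply B x‖ ^ p) 0) ^ (1 / (lam - 1)) := by
  have hn0 : 0 < n := by omega
  have hnR : (0 : ℝ) < n := by exact_mod_cast hn0
  have hp0 : 0 < p := by linarith
  have hl1 : 0 < lam - 1 := by linarith
  have hfn := hf_cont.isNice hf_nonneg hf_supp hf_ne
  have hfln := hf_cont.isNice_rpow hf_nonneg hf_supp hf_ne (show 0 < lam by linarith)
  have hprof := (IsNorm.norm (n := n)).isNice_profile hp0 (one_div_pos.2 hl1)
  have hprofl := (IsNorm.norm (n := n)).isNice_profile hp0 (q := lam / (lam - 1))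
    (div_pos (by linarith) hl1)
  rw [← hfn.isExtremal_iff hn0 hp hlam]
  have hI := hprof.integral_pos
  have hJ := hprofl.integral_pos
  simp only [← profile_rpow] at hJ
  constructor
  · intro h
    have hF := hfn.integral_pos
    have hG := hfln.integral_pos
    set F := ∫ x, f x with hFdef
    set G := ∫ x, f x ^ lam with hGdef
    set I := ∫ x : 𝔼 n, max (1 - ‖x‖ ^ p) 0 ^ (1 / (lam - 1)) with hIdef
    set J := ∫ x : 𝔼 n, (max (1 - ‖x‖ ^ p) 0 ^ (1 / (lam - 1))) ^ lam with hJdef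
    set κ := (J * F / (G * I)) ^ (1 / (lam - 1)) with hκdef
    have hκ : 0 < κ := by positivity
    have hκl : κ ^ (lam - 1) = J * F / (G * I) := by
      rw [hκdef, ← Real.rpow_mul (by positivity), one_div_mul_cancel hl1.ne', Real.rpow_one]
    set a := κ * F / I with hadef
    have ha : 0 < a := by positivity
    have hs : 0 < a ^ (1 / (n : ℝ)) := by positivity
    set S := scaleEquiv n hs with hSdef
    have hSa : absDet S = a := by
      rw [hSdef, absDet_scaleEquiv, ← Real.rpow_mul ha.le, one_div_mul_cancel hnR.ne', Real.rpow_one]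
    have hg := h.const_mul_comp hfn hp hlam hG hn0 hκ S
    have hrpow : ∀ x, (κ * f (S x)) ^ lam = κ ^ lam * f (S x) ^ lam := fun x =>
      Real.mul_rpow hκ.le (hf_nonneg _)
    have hκ' : κ ^ lam = κ * (J * F / (G * I)) := by
      rw [← hκl, ← Real.rpow_one_add' hκ.le (by linarith)]; congr 1; ring
    have hScont : Continuous S := S.toLinearMap.continuous_of_finiteDimensional
    obtain ⟨A, hA⟩ := hg.exists_eq_profile hn0 hp hlam (continuous_const.mul (hf_cont.comp hScont))
      ((hfn.comp_linearEquiv S).const_mul hκ)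
      (by simp only [hrpow]; exact ((hfln.comp_linearEquiv S).const_mul (by positivity)).integrable)
      (by rw [integral_const_mul, integral_comp_linearEquiv S f, hSa, ← hFdef, ← hIdef, hadef]
          field_simp)
      (by simp only [hrpow]
          rw [integral_const_mul, integral_comp_linearEquiv S fun x => f x ^ lam, hSa, ← hGdef,
            ← hJdef, hκ', hadef]
          field_simp)
    obtain ⟨B, hB, hBA⟩ := exists_matrix_of_linearEquiv (S.symm.trans A)
    refine ⟨κ⁻¹, inv_pos.2 hκ, B, hB, fun x => ?_⟩
    have := hA (S.symm x)
    rw [LinearEquiv.apply_symm_apply] at this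
    rw [hBA, LinearEquiv.trans_apply, ← this]
    field_simp
  · rintro ⟨a, ha, B, hB, h⟩
    obtain ⟨A, hA⟩ := exists_linearEquiv_of_matrix hB
    simp only [hA] at h
    rw [show f = fun x => a * max (1 - ‖A x‖ ^ p) 0 ^ (1 / (lam - 1)) from funext h]
    exact (isExtremal_profile_norm hn0 hp hlam).const_mul_comp hprof hp hlam hJ hn0 ha A
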